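/- Assume in addition that K is a finite extension of ℚ_p with d = [K:ℚ_p] and with exactly q p-power roots of unity, where q ≥ 3 (this forces d to be even), that L contains at least q p-power roots of unity, and that n ≥ 2. Then the ring R[1/p] is normal: for every prime ideal P of R[1/p], the localization of R[1/p] at P is an integral domain that is integrally closed in its fraction field. In particular, the connected components of Spec R[1/p] are irreducible. -/

import Mathlib

set_option synthInstance.maxHeartbeats 1000000
set_option maxHeartbeats 1000000

noncomputable section

/-- The ring of integers of `L`: the integral closure of `ℤ_[p]` in `L`. -/
abbrev RingOfIntegers (p : ℕ) [Fact p.Prime] (L : Type*) [Field L] [Algebra ℤ_[p] L] :=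
  integralClosure ℤ_[p] L

/-- The matrix of variables `X_k` inside the multivariate power series ring. -/
def varMatrix {A : Type*} [CommRing A] (N n : ℕ) (k : Fin N) :
    Matrix (Fin n) (Fin n) (MvPowerSeries (Fin N × Fin n × Fin n) A) :=
  Matrix.of fun i j => MvPowerSeries.X (k, i, j)

/-- `X̃_k = I + X_k`. -/
def Xt {A : Type*} [CommRing A] (N n : ℕ) (k : Fin N) :
    Matrix (Fin n) (Fin n) (MvPowerSeries (Fin N × Fin n × Fin n) A) :=
  1 + varMatrix N n k

/-- Commutator `[A, B] = A B A⁻¹ B⁻¹` of square matrices. -/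
def matComm {R : Type*} [CommRing R] {n : ℕ} (A B : Matrix (Fin n) (Fin n) R) :
    Matrix (Fin n) (Fin n) R :=
  A * B * A⁻¹ * B⁻¹

/-- The Demuškin relation matrix
`X̃_1^q ⬝ [X̃_1, X̃_2] ⬝ [X̃_3, X̃_4] ⋯ [X̃_{d+1}, X̃_{d+2}]` with `d = 2m`. -/
def relMatrix {A : Type*} [CommRing A] (q m n : ℕ) :
    Matrix (Fin n) (Fin n) (MvPowerSeries (Fin (2 * m + 2) × Fin n × Fin n) A) :=
  (Xt (2 * m + 2) n ⟨0, by omega⟩) ^ q *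
    (List.ofFn (fun i : Fin (m + 1) =>
      matComm (Xt (2 * m + 2) n ⟨2 * i, by have := i.isLt; omega⟩)
        (Xt (2 * m + 2) n ⟨2 * i + 1, by have := i.isLt; omega⟩))).prod

/-- The ideal generated by the `n²` entries of the relation matrix minus the identity. -/
def relIdeal {A : Type*} [CommRing A] (q m n : ℕ) :
    Ideal (MvPowerSeries (Fin (2 * m + 2) × Fin n × Fin n) A) :=
  Ideal.span (Set.range fun ij : Fin n × Fin n =>
    (relMatrix (A := A) q m n - 1) ij.1 ij.2)

/-- The universal framed deformation ring `R = S / I_rel`. -/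
abbrev defRing {A : Type*} [CommRing A] (q m n : ℕ) :=
  MvPowerSeries (Fin (2 * m + 2) × Fin n × Fin n) A ⧸ relIdeal (A := A) q m n

/-- The scheme-theoretic generic fiber `R[1/p]` of the framed deformation space. -/
def genericFiberRing (p : ℕ) (A : Type*) [CommRing A] (q m n : ℕ) : Type _ :=
  Localization.Away (p : defRing (A := A) q m n)

instance (p : ℕ) (A : Type*) [CommRing A] (q m n : ℕ) :
    CommRing (genericFiberRing p A q m n) :=
  inferInstanceAs (CommRing (Localization _))

instance (p : ℕ) (A : Type*) [CommRing A] (q m n : ℕ) :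
    Algebra (defRing (A := A) q m n) (genericFiberRing p A q m n) :=
  inferInstanceAs (Algebra _ (Localization _))

/-- Elementwise form of complete integral closedness of a domain. -/
def CompletelyIntClosed (A : Type*) [CommRing A] : Prop :=
  ∀ a b d : A, b ≠ 0 → d ≠ 0 → (∀ m : ℕ, b ^ m ∣ d * a ^ m) → b ∣ a

theorem completelyIntClosed_of_isIntegrallyClosed (A : Type*) [CommRing A] [IsDomain A]
    [IsNoetherianRing A] [IsIntegrallyClosed A] : CompletelyIntClosed A := by
  intro a b d hb hd h
  have hb' : algebraMap A (FractionRing A) b ≠ 0 := by simpa using hb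
  have key : IsAlmostIntegral A (algebraMap A (FractionRing A) a / algebraMap A (FractionRing A) b) := by
    refine ⟨d, by simpa using hd, fun m => ?_⟩
    obtain ⟨c, hc⟩ := h m
    refine ⟨c, ?_⟩
    rw [Algebra.smul_def, div_pow, ← mul_div_assoc, eq_div_iff (pow_ne_zero _ hb'), ← map_pow,
      ← map_pow, ← map_mul, ← map_mul, hc, mul_comm]
  obtain ⟨y, hy⟩ := (isIntegrallyClosed_iff (FractionRing A)).1 inferInstance key.isIntegral
  refine ⟨y, ?_⟩
  rw [eq_div_iff hb', ← map_mul] at hy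
  rw [← IsFractionRing.injective A (FractionRing A) hy, mul_comm]

theorem CompletelyIntClosed.isIntegrallyClosed {A : Type*} [CommRing A] [IsDomain A]
    (h : CompletelyIntClosed A) : IsIntegrallyClosed A := by
  rw [isIntegrallyClosed_iff (FractionRing A)]
  intro x hx
  obtain ⟨d, hd, hd'⟩ := hx.isAlmostIntegral
  obtain ⟨a, b, hb, rfl⟩ := IsFractionRing.div_surjective (A := A) x
  have hb0 : b ≠ 0 := nonZeroDivisors.ne_zero hb
  have hb' : algebraMap A (FractionRing A) b ≠ 0 := by simpa using hb0
  obtain ⟨y, rfl⟩ : b ∣ a := by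
    refine h a b d hb0 (nonZeroDivisors.ne_zero hd) fun m => ?_
    obtain ⟨c, hc⟩ := hd' m
    refine ⟨c, ?_⟩
    change algebraMap A (FractionRing A) c = _ at hc
    rw [Algebra.smul_def, div_pow, ← mul_div_assoc, eq_div_iff (pow_ne_zero _ hb'), ← map_pow,
      ← map_pow, ← map_mul, ← map_mul] at hc
    rw [← IsFractionRing.injective A (FractionRing A) hc, mul_comm]
  exact ⟨y, by rw [map_mul, mul_div_cancel_left₀ _ hb']⟩

theorem dvd_of_dvd_pow_of_reduced {R : Type*} [CommRing R] {h : R}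
    (H : ∀ r, h ∣ r ^ 2 → h ∣ r) {r : R} {m : ℕ} (hm : h ∣ r ^ m) : h ∣ r := by
  induction m using Nat.strong_induction_on with
  | _ m ih =>
    rcases Nat.lt_or_ge m 2 with h2 | h2
    · interval_cases m
      · exact (by simpa using hm : h ∣ 1).trans (one_dvd r)
      · simpa using hm
    · have : h ∣ r ^ ((m + 1) / 2) := by
        apply H
        rw [← pow_mul]
        exact hm.trans (pow_dvd_pow _ (by omega))
      exact ih _ (by omega) this

/-- Division by one factor at a time: an element integral over `R` with denominator a product of
elements generating radical ideals lies in `R`. -/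
theorem exists_algebraMap_eq_of_closure {R F : Type*} [CommRing R] [CommRing F] [Algebra R F]
    (hinj : Function.Injective (algebraMap R F)) {H : Set R}
    (h1 : ∀ h ∈ H, algebraMap R F h ∈ nonZeroDivisors F)
    (h2 : ∀ h ∈ H, ∀ r, h ∣ r ^ 2 → h ∣ r) {g : R} (hg : g ∈ Submonoid.closure H) :
    ∀ (x : F) (r : R), IsIntegral R x → algebraMap R F g * x = algebraMap R F r →
      ∃ y, algebraMap R F y = x := by
  induction hg using Submonoid.closure_induction with
  | one => intro x r _ h; exact ⟨r, by simpa using h.symm⟩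
  | mul a b ha hb iha ihb =>
    intro x r hx h
    rw [map_mul, mul_assoc] at h
    obtain ⟨y, hy⟩ := iha _ r ((isIntegral_algebraMap (x := b)).mul hx) h
    exact ihb x y hx hy.symm
  | mem h hh =>
    intro x r hx hr
    obtain ⟨P, hP, hP0⟩ := hx
    have hroot : Polynomial.aeval (algebraMap R F h * x) (P.scaleRoots h) = 0 :=
      Polynomial.scaleRoots_aeval_eq_zero hP0
    rw [hr, Polynomial.aeval_algebraMap_apply, ← map_zero (algebraMap R F)] at hroot
    have hroot := hinj hroot
    have hdvd : h ∣ r ^ P.natDegree := by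
      rw [Polynomial.aeval_eq_sum_range, Finset.sum_range_succ, Polynomial.natDegree_scaleRoots,
        Polynomial.coeff_scaleRoots_natDegree, hP.leadingCoeff, one_smul] at hroot
      rw [eq_neg_of_add_eq_zero_right hroot, dvd_neg]
      refine Finset.dvd_sum fun i hi => ?_
      rw [Polynomial.coeff_scaleRoots, smul_eq_mul]
      have : P.natDegree - i ≠ 0 := by have := Finset.mem_range.1 hi; omega
      exact Dvd.dvd.mul_right (Dvd.dvd.mul_left (dvd_pow_self h this) _) _
    obtain ⟨y, rfl⟩ := dvd_of_dvd_pow_of_reduced (h2 h hh) hdvd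
    refine ⟨y, ?_⟩
    rw [map_mul] at hr
    have := (h1 h hh).1 (x - algebraMap R F y) (by rw [mul_sub, hr, sub_self])
    exact (sub_eq_zero.1 this).symm

/-- Normality criterion: `R` is an integrally closed domain if it agrees with such a ring `Q` after
inverting nonzerodivisors that generate radical ideals. -/
theorem isDomain_and_isIntegrallyClosed_of_clear {R Q : Type*} [CommRing R] [CommRing Q]
    [IsDomain Q] [IsIntegrallyClosed Q] (ψ : Q →+* R) (hψ : Function.Injective ψ) (H : Set R)
    (h1 : ∀ h ∈ H, h ∈ nonZeroDivisors R) (h2 : ∀ h ∈ H, ∀ r, h ∣ r ^ 2 → h ∣ r)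
    (h3 : ∀ h ∈ H, h ∈ ψ.range)
    (h4 : ∀ x, ∃ g ∈ Submonoid.closure H, g * x ∈ ψ.range) :
    IsDomain R ∧ IsIntegrallyClosed R := by
  have hreg : ∀ g ∈ Submonoid.closure H, g ∈ nonZeroDivisors R := fun g hg =>
    (Submonoid.closure_le.2 h1 : Submonoid.closure H ≤ nonZeroDivisors R) hg
  have hrange : ∀ g ∈ Submonoid.closure H, g ∈ ψ.range := fun g hg =>
    (Submonoid.closure_le.2 h3 : Submonoid.closure H ≤ ψ.range.toSubmonoid) hg
  have hnt : Nontrivial R := hψ.nontrivial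
  have hnz : NoZeroDivisors R := by
    refine ⟨fun {a b} hab => ?_⟩
    obtain ⟨g, hg, a', ha⟩ := h4 a
    obtain ⟨g', hg', b', hb⟩ := h4 b
    have : a' * b' = 0 := hψ (by
      rw [map_mul, ha, hb, map_zero, mul_mul_mul_comm, hab, mul_zero])
    rcases mul_eq_zero.1 this with h | h
    · left
      rw [h, map_zero] at ha
      exact (hreg g hg).1 a ha.symm
    · right
      rw [h, map_zero] at hb
      exact (hreg g' hg').1 b hb.symm
  have hdom : IsDomain R := NoZeroDivisors.to_isDomain R
  refine ⟨hdom, ?_⟩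
  rw [isIntegrallyClosed_iff (FractionRing R)]
  intro x hx
  let F := FractionRing R
  have hinj : Function.Injective (algebraMap R F) := IsFractionRing.injective R F
  let _ : Algebra Q F := ((algebraMap R F).comp ψ).toAlgebra
  have hQF : ∀ y, algebraMap Q F y = algebraMap R F (ψ y) := fun _ => rfl
  have hQinj : Function.Injective (algebraMap Q F) := hinj.comp hψ
  obtain ⟨P, hP, hP0⟩ := hx
  -- a common denominator of the coefficients
  have hden : ∀ t : Finset ℕ, ∃ g ∈ Submonoid.closure H, ∀ i ∈ t, g * P.coeff i ∈ ψ.range := by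
    intro t
    induction t using Finset.induction_on with
    | empty => exact ⟨1, one_mem _, by simp⟩
    | insert a t ha ih =>
      obtain ⟨g, hg, hgt⟩ := ih
      obtain ⟨g', hg', hgt'⟩ := h4 (P.coeff a)
      refine ⟨g * g', mul_mem hg hg', fun i hi => ?_⟩
      rcases Finset.mem_insert.1 hi with rfl | hi
      · rw [mul_assoc]; exact mul_mem (hrange _ hg) hgt'
      · rw [mul_comm g, mul_assoc]; exact mul_mem (hrange _ hg') (hgt i hi)
  obtain ⟨g, hg, hgt⟩ := hden (Finset.range (P.natDegree + 1))
  have hroot : Polynomial.aeval (algebraMap R F g * x) (P.scaleRoots g) = 0 :=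
    Polynomial.scaleRoots_aeval_eq_zero hP0
  have hlift : P.scaleRoots g ∈ Polynomial.lifts ψ := by
    rw [Polynomial.lifts_iff_coeff_lifts]
    intro i
    change _ ∈ ψ.range
    rw [Polynomial.coeff_scaleRoots]
    rcases lt_trichotomy i P.natDegree with hi | hi | hi
    · obtain ⟨e, he⟩ : ∃ e, P.natDegree - i = e + 1 := ⟨P.natDegree - i - 1, by omega⟩
      rw [he, pow_succ', ← mul_assoc, mul_comm _ g]
      exact mul_mem (hgt i (Finset.mem_range.2 (by omega))) (pow_mem (hrange g hg) _)
    · rw [hi, hP.coeff_natDegree, Nat.sub_self, pow_zero, one_mul]; exact one_mem _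
    · rw [Polynomial.coeff_eq_zero_of_natDegree_lt hi, zero_mul]; exact zero_mem _
  obtain ⟨P', hP', -, hmonic⟩ := Polynomial.lifts_and_natDegree_eq_and_monic hlift
    ((Polynomial.monic_scaleRoots_iff g).2 hP)
  have hint : IsIntegral Q (algebraMap R F g * x) := by
    refine ⟨P', hmonic, ?_⟩
    rw [← hP', Polynomial.aeval_def, Polynomial.eval₂_map] at hroot
    exact hroot
  obtain ⟨u, v, hv, huv⟩ := IsFractionRing.div_surjective (A := R) x
  obtain ⟨g₁, hg₁, u', hu⟩ := h4 u
  obtain ⟨g₂, hg₂, v', hv'⟩ := h4 v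
  have hF : ∀ c ∈ Submonoid.closure H, algebraMap R F c ≠ 0 := fun c hc h =>
    nonZeroDivisors.ne_zero (hreg c hc) (hinj (by rw [h, map_zero]))
  have hv0 : algebraMap R F v ≠ 0 := fun h =>
    nonZeroDivisors.ne_zero hv (hinj (by rw [h, map_zero]))
  obtain ⟨c₁, hc₁⟩ := hrange _ (mul_mem hg hg₂)
  obtain ⟨c₂, hc₂⟩ := hrange _ hg₁
  have hfrac : algebraMap Q F (c₂ * v') * (algebraMap R F g * x) = algebraMap Q F (c₁ * u') := by
    have hxv : x * algebraMap R F v = algebraMap R F u := (eq_div_iff hv0).1 huv.symm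
    rw [hQF, hQF, map_mul ψ c₂, map_mul ψ c₁, hc₁, hc₂, hu, hv']
    simp only [map_mul]
    linear_combination (algebraMap R F g₁ * algebraMap R F g₂ * algebraMap R F g) * hxv
  have hne : c₂ * v' ≠ 0 := by
    intro h0
    have : ψ (c₂ * v') = 0 := by rw [h0, map_zero]
    rw [map_mul, hc₂, hv'] at this
    rcases mul_eq_zero.1 this with h | h
    · exact nonZeroDivisors.ne_zero (hreg _ hg₁) h
    · rcases mul_eq_zero.1 h with h | h
      · exact nonZeroDivisors.ne_zero (hreg _ hg₂) h
      · exact nonZeroDivisors.ne_zero hv h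
  let _ : Algebra (FractionRing Q) F := (IsFractionRing.lift (A := Q) (g := algebraMap Q F) hQinj).toAlgebra
  have : IsScalarTower Q (FractionRing Q) F := IsScalarTower.of_algebraMap_eq fun y => by
    change _ = IsFractionRing.lift hQinj _
    rw [IsFractionRing.lift_algebraMap]
  have hne' : algebraMap Q F (c₂ * v') ≠ 0 := fun h => hne (hQinj (by rw [h, map_zero]))
  have hz : algebraMap R F g * x = algebraMap (FractionRing Q) F
      (algebraMap Q _ (c₁ * u') / algebraMap Q _ (c₂ * v')) := by
    rw [map_div₀, ← IsScalarTower.algebraMap_apply, ← IsScalarTower.algebraMap_apply,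
      eq_div_iff hne', mul_comm]
    exact hfrac
  rw [hz, isIntegral_algebraMap_iff (algebraMap (FractionRing Q) F).injective] at hint
  obtain ⟨y, hy⟩ := (isIntegrallyClosed_iff (FractionRing Q)).1 inferInstance hint
  rw [← hy, ← IsScalarTower.algebraMap_apply] at hz
  exact exists_algebraMap_eq_of_closure hinj
    (fun h hh => by simpa using hF h (Submonoid.subset_closure hh)) h2 hg x (ψ y) ⟨P, hP, hP0⟩ hz

/-- A family is regular in every order. -/
def StronglyRegular {G ι : Type*} [CommRing G] (g : ι → G) : Prop :=
  ∀ (s : Finset ι) (r : ι), r ∉ s → ∀ x, g r * x ∈ Ideal.span (g '' s) → x ∈ Ideal.span (g '' s)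

/-- Symbol maps of a filtered ring `S` with values in its associated graded ring `G`, which is
assumed to be split into `S`. -/
structure SymbolMap (S G : Type*) [CommRing S] [CommRing G] where
  symb : ℤ → S →+ G
  lift : G →+* S
  exhaustive : ∀ x, ∃ a, ∀ m < a, symb m x = 0
  symb_mul_lt : ∀ {a b x y}, (∀ m < a, symb m x = 0) → (∀ m < b, symb m y = 0) →
    ∀ m < a + b, symb m (x * y) = 0
  symb_mul : ∀ {a b x y}, (∀ m < a, symb m x = 0) → (∀ m < b, symb m y = 0) →
    symb (a + b) (x * y) = symb a x * symb b y
  symb_lift : ∀ n x, symb n (lift (symb n x)) = symb n x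
  symb_lift_ne : ∀ {m n}, m ≠ n → ∀ x, symb m (lift (symb n x)) = 0
  symb_lift_mul : ∀ a b h x, symb (a + b) (lift (h * symb b x)) = symb a (lift h) * symb b x

namespace SymbolMap

variable {S G : Type*} [CommRing S] [CommRing G] (T : SymbolMap S G)

/-- The filtration defined by the vanishing of low order symbols. -/
def fil (a : ℤ) : AddSubgroup S where
  carrier := {x | ∀ m < a, T.symb m x = 0}
  zero_mem' := by simp
  add_mem' := fun hx hy m hm => by rw [map_add, hx m hm, hy m hm, add_zero]
  neg_mem' := fun hx m hm => by rw [map_neg, hx m hm, neg_zero]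

theorem fil_mono {a b : ℤ} (h : a ≤ b) {x : S} (hx : x ∈ T.fil b) : x ∈ T.fil a :=
  fun m hm => hx m (hm.trans_le h)

theorem mem_fil_succ {a : ℤ} {x : S} (hx : x ∈ T.fil a) (h0 : T.symb a x = 0) :
    x ∈ T.fil (a + 1) := fun m hm => by
  rcases (Int.lt_add_one_iff.1 hm).lt_or_eq with h | rfl
  · exact hx m h
  · exact h0

theorem mul_mem_fil {a b : ℤ} {x y : S} (hx : x ∈ T.fil a) (hy : y ∈ T.fil b) :
    x * y ∈ T.fil (a + b) := T.symb_mul_lt hx hy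

theorem lift_symb_mem_fil (a : ℤ) (x : S) : T.lift (T.symb a x) ∈ T.fil a :=
  fun _ hm => T.symb_lift_ne hm.ne x

theorem one_mem_fil_and_symb_pow {a : ℤ} {x : S} (h1 : (1 : S) ∈ T.fil 0) (h1' : T.symb 0 1 = 1)
    (hx : x ∈ T.fil a) (m : ℕ) : x ^ m ∈ T.fil (m * a) ∧ T.symb (m * a) (x ^ m) = T.symb a x ^ m := by
  induction m with
  | zero => simpa using ⟨h1, h1'⟩
  | succ m ih =>
    have e : ((m + 1 : ℕ) : ℤ) * a = m * a + a := by push_cast; ring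
    rw [pow_succ, pow_succ, e]
    exact ⟨T.mul_mem_fil ih.1 hx, by rw [T.symb_mul ih.1 hx, ih.2]⟩

/-- An ideal is closed for the filtration. -/
def Closed (I : Ideal S) : Prop := ∀ x, (∀ n, ∃ y ∈ I, x - y ∈ T.fil n) → x ∈ I

variable {T}

theorem Closed.mem_of_improve {I : Ideal S} (hI : T.Closed I) (P : S → Prop)
    (hP : ∀ x z, P x → z ∈ I → P (x - z))
    (H : ∀ e x, P x → x ∈ T.fil e → ∃ z ∈ I, x - z ∈ T.fil (e + 1)) {x : S} (hx : P x) :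
    x ∈ I := by
  apply hI
  obtain ⟨a, ha⟩ := T.exhaustive x
  have key : ∀ k : ℕ, ∃ y ∈ I, x - y ∈ T.fil (a + k) := by
    intro k
    induction k with
    | zero => exact ⟨0, I.zero_mem, by rw [Nat.cast_zero, add_zero, sub_zero]; exact ha⟩
    | succ k ih =>
      obtain ⟨y, hy, hy'⟩ := ih
      obtain ⟨z, hz, hz'⟩ := H _ _ (hP x y hx hy) hy'
      exact ⟨y + z, I.add_mem hy hz, by push_cast; rwa [← add_assoc, ← sub_sub]⟩
  intro n
  obtain ⟨y, hy, hy'⟩ := key (n - a).toNat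
  exact ⟨y, hy, T.fil_mono (by omega) hy'⟩

theorem Closed.exists_lead {I : Ideal S} (hI : T.Closed I) {x : S} (hx : x ∉ I) :
    ∃ e x', x - x' ∈ I ∧ x' ∈ T.fil e ∧ ∀ z ∈ I, x' - z ∉ T.fil (e + 1) := by
  by_contra! hcon
  refine hx (hI.mem_of_improve (fun y => x - y ∈ I) (fun y z hy hz => ?_) (fun e y hy hye => ?_)
    (x := x) (by simp))
  · have := I.add_mem hy hz
    rwa [← sub_add] 
  · exact hcon e y hy hye

variable (T)

/-- The family `f` has symbols `g` in degrees `d`. -/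
def HasSymb {ι : Type*} (f : ι → S) (g : ι → G) (d : ι → ℤ) : Prop :=
  ∀ l, f l ∈ T.fil (d l) ∧ T.symb (d l) (f l) = g l

variable {T} {ι : Type*} {f : ι → S} {g : ι → G} {d : ι → ℤ}

theorem HasSymb.symb_lift_mul (hf : T.HasSymb f g d) (l : ι) (e : ℤ) (h : G) :
    T.symb e (T.lift (h * g l)) = T.symb (e - d l) (T.lift h) * g l := by
  have := T.symb_lift_mul (e - d l) (d l) h (f l)
  rwa [(hf l).2, sub_add_cancel] at this

theorem HasSymb.symb_lift_mem (hf : T.HasSymb f g d) (s : Set ι) (e : ℤ) {y : G}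
    (hy : y ∈ Ideal.span (g '' s)) : T.symb e (T.lift y) ∈ Ideal.span (g '' s) := by
  refine Submodule.span_induction (p := fun y _ => ∀ h, T.symb e (T.lift (h * y)) ∈
    Ideal.span (g '' s)) ?_ ?_ ?_ ?_ hy 1 |> fun h => by simpa using h
  · rintro _ ⟨l, hl, rfl⟩ h
    rw [hf.symb_lift_mul]
    exact Ideal.mul_mem_left _ _ (Ideal.subset_span ⟨l, hl, rfl⟩)
  · simp
  · intro x y _ _ hx hy h
    rw [mul_add, map_add, map_add]
    exact add_mem (hx h) (hy h)
  · intro a x _ hx h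
    rw [smul_eq_mul, ← mul_assoc]
    exact hx _

theorem HasSymb.improve (hf : T.HasSymb f g d) (s : Finset ι) {e : ℤ} {x : S} (hx : x ∈ T.fil e)
    (hx' : T.symb e x ∈ Ideal.span (g '' s)) :
    ∃ a : ι → S, (∀ l, a l ∈ T.fil (e - d l)) ∧ x - ∑ l ∈ s, a l * f l ∈ T.fil (e + 1) := by
  classical
  obtain ⟨c, hc⟩ := (Submodule.mem_span_image_finset_iff_exists_fun G).1 hx'
  let c' : ι → G := fun l => if h : l ∈ s then c ⟨l, h⟩ else 0
  have hc' : ∑ l ∈ s, c' l * g l = T.symb e x := by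
    rw [← hc, ← Finset.sum_attach]
    exact Finset.sum_congr rfl fun l _ => by simp [c']
  refine ⟨fun l => T.lift (T.symb (e - d l) (T.lift (c' l))),
    fun l => T.lift_symb_mem_fil _ _, T.mem_fil_succ (sub_mem hx ?_) ?_⟩
  · refine sum_mem fun l _ => ?_
    have := T.mul_mem_fil (T.lift_symb_mem_fil (e - d l) (T.lift (c' l))) (hf l).1
    rwa [sub_add_cancel] at this
  · rw [map_sub, map_sum, ← T.symb_lift e x, ← hc', map_sum, map_sum, sub_eq_zero]
    refine Finset.sum_congr rfl fun l _ => ?_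
    have := T.symb_mul (T.lift_symb_mem_fil (e - d l) (T.lift (c' l))) (hf l).1
    rw [sub_add_cancel] at this
    rw [this, T.symb_lift, hf.symb_lift_mul, (hf l).2]

theorem sum_mem_span_image (s : Finset ι) (a : ι → S) :
    ∑ l ∈ s, a l * f l ∈ Ideal.span (f '' s) :=
  sum_mem fun l hl => Ideal.mul_mem_left _ _ (Ideal.subset_span ⟨l, hl, rfl⟩)

theorem HasSymb.improve' (hf : T.HasSymb f g d) (s : Finset ι) {e : ℤ} {x : S} (hx : x ∈ T.fil e)
    (hx' : T.symb e x ∈ Ideal.span (g '' s)) :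
    ∃ z ∈ Ideal.span (f '' s), x - z ∈ T.fil (e + 1) := by
  obtain ⟨a, -, ha⟩ := hf.improve s hx hx'
  exact ⟨_, sum_mem_span_image s a, ha⟩

/-- If the symbols form a strongly regular family, then elements of the ideal have
representations without cancellation. -/
theorem HasSymb.exists_rep (hf : T.HasSymb f g d) (hg : StronglyRegular g) (s : Finset ι) :
    ∀ (n : ℤ) (x : S), x ∈ Ideal.span (f '' s) → x ∈ T.fil n →
      ∃ a : ι → S, (∀ l ∈ s, a l ∈ T.fil (n - d l)) ∧ x = ∑ l ∈ s, a l * f l := by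
  classical
  induction s using Finset.induction_on with
  | empty =>
    intro n x hx _
    exact ⟨0, by simp, by simpa using hx⟩
  | insert r s hr ih =>
    have hsymb : ∀ (n : ℤ) (x : S), x ∈ Ideal.span (f '' s) → x ∈ T.fil n →
        T.symb n x ∈ Ideal.span (g '' s) := by
      intro n x hx hn
      obtain ⟨a, ha, rfl⟩ := ih n x hx hn
      rw [map_sum]
      refine sum_mem fun l hl => ?_
      have := T.symb_mul (ha l hl) (hf l).1
      rw [sub_add_cancel] at this
      rw [this, (hf l).2]
      exact Ideal.mul_mem_left _ _ (Ideal.subset_span ⟨l, hl, rfl⟩)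
    intro n x hx hn
    have main : ∀ (k : ℕ) (y b : S), y ∈ Ideal.span (f '' s) → b ∈ T.fil (n - d r - k) →
        x = y + b * f r → ∃ y b, y ∈ Ideal.span (f '' s) ∧ b ∈ T.fil (n - d r) ∧
          x = y + b * f r := by
      intro k
      induction k with
      | zero => exact fun y b hy hb hxy => ⟨y, b, hy, by simpa using hb, hxy⟩
      | succ k ihk =>
        intro y b hy hb hxy
        set e := n - d r - (k + 1 : ℕ) with he
        have hbf := T.mul_mem_fil hb (hf r).1
        have hyfil : y ∈ T.fil (e + d r) := by
          rw [eq_sub_of_add_eq hxy.symm]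
          exact sub_mem (T.fil_mono (by omega) hn) hbf
        have h1 := hsymb _ y hy hyfil
        have h2 : T.symb (e + d r) x = 0 := hn _ (by omega)
        rw [hxy, map_add, T.symb_mul hb (hf r).1, (hf r).2] at h2
        have h3 : g r * T.symb e b ∈ Ideal.span (g '' s) := by
          rw [mul_comm, ← neg_mem_iff, ← eq_neg_of_add_eq_zero_left h2]
          exact h1
        obtain ⟨z, hz, hz'⟩ := hf.improve' s hb (hg s r hr _ h3)
        refine ihk (y + z * f r) (b - z) (add_mem hy (Ideal.mul_mem_right _ _ hz)) ?_ ?_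
        · exact T.fil_mono (by omega) hz'
        · rw [hxy]; ring
    obtain ⟨y, b, hy, hb, hxy⟩ : ∃ y b, y ∈ Ideal.span (f '' s) ∧ b ∈ T.fil (n - d r) ∧
          x = y + b * f r := by
      rw [Finset.coe_insert, Set.image_insert_eq, Ideal.span, Submodule.mem_span_insert] at hx
      obtain ⟨b, y, hy, hxy⟩ := hx
      obtain ⟨a, ha⟩ := T.exhaustive b
      refine main (n - d r - a).toNat y b hy (T.fil_mono (by omega) ha) ?_
      rw [hxy, smul_eq_mul, add_comm]
    have hyfil : y ∈ T.fil n := by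
      rw [eq_sub_of_add_eq hxy.symm]
      have := T.mul_mem_fil hb (hf r).1
      rw [sub_add_cancel] at this
      exact sub_mem hn this
    obtain ⟨a, ha, hay⟩ := ih n y hy hyfil
    refine ⟨Function.update a r b, fun l hl => ?_, ?_⟩
    · rcases Finset.mem_insert.1 hl with rfl | hl
      · simpa using hb
      · rw [Function.update_of_ne (fun h : l = r => hr (h ▸ hl))]; exact ha l hl
    · rw [Finset.sum_insert hr, Function.update_self, hxy, hay, add_comm]
      congr 1
      exact Finset.sum_congr rfl fun l hl => by
        rw [Function.update_of_ne (fun h : l = r => hr (h ▸ hl))]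

theorem HasSymb.symb_mem (hf : T.HasSymb f g d) (hg : StronglyRegular g) (s : Finset ι)
    {n : ℤ} {x : S} (hx : x ∈ Ideal.span (f '' s)) (hn : x ∈ T.fil n) :
    T.symb n x ∈ Ideal.span (g '' s) := by
  obtain ⟨a, ha, rfl⟩ := hf.exists_rep hg s n x hx hn
  rw [map_sum]
  refine sum_mem fun l hl => ?_
  have := T.symb_mul (ha l hl) (hf l).1
  rw [sub_add_cancel] at this
  rw [this, (hf l).2]
  exact Ideal.mul_mem_left _ _ (Ideal.subset_span ⟨l, hl, rfl⟩)

theorem HasSymb.stronglyRegular (hf : T.HasSymb f g d) (hg : StronglyRegular g)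
    (hcl : ∀ I, T.Closed I) : StronglyRegular f := by
  intro s r hr x hx
  refine (hcl _).mem_of_improve (fun x => f r * x ∈ Ideal.span (f '' s)) (fun x z hx hz => ?_)
    (fun e x hx hxe => ?_) hx
  · rw [mul_sub]; exact sub_mem hx (Ideal.mul_mem_left _ _ hz)
  · refine hf.improve' s hxe (hg s r hr _ ?_)
    rw [← (hf r).2, ← T.symb_mul (hf r).1 hxe]
    exact hf.symb_mem hg s hx (T.mul_mem_fil (hf r).1 hxe)

theorem HasSymb.isRadical [Fintype ι] (hf : T.HasSymb f g d) (hg : StronglyRegular g)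
    (hcl : ∀ I, T.Closed I) (hred : ∀ y, y ^ 2 ∈ Ideal.span (Set.range g) → y ∈ Ideal.span (Set.range g))
    (x : S) (hx : x ^ 2 ∈ Ideal.span (Set.range f)) : x ∈ Ideal.span (Set.range f) := by
  have e1 : Set.range f = f '' (Finset.univ : Finset ι) := by simp
  have e2 : Set.range g = g '' (Finset.univ : Finset ι) := by simp
  rw [e1] at hx ⊢
  rw [e2] at hred
  refine (hcl (Ideal.span (f '' (Finset.univ : Finset ι)))).mem_of_improve
    (fun x => x ^ 2 ∈ Ideal.span (f '' (Finset.univ : Finset ι))) (fun x z hx hz => ?_)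
    (fun e x hx hxe => ?_) hx
  · have : (x - z) ^ 2 = x ^ 2 - (2 * x - z) * z := by ring
    rw [this]
    exact sub_mem hx (Ideal.mul_mem_left _ _ hz)
  · refine hf.improve' Finset.univ hxe (hred _ ?_)
    rw [sq, ← T.symb_mul hxe hxe]
    rw [sq] at hx
    exact hf.symb_mem hg Finset.univ hx (T.mul_mem_fil hxe hxe)

/-- Normality descends from the ring defined by the symbols. -/
theorem HasSymb.completelyIntClosed [Fintype ι] (hf : T.HasSymb f g d) (hg : StronglyRegular g)
    (hcl : ∀ I, T.Closed I) (h1 : (1 : S) ∈ T.fil 0) (h1' : T.symb 0 1 = 1)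
    [IsDomain (G ⧸ Ideal.span (Set.range g))]
    (hG : CompletelyIntClosed (G ⧸ Ideal.span (Set.range g))) :
    IsDomain (S ⧸ Ideal.span (Set.range f)) ∧
      CompletelyIntClosed (S ⧸ Ideal.span (Set.range f)) := by
  have e1 : Set.range f = f '' (Finset.univ : Finset ι) := by simp
  have e2 : Set.range g = g '' (Finset.univ : Finset ι) := by simp
  set I := Ideal.span (Set.range f) with hI
  set J := Ideal.span (Set.range g) with hJ
  have hprime : J.IsPrime := Ideal.Quotient.isDomain_iff_prime J |>.1 inferInstance
  have improve : ∀ {e : ℤ} {x : S}, x ∈ T.fil e → T.symb e x ∈ J → ∃ z ∈ I, x - z ∈ T.fil (e + 1) := by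
    intro e x hx hx'
    rw [hI, e1]
    rw [hJ, e2] at hx'
    exact hf.improve' _ hx hx'
  have symb_mem : ∀ {e : ℤ} {x : S}, x ∈ T.fil e → x ∈ I → T.symb e x ∈ J := by
    intro e x hx hx'
    rw [hI, e1] at hx'
    rw [hJ, e2]
    exact hf.symb_mem hg _ hx' hx
  have lead : ∀ x, x ∉ I → ∃ e x', x - x' ∈ I ∧ x' ∈ T.fil e ∧ T.symb e x' ∉ J := by
    intro x hx
    obtain ⟨e, x', h, h', h''⟩ := (hcl I).exists_lead hx
    refine ⟨e, x', h, h', fun hmem => ?_⟩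
    obtain ⟨z, hz, hz'⟩ := improve h' hmem
    exact h'' z hz hz'
  have hne : (1 : S) ∉ I := fun h => hprime.ne_top ((Ideal.eq_top_iff_one J).2 (by
    rw [← h1']; exact symb_mem h1 h))
  have hIprime : I.IsPrime := by
    refine ⟨fun h => hne (h ▸ Submodule.mem_top), fun {x y} hxy => ?_⟩
    by_contra! hcon
    obtain ⟨a, x', hx, hxa, hxJ⟩ := lead x hcon.1
    obtain ⟨b, y', hy, hyb, hyJ⟩ := lead y hcon.2
    have : x' * y' ∈ I := by
      have : x' * y' = x * y - ((x - x') * y + x' * (y - y')) := by ring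
      rw [this]
      exact sub_mem hxy (add_mem (Ideal.mul_mem_right _ _ hx) (Ideal.mul_mem_left _ _ hy))
    have := symb_mem (T.mul_mem_fil hxa hyb) this
    rw [T.symb_mul hxa hyb] at this
    exact (hprime.mem_or_mem this).elim hxJ hyJ
  have hdom : IsDomain (S ⧸ I) := Ideal.Quotient.isDomain I
  refine ⟨hdom, fun a b d hb hd h => ?_⟩
  obtain ⟨b, rfl⟩ := Ideal.Quotient.mk_surjective b
  obtain ⟨d, rfl⟩ := Ideal.Quotient.mk_surjective d
  obtain ⟨a, rfl⟩ := Ideal.Quotient.mk_surjective a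
  obtain ⟨β, b', hbI, hbβ, hbJ⟩ := lead b (fun h => hb (Ideal.Quotient.eq_zero_iff_mem.2 h))
  obtain ⟨δ, d', hdI, hdδ, hdJ⟩ := lead d (fun h => hd (Ideal.Quotient.eq_zero_iff_mem.2 h))
  rw [Ideal.Quotient.eq.2 hbI] at *
  rw [Ideal.Quotient.eq.2 hdI] at *
  have hmain : a ∈ I ⊔ Ideal.span {b'} := by
    refine (hcl _).mem_of_improve
      (fun x => ∀ m : ℕ, Ideal.Quotient.mk I b' ^ m ∣ Ideal.Quotient.mk I d' * Ideal.Quotient.mk I x ^ m)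
      (fun x z hx hz m => ?_) (fun e x hx hxe => ?_) h
    · obtain ⟨i, hi, w, hw, rfl⟩ := Submodule.mem_sup.1 hz
      obtain ⟨c, rfl⟩ := Ideal.mem_span_singleton'.1 hw
      rw [map_sub, map_add, Ideal.Quotient.eq_zero_iff_mem.2 hi, zero_add, sub_eq_add_neg, add_pow,
        Finset.mul_sum]
      refine Finset.dvd_sum fun j hj => ?_
      have hj := Finset.mem_range.1 hj
      obtain ⟨k, rfl⟩ : ∃ k, m = j + k := ⟨m - j, by omega⟩
      obtain ⟨y, hy⟩ := hx j
      rw [Nat.add_sub_cancel_left, map_mul, ← mul_assoc, ← mul_assoc, hy, pow_add, neg_eq_neg_one_mul]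
      refine ⟨y * (-1) ^ k * Ideal.Quotient.mk I c ^ k * ((j + k).choose j), by ring⟩
    · by_cases hxJ : T.symb e x ∈ J
      · obtain ⟨z, hz, hz'⟩ := improve hxe hxJ
        exact ⟨z, Ideal.mem_sup_left hz, hz'⟩
      have hdvd : ∀ m : ℕ, Ideal.Quotient.mk J (T.symb β b') ^ m ∣
          Ideal.Quotient.mk J (T.symb δ d') * Ideal.Quotient.mk J (T.symb e x) ^ m := by
        intro m
        obtain ⟨c, hc⟩ := hx m
        obtain ⟨c, rfl⟩ := Ideal.Quotient.mk_surjective c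
        simp only [← map_pow, ← map_mul] at hc ⊢
        have hbm := T.one_mem_fil_and_symb_pow h1 h1' hbβ m
        have hxm := T.one_mem_fil_and_symb_pow h1 h1' hxe m
        have hdx := T.mul_mem_fil hdδ hxm.1
        have hsdx := T.symb_mul hdδ hxm.1
        have hdxJ : T.symb (δ + m * e) (d' * x ^ m) ∉ J := by
          rw [hsdx, hxm.2]
          intro h
          rcases hprime.mem_or_mem h with h | h
          · exact hdJ h
          · exact hxJ (hprime.mem_of_pow_mem _ h)
        have hcI : c ∉ I := by
          intro hcI
          have : d' * x ^ m ∈ I := by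
            rw [← Ideal.Quotient.eq_zero_iff_mem, hc, Ideal.Quotient.eq_zero_iff_mem]
            exact Ideal.mul_mem_left _ _ hcI
          exact hdxJ (symb_mem hdx this)
        obtain ⟨γ, c', hcI', hcγ, hcJ⟩ := lead c hcI
        rw [map_mul _ _ c, Ideal.Quotient.eq.2 hcI', ← map_mul, Ideal.Quotient.eq] at hc
        have hbc := T.mul_mem_fil hbm.1 hcγ
        have hsbc := T.symb_mul hbm.1 hcγ
        have hbcJ : T.symb (m * β + γ) (b' ^ m * c') ∉ J := by
          rw [hsbc, hbm.2]
          intro h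
          rcases hprime.mem_or_mem h with h | h
          · exact hbJ (hprime.mem_of_pow_mem _ h)
          · exact hcJ h
        have heq : (m * β + γ : ℤ) = δ + m * e := by
          rcases lt_trichotomy (m * β + γ : ℤ) (δ + m * e) with hlt | heq | hlt
          · refine absurd ?_ hbcJ
            have := symb_mem (sub_mem (T.fil_mono hlt.le hdx) hbc) hc
            rwa [map_sub, hdx _ hlt, zero_sub, neg_mem_iff] at this
          · exact heq
          · refine absurd ?_ hdxJ
            have := symb_mem (sub_mem hdx (T.fil_mono hlt.le hbc)) hc
            rwa [map_sub, hbc _ hlt, sub_zero] at this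
        refine ⟨Ideal.Quotient.mk J (T.symb γ c'), ?_⟩
        rw [← map_mul, ← hbm.2, ← hxm.2, ← hsbc, ← hsdx, Ideal.Quotient.eq, heq, ← map_sub]
        rw [heq] at hbc
        exact symb_mem (sub_mem hdx hbc) hc
      have hxJ' : Ideal.Quotient.mk J (T.symb β b') ≠ 0 := fun h =>
        hbJ (Ideal.Quotient.eq_zero_iff_mem.1 h)
      have hdJ' : Ideal.Quotient.mk J (T.symb δ d') ≠ 0 := fun h =>
        hdJ (Ideal.Quotient.eq_zero_iff_mem.1 h)
      obtain ⟨y, hy⟩ := hG _ _ _ hxJ' hdJ' hdvd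
      obtain ⟨y, rfl⟩ := Ideal.Quotient.mk_surjective y
      rw [← map_mul, Ideal.Quotient.eq] at hy
      set z := T.lift (T.symb (e - β) (T.lift y)) * b' with hz
      have hzfil : z ∈ T.fil e := by
        have := T.mul_mem_fil (T.lift_symb_mem_fil (e - β) (T.lift y)) hbβ
        rwa [sub_add_cancel] at this
      have hzs : T.symb e z = T.symb e (T.lift (T.symb β b' * y)) := by
        have := T.symb_mul (T.lift_symb_mem_fil (e - β) (T.lift y)) hbβ
        rw [sub_add_cancel] at this
        rw [hz, this, T.symb_lift, mul_comm (T.symb β b'), ← T.symb_lift_mul, sub_add_cancel]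
      have : T.symb e (x - z) ∈ J := by
        rw [map_sub, hzs, ← T.symb_lift e x, ← map_sub, ← map_sub]
        rw [hJ, ← Set.image_univ] at hy ⊢
        exact hf.symb_lift_mem _ _ hy
      obtain ⟨w, hw, hw'⟩ := improve (sub_mem hxe hzfil) this
      refine ⟨w + z, add_mem (Ideal.mem_sup_left hw)
        (Ideal.mem_sup_right (Ideal.mul_mem_left _ _ (Ideal.mem_span_singleton_self b'))), ?_⟩
      rwa [add_comm w, ← sub_sub]
  obtain ⟨i, hi, w, hw, rfl⟩ := Submodule.mem_sup.1 hmain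
  obtain ⟨c, rfl⟩ := Ideal.mem_span_singleton'.1 hw
  refine ⟨Ideal.Quotient.mk I c, ?_⟩
  rw [map_add, Ideal.Quotient.eq_zero_iff_mem.2 hi, zero_add, map_mul, mul_comm]

end SymbolMap

namespace SymbolMap

variable {τ k : Type*} [CommRing k]

/-- Symbols attached to a weight, for a ring with a coefficient function. -/
noncomputable def ofCoeff [DecidableEq τ] {S : Type*} [CommRing S] (w : τ → ℤ) (c : (τ →₀ ℕ) → S →+ k)
    (c_mul : ∀ d x y, c d (x * y) = ∑ p ∈ Finset.HasAntidiagonal.antidiagonal d, c p.1 x * c p.2 y)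
    (symb : ℤ → S →+ MvPolynomial τ k)
    (coeff_symb : ∀ m x d, (symb m x).coeff d = if Finsupp.weight w d = m then c d x else 0)
    (lift : MvPolynomial τ k →+* S) (c_lift : ∀ d g, c d (lift g) = g.coeff d)
    (exhaustive : ∀ x, ∃ a, ∀ m < a, symb m x = 0) : SymbolMap S (MvPolynomial τ k) where
  symb := symb
  lift := lift
  exhaustive := exhaustive
  symb_mul_lt := by
    intro a b x y hx hy m hm
    have h0 : ∀ {e : ℤ} {z : S}, (∀ m < e, symb m z = 0) → ∀ d, Finsupp.weight w d < e → c d z = 0 := by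
      intro e z hz d hd
      have := coeff_symb _ z d ▸ congrArg (MvPolynomial.coeff d) (hz _ hd)
      simpa using this
    ext d
    rw [coeff_symb, MvPolynomial.coeff_zero]
    split_ifs with h
    · rw [c_mul]
      refine Finset.sum_eq_zero fun p hp => ?_
      rw [Finset.HasAntidiagonal.mem_antidiagonal] at hp
      rw [← hp, map_add] at h
      rcases lt_or_ge (Finsupp.weight w p.1) a with h1 | h1
      · rw [h0 hx _ h1, zero_mul]
      · rw [h0 hy p.2 (by omega), mul_zero]
    · rfl
  symb_mul := by
    intro a b x y hx hy
    have h0 : ∀ {e : ℤ} {z : S}, (∀ m < e, symb m z = 0) → ∀ d, Finsupp.weight w d < e → c d z = 0 := by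
      intro e z hz d hd
      have := coeff_symb _ z d ▸ congrArg (MvPolynomial.coeff d) (hz _ hd)
      simpa using this
    ext d
    rw [coeff_symb, MvPolynomial.coeff_mul]
    split_ifs with h
    · rw [c_mul]
      refine Finset.sum_congr rfl fun p hp => ?_
      rw [Finset.HasAntidiagonal.mem_antidiagonal] at hp
      rw [← hp, map_add] at h
      rw [coeff_symb, coeff_symb]
      rcases lt_trichotomy (Finsupp.weight w p.1) a with h1 | h1 | h1
      · rw [h0 hx _ h1, zero_mul, ite_self, zero_mul]
      · rw [if_pos h1, if_pos (by omega)]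
      · rw [h0 hy p.2 (by omega), mul_zero, ite_self, mul_zero]
    · symm
      refine Finset.sum_eq_zero fun p hp => ?_
      rw [Finset.HasAntidiagonal.mem_antidiagonal] at hp
      rw [← hp, map_add] at h
      rw [coeff_symb, coeff_symb]
      by_cases h1 : Finsupp.weight w p.1 = a
      · rw [if_neg (by omega : ¬ Finsupp.weight w p.2 = b), mul_zero]
      · rw [if_neg h1, zero_mul]
  symb_lift := fun n x => by
    ext d
    simp only [coeff_symb, c_lift]
    split_ifs <;> rfl
  symb_lift_ne := fun {m n} h x => by
    ext d
    simp only [coeff_symb, c_lift, MvPolynomial.coeff_zero]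
    split_ifs with h1 h2
    · exact absurd (h1.symm.trans h2) h
    · rfl
    · rfl
  symb_lift_mul := fun a b h x => by
    ext d
    rw [coeff_symb, c_lift, MvPolynomial.coeff_mul, MvPolynomial.coeff_mul]
    simp only [coeff_symb, c_lift]
    split_ifs with hd
    · refine Finset.sum_congr rfl fun p hp => ?_
      rw [Finset.HasAntidiagonal.mem_antidiagonal] at hp
      rw [← hp, map_add] at hd
      by_cases h1 : Finsupp.weight w p.1 = a
      · rw [if_pos h1]
      · rw [if_neg (by omega : ¬ Finsupp.weight w p.2 = b), mul_zero, mul_zero]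
    · symm
      refine Finset.sum_eq_zero fun p hp => ?_
      rw [Finset.HasAntidiagonal.mem_antidiagonal] at hp
      rw [← hp, map_add] at hd
      by_cases h1 : Finsupp.weight w p.1 = a
      · rw [if_neg (by omega : ¬ Finsupp.weight w p.2 = b), mul_zero]
      · rw [if_neg h1, zero_mul]

/-- Symbols of polynomials. -/
noncomputable def polynomial (k : Type*) [CommRing k] (w : τ → ℤ) :
    SymbolMap (MvPolynomial τ k) (MvPolynomial τ k) := by
  classical
  exact ofCoeff w (fun d => (MvPolynomial.lcoeff k d).toAddMonoidHom)
    (fun d x y => MvPolynomial.coeff_mul x y d)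
    (fun m => (MvPolynomial.weightedHomogeneousComponent w m).toAddMonoidHom)
    (fun m x d => by simpa using MvPolynomial.coeff_weightedHomogeneousComponent m x d)
    (RingHom.id _) (fun _ _ => rfl)
    (fun x => by
      obtain ⟨a, ha⟩ := (x.support.image (Finsupp.weight w)).bddBelow
      refine ⟨a, fun m hm => ?_⟩
      ext d
      change MvPolynomial.coeff d (MvPolynomial.weightedHomogeneousComponent w m x) = _
      rw [MvPolynomial.coeff_weightedHomogeneousComponent, MvPolynomial.coeff_zero]
      split_ifs with h
      · by_contra hd
        have := ha (Finset.mem_coe.2 (Finset.mem_image_of_mem _ (MvPolynomial.mem_support_iff.2 hd)))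
        omega
      · rfl)

theorem coeff_polynomial_symb (w : τ → ℤ) (m : ℤ) (x : MvPolynomial τ k) (d : τ →₀ ℕ) [Decidable (Finsupp.weight w d = m)] :
    ((polynomial k w).symb m x).coeff d = if Finsupp.weight w d = m then x.coeff d else 0 := by
  classical
  change MvPolynomial.coeff d (MvPolynomial.weightedHomogeneousComponent w m x) = _
  rw [MvPolynomial.coeff_weightedHomogeneousComponent]
  split_ifs <;> rfl

theorem weight_mono_finite [Finite τ] {w : τ → ℤ} (hw : ∀ v, 0 < w v) (m : ℤ) :
    {d : τ →₀ ℕ | Finsupp.weight w d ≤ m}.Finite := by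
  classical
  have := Fintype.ofFinite τ
  refine (Set.finite_Iic (Finsupp.equivFunOnFinite.symm fun _ : τ => m.toNat)).subset fun d hd v => ?_
  have h1 : (d v : ℤ) ≤ Finsupp.weight w d := by
    rw [Finsupp.weight_apply, Finsupp.sum_fintype _ _ (by simp)]
    have h2 : (d v : ℤ) ≤ d v • w v := by
      rw [nsmul_eq_mul]; nlinarith [hw v, Int.natCast_nonneg (d v)]
    refine h2.trans (Finset.single_le_sum (f := fun v => d v • w v) (fun i _ => ?_)
      (Finset.mem_univ v))
    exact nsmul_nonneg (hw i).le _
  have h3 : Finsupp.weight w d ≤ m := hd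
  have : d v ≤ m.toNat := by omega
  simpa using this

/-- Symbols of power series for positive weights. -/
noncomputable def powerSeries [Finite τ] (k : Type*) [CommRing k] (w : τ → ℤ) (hw : ∀ v, 0 < w v) :
    SymbolMap (MvPowerSeries τ k) (MvPolynomial τ k) := by
  classical
  have fin : ∀ m, {d : τ →₀ ℕ | Finsupp.weight w d = m}.Finite := fun m =>
    (weight_mono_finite hw m).subset fun d hd => le_of_eq hd
  have hcoeff : ∀ (m : ℤ) (x : MvPowerSeries τ k) (d : τ →₀ ℕ),
      MvPolynomial.coeff d (∑ e ∈ (fin m).toFinset, MvPolynomial.monomial e (MvPowerSeries.coeff e x)) =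
        if Finsupp.weight w d = m then MvPowerSeries.coeff d x else 0 := by
    intro m x d
    rw [MvPolynomial.coeff_sum]
    simp [MvPolynomial.coeff_monomial]
  exact ofCoeff w (fun d => (MvPowerSeries.coeff d).toAddMonoidHom)
    (fun d x y => MvPowerSeries.coeff_mul d x y)
    (fun m =>
      { toFun := fun x => ∑ e ∈ (fin m).toFinset, MvPolynomial.monomial e (MvPowerSeries.coeff e x)
        map_zero' := by simp
        map_add' := fun x y => by simp [Finset.sum_add_distrib] })
    (fun m x d => hcoeff m x d)
    MvPolynomial.coeToMvPowerSeries.ringHom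
    (fun d g => MvPolynomial.coeff_coe g d)
    (fun x => ⟨0, fun m hm => by
      refine Finset.sum_eq_zero fun d hd => ?_
      have h1 : Finsupp.weight w d = m := by simpa using hd
      have : 0 ≤ Finsupp.weight w d := by
        rw [Finsupp.weight_apply]
        exact Finset.sum_nonneg fun i _ => nsmul_nonneg (hw i).le _
      omega⟩)

theorem coeff_powerSeries_symb [Finite τ] (w : τ → ℤ) (hw : ∀ v, 0 < w v) (m : ℤ)
    (x : MvPowerSeries τ k) (d : τ →₀ ℕ) [Decidable (Finsupp.weight w d = m)] :
    ((powerSeries k w hw).symb m x).coeff d =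
      if Finsupp.weight w d = m then MvPowerSeries.coeff d x else 0 := by
  classical
  change MvPolynomial.coeff d (∑ e ∈ Set.Finite.toFinset _, _) = _
  rw [MvPolynomial.coeff_sum]
  simp [MvPolynomial.coeff_monomial]

theorem mem_fil_polynomial {w : τ → ℤ} {a : ℤ} {x : MvPolynomial τ k} :
    x ∈ (polynomial k w).fil a ↔ ∀ d, Finsupp.weight w d < a → x.coeff d = 0 := by
  classical
  constructor
  · intro h d hd
    have := congrArg (MvPolynomial.coeff d) (h _ hd)
    rwa [coeff_polynomial_symb, if_pos rfl, MvPolynomial.coeff_zero] at this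
  · intro h m hm
    ext d
    rw [coeff_polynomial_symb, MvPolynomial.coeff_zero]
    split_ifs with h1
    · exact h d (h1 ▸ hm)
    · rfl

theorem mem_fil_powerSeries [Finite τ] {w : τ → ℤ} {hw : ∀ v, 0 < w v} {a : ℤ}
    {x : MvPowerSeries τ k} :
    x ∈ (powerSeries k w hw).fil a ↔ ∀ d, Finsupp.weight w d < a → MvPowerSeries.coeff d x = 0 := by
  classical
  constructor
  · intro h d hd
    have := congrArg (MvPolynomial.coeff d) (h _ hd)
    rwa [coeff_powerSeries_symb, if_pos rfl, MvPolynomial.coeff_zero] at this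
  · intro h m hm
    ext d
    rw [coeff_powerSeries_symb, MvPolynomial.coeff_zero]
    split_ifs with h1
    · exact h d (h1 ▸ hm)
    · rfl

theorem X_mem_fil_polynomial (w : τ → ℤ) (v : τ) :
    (MvPolynomial.X v : MvPolynomial τ k) ∈ (polynomial k w).fil (w v) := by
  classical
  refine mem_fil_polynomial.2 fun d hd => ?_
  rw [MvPolynomial.coeff_X]
  refine if_neg fun h => ?_
  rw [← h, Finsupp.weight_single, one_smul] at hd
  exact lt_irrefl _ hd

theorem C_mem_fil_polynomial (w : τ → ℤ) (c : k) :
    (MvPolynomial.C c : MvPolynomial τ k) ∈ (polynomial k w).fil 0 := by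
  classical
  refine mem_fil_polynomial.2 fun d hd => ?_
  rw [MvPolynomial.coeff_C]
  refine if_neg fun h => ?_
  rw [← h, map_zero] at hd
  exact lt_irrefl _ hd

end SymbolMap

namespace MvPolynomial

variable {τ k ι : Type*} [Field k]

theorem prod_X_eq_monomial (e : Finset τ) :
    (∏ v ∈ e, X v : MvPolynomial τ k) = monomial (∑ v ∈ e, Finsupp.single v 1) 1 := by
  rw [monomial_sum_one]; rfl

theorem sum_single_apply [DecidableEq τ] (e : Finset τ) (v : τ) :
    (∑ u ∈ e, Finsupp.single u 1 : τ →₀ ℕ) v = if v ∈ e then 1 else 0 := by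
  rw [Finsupp.finsetSum_apply]
  simp [Finsupp.single_apply]

theorem sum_single_le_iff (e : Finset τ) (d : τ →₀ ℕ) :
    ∑ u ∈ e, Finsupp.single u 1 ≤ d ↔ ∀ v ∈ e, d v ≠ 0 := by
  classical
  constructor
  · intro h v hv
    have := h v
    rw [sum_single_apply, if_pos hv] at this
    omega
  · intro h v
    rw [sum_single_apply]
    split_ifs with hv
    · exact Nat.one_le_iff_ne_zero.2 (h v hv)
    · exact Nat.zero_le _

theorem mem_span_squarefree_iff {e : ι → Finset τ} {c : ι → k} (hc : ∀ l, c l ≠ 0) (s : Set ι)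
    (x : MvPolynomial τ k) :
    x ∈ Ideal.span ((fun l => C (c l) * ∏ v ∈ e l, X v) '' s) ↔
      ∀ d ∈ x.support, ∃ l ∈ s, ∀ v ∈ e l, d v ≠ 0 := by
  have h1 : Ideal.span ((fun l => C (c l) * ∏ v ∈ e l, X v : ι → MvPolynomial τ k) '' s) =
      Ideal.span ((fun d : τ →₀ ℕ => monomial d (1 : k)) ''
        ((fun l => ∑ v ∈ e l, Finsupp.single v 1) '' s)) := by
    apply le_antisymm
    · rw [Ideal.span_le]
      rintro _ ⟨l, hl, rfl⟩
      refine Ideal.mul_mem_left _ _ (Ideal.subset_span ⟨_, ⟨l, hl, rfl⟩, ?_⟩)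
      exact (prod_X_eq_monomial _).symm
    · rw [Ideal.span_le]
      rintro _ ⟨_, ⟨l, hl, rfl⟩, rfl⟩
      have : (monomial (∑ v ∈ e l, Finsupp.single v 1) 1 : MvPolynomial τ k) =
          C (c l)⁻¹ * (C (c l) * ∏ v ∈ e l, X v) := by
        rw [← mul_assoc, ← C_mul, inv_mul_cancel₀ (hc l), C_1, one_mul, prod_X_eq_monomial]
      simp only [SetLike.mem_coe]
      rw [this]
      exact Ideal.mul_mem_left _ _ (Ideal.subset_span ⟨l, hl, rfl⟩)
  rw [h1, mem_ideal_span_monomial_image]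
  refine forall₂_congr fun d _ => ?_
  constructor
  · rintro ⟨_, ⟨l, hl, rfl⟩, h⟩
    exact ⟨l, hl, (sum_single_le_iff _ _).1 h⟩
  · rintro ⟨l, hl, h⟩
    exact ⟨_, ⟨l, hl, rfl⟩, (sum_single_le_iff _ _).2 h⟩

theorem stronglyRegular_squarefree {e : ι → Finset τ} {c : ι → k} (hc : ∀ l, c l ≠ 0)
    (he : Pairwise fun i j => Disjoint (e i) (e j)) :
    StronglyRegular (fun l => C (c l) * ∏ v ∈ e l, X v : ι → MvPolynomial τ k) := by
  classical
  intro s r hr x hx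
  rw [mem_span_squarefree_iff hc] at hx ⊢
  intro d hd
  obtain ⟨l, hl, h⟩ := hx (∑ v ∈ e r, Finsupp.single v 1 + d) (by
    rw [mem_support_iff, mul_assoc, coeff_C_mul, prod_X_eq_monomial, coeff_monomial_mul]
    exact mul_ne_zero (hc r) (mul_ne_zero one_ne_zero (mem_support_iff.1 hd)))
  refine ⟨l, hl, fun v hv => ?_⟩
  have := h v hv
  have hne : l ≠ r := fun h => hr (h ▸ hl)
  rw [Finsupp.add_apply, sum_single_apply, if_neg, zero_add] at this
  · exact this
  · exact fun hv' => Finset.disjoint_left.1 (he hne) hv hv'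

theorem isRadical_squarefree {e : ι → Finset τ} {c : ι → k} (hc : ∀ l, c l ≠ 0)
    (x : MvPolynomial τ k)
    (hx : x ^ 2 ∈ Ideal.span (Set.range (fun l => C (c l) * ∏ v ∈ e l, X v))) :
    x ∈ Ideal.span (Set.range (fun l => C (c l) * ∏ v ∈ e l, X v)) := by
  classical
  rw [← Set.image_univ] at hx ⊢
  rw [mem_span_squarefree_iff hc]
  intro d hd
  by_contra! hcon
  let φ : MvPolynomial τ k →ₐ[k] MvPolynomial τ k := aeval fun v => if d v = 0 then 0 else X v
  have hker : Ideal.span ((fun l => C (c l) * ∏ v ∈ e l, X v) '' Set.univ) ≤ RingHom.ker φ := by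
    rw [Ideal.span_le]
    rintro _ ⟨l, -, rfl⟩
    obtain ⟨v, hv, hdv⟩ := hcon l trivial
    simp only [SetLike.mem_coe, RingHom.mem_ker, map_mul, map_prod]
    rw [Finset.prod_eq_zero hv, mul_zero]
    simp [φ, hdv]
  have h0 : φ x = 0 := by
    have := hker hx
    rw [RingHom.mem_ker, map_pow] at this
    exact pow_eq_zero_iff two_ne_zero |>.1 this
  have hcoef : ∀ y : MvPolynomial τ k, coeff d (φ y) = coeff d y := by
    intro y
    induction y using MvPolynomial.induction_on' with
    | add p q hp hq => rw [map_add, coeff_add, coeff_add, hp, hq]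
    | monomial u a =>
      simp only [φ, aeval_monomial, algebraMap_eq]
      rw [coeff_C_mul, coeff_monomial]
      by_cases hu : ∃ v ∈ u.support, d v = 0
      · obtain ⟨v, hv, hdv⟩ := hu
        rw [Finsupp.prod, Finset.prod_eq_zero hv, coeff_zero, mul_zero, if_neg]
        · rintro rfl
          exact Finsupp.mem_support_iff.1 hv hdv
        · rw [if_pos hdv, zero_pow (Finsupp.mem_support_iff.1 hv)]
      · push Not at hu
        have : (u.prod fun i k_1 => (if d i = 0 then 0 else X i : MvPolynomial τ k) ^ k_1) =
            monomial u 1 := by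
          rw [monomial_eq, C_1, one_mul]
          exact Finset.prod_congr rfl fun v hv => by simp [hu v hv]
        rw [this, coeff_monomial]
        split_ifs <;> simp
  rw [mem_support_iff, ← hcoef, h0, coeff_zero] at hd
  exact hd rfl

/-- The members of the family have leading monomials that are squarefree and pairwise coprime,
leading meaning of strictly lowest weight for a common weight. -/
def HasLeads (f : ι → MvPolynomial τ k) : Prop :=
  ∃ (e : ι → Finset τ) (c : ι → k) (ω : τ → ℤ), (∀ l, c l ≠ 0) ∧
    (Pairwise fun i j => Disjoint (e i) (e j)) ∧ ∀ (Λ : ℤ) (l : ι),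
      f l - C (c l) * ∏ v ∈ e l, X v ∈
        (SymbolMap.polynomial k fun v => ω v - Λ).fil (∑ v ∈ e l, (ω v - Λ) + 1)

theorem HasLeads.exists_hasSymb [Finite τ] {f : ι → MvPolynomial τ k} (hf : HasLeads f) :
    ∃ (T : SymbolMap (MvPolynomial τ k) (MvPolynomial τ k)) (e : ι → Finset τ) (c : ι → k)
      (d : ι → ℤ), (∀ l, c l ≠ 0) ∧ (Pairwise fun i j => Disjoint (e i) (e j)) ∧
      (∀ I, T.Closed I) ∧ T.HasSymb f (fun l => C (c l) * ∏ v ∈ e l, X v) d := by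
  classical
  obtain ⟨e, c, ω, hc, he, h⟩ := hf
  obtain ⟨Λ, hΛ⟩ : ∃ Λ : ℤ, ∀ v, ω v ≤ Λ := by
    obtain ⟨Λ, hΛ⟩ := (Set.finite_range ω).bddAbove
    exact ⟨Λ, fun v => hΛ ⟨v, rfl⟩⟩
  refine ⟨SymbolMap.polynomial k fun v => ω v - Λ, e, c, fun l => ∑ v ∈ e l, (ω v - Λ), hc, he,
    fun I x hx => ?_, fun l => ?_⟩
  · obtain ⟨y, hy, hxy⟩ := hx 1
    have : x - y = 0 := by
      ext d
      refine SymbolMap.mem_fil_polynomial.1 hxy d ?_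
      rw [Finsupp.weight_apply]
      refine lt_of_le_of_lt (Finset.sum_nonpos fun v _ => ?_) one_pos
      exact nsmul_nonpos (by have := hΛ v; omega) _
    rw [sub_eq_zero.1 this]
    exact hy
  · have hw : Finsupp.weight (fun v => ω v - Λ) (∑ v ∈ e l, Finsupp.single v 1) =
        ∑ v ∈ e l, (ω v - Λ) := by
      rw [map_sum]
      exact Finset.sum_congr rfl fun v _ => by rw [Finsupp.weight_single, one_smul]
    have hmon : (C (c l) * ∏ v ∈ e l, X v : MvPolynomial τ k) ∈
        (SymbolMap.polynomial k fun v => ω v - Λ).fil (∑ v ∈ e l, (ω v - Λ)) := by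
      refine SymbolMap.mem_fil_polynomial.2 fun d hd => ?_
      rw [coeff_C_mul, prod_X_eq_monomial, coeff_monomial, if_neg, mul_zero]
      rintro rfl
      exact absurd hw hd.ne
    have hl := h Λ l
    constructor
    · rw [← sub_add_cancel (f l) (C (c l) * ∏ v ∈ e l, X v)]
      exact add_mem (SymbolMap.fil_mono _ (lt_add_one _).le hl) hmon
    · have := hl _ (lt_add_one _)
      rw [map_sub, sub_eq_zero] at this
      rw [this]
      ext d
      rw [SymbolMap.coeff_polynomial_symb, coeff_C_mul, prod_X_eq_monomial, coeff_monomial]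
      split_ifs with h1 h2 h2
      · rfl
      · rfl
      · subst h2; exact absurd hw h1
      · simp

theorem HasLeads.stronglyRegular [Finite τ] {f : ι → MvPolynomial τ k} (hf : HasLeads f) :
    StronglyRegular f := by
  obtain ⟨T, e, c, d, hc, he, hcl, hs⟩ := hf.exists_hasSymb
  exact hs.stronglyRegular (stronglyRegular_squarefree hc he) hcl

theorem HasLeads.isRadical [Finite τ] [Finite ι] {f : ι → MvPolynomial τ k} (hf : HasLeads f)
    (x : MvPolynomial τ k) (hx : x ^ 2 ∈ Ideal.span (Set.range f)) :
    x ∈ Ideal.span (Set.range f) := by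
  have := Fintype.ofFinite ι
  obtain ⟨T, e, c, d, hc, he, hcl, hs⟩ := hf.exists_hasSymb
  exact hs.isRadical (stronglyRegular_squarefree hc he) hcl (isRadical_squarefree hc) x hx

end MvPolynomial

namespace MvPolynomial

variable {τ k ι : Type*} [Field k]

theorem isDomain_and_isIntegrallyClosed_of_leads [Finite τ] [Finite ι] {Q : Type*} [CommRing Q]
    [IsDomain Q] [IsIntegrallyClosed Q] (f : ι → MvPolynomial τ k)
    (H : Set (MvPolynomial τ k)) (hH : ∀ h ∈ H, HasLeads fun o : Option ι => o.elim h f)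
    (ψ : Q →+* MvPolynomial τ k ⧸ Ideal.span (Set.range f)) (hψ : Function.Injective ψ)
    (hC : ∀ c, Ideal.Quotient.mk _ (C c) ∈ ψ.range)
    (h3 : ∀ h ∈ H, Ideal.Quotient.mk _ h ∈ ψ.range)
    (h4 : ∀ v, ∃ g ∈ Submonoid.closure (Ideal.Quotient.mk (Ideal.span (Set.range f)) '' H),
      g * Ideal.Quotient.mk _ (X v) ∈ ψ.range) :
    IsDomain (MvPolynomial τ k ⧸ Ideal.span (Set.range f)) ∧
      IsIntegrallyClosed (MvPolynomial τ k ⧸ Ideal.span (Set.range f)) := by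
  classical
  have := Fintype.ofFinite ι
  have h3' : ∀ h ∈ Ideal.Quotient.mk (Ideal.span (Set.range f)) '' H, h ∈ ψ.range := by
    rintro _ ⟨h, hh, rfl⟩
    exact h3 h hh
  have hrange : ∀ g ∈ Submonoid.closure (Ideal.Quotient.mk (Ideal.span (Set.range f)) '' H),
      g ∈ ψ.range := fun g hg => (Submonoid.closure_le.2 h3' : _ ≤ ψ.range.toSubmonoid) hg
  refine isDomain_and_isIntegrallyClosed_of_clear ψ hψ _ ?_ ?_ h3' ?_
  · rintro _ ⟨h, hh, rfl⟩
    rw [mem_nonZeroDivisors_iff_right]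
    intro x hx
    obtain ⟨x, rfl⟩ := Ideal.Quotient.mk_surjective x
    rw [mul_comm, ← map_mul, Ideal.Quotient.eq_zero_iff_mem] at hx
    rw [Ideal.Quotient.eq_zero_iff_mem]
    have himg : (fun o : Option ι => o.elim h f) '' ((Finset.univ.image some : Finset (Option ι))) =
        Set.range f := by
      ext y; simp
    have := (hH h hh).stronglyRegular (Finset.univ.image some) none (by simp) x
    rw [himg] at this
    exact this hx
  · rintro _ ⟨h, hh, rfl⟩ r hr
    obtain ⟨r, rfl⟩ := Ideal.Quotient.mk_surjective r
    have himg : Ideal.span (Set.range (fun o : Option ι => o.elim h f)) =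
        Ideal.span {h} ⊔ Ideal.span (Set.range f) := by
      rw [← Ideal.span_union]
      congr 1
      ext y; simp [Option.exists, eq_comm]
    have hiff : ∀ y : MvPolynomial τ k, Ideal.Quotient.mk (Ideal.span (Set.range f)) h ∣
        Ideal.Quotient.mk _ y ↔ y ∈ Ideal.span (Set.range (fun o : Option ι => o.elim h f)) := by
      intro y
      rw [himg, Submodule.mem_sup]
      constructor
      · rintro ⟨z, hz⟩
        obtain ⟨z, rfl⟩ := Ideal.Quotient.mk_surjective z
        rw [← map_mul, Ideal.Quotient.eq] at hz
        exact ⟨h * z, Ideal.mem_span_singleton.2 (dvd_mul_right _ _), _, hz, by ring⟩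
      · rintro ⟨a, ha, b, hb, rfl⟩
        rw [map_add, Ideal.Quotient.eq_zero_iff_mem.2 hb, add_zero]
        exact map_dvd _ (Ideal.mem_span_singleton.1 ha)
    rw [← map_pow, hiff] at hr
    rw [hiff]
    exact (hH h hh).isRadical r hr
  · intro x
    obtain ⟨x, rfl⟩ := Ideal.Quotient.mk_surjective x
    induction x using MvPolynomial.induction_on with
    | C a => exact ⟨1, one_mem _, by rw [one_mul]; exact hC a⟩
    | add p q hp hq =>
      obtain ⟨g, hg, hgp⟩ := hp
      obtain ⟨g', hg', hgq⟩ := hq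
      refine ⟨g * g', mul_mem hg hg', ?_⟩
      have : g * g' * Ideal.Quotient.mk (Ideal.span (Set.range f)) (p + q) =
          g' * (g * Ideal.Quotient.mk _ p) + g * (g' * Ideal.Quotient.mk _ q) := by
        rw [map_add]; ring
      rw [this]
      exact add_mem (mul_mem (hrange _ hg') hgp) (mul_mem (hrange _ hg) hgq)
    | mul_X p v hp =>
      obtain ⟨g, hg, hgp⟩ := hp
      obtain ⟨g', hg', hgq⟩ := h4 v
      refine ⟨g * g', mul_mem hg hg', ?_⟩
      rw [map_mul, mul_mul_mul_comm]
      exact mul_mem hgp hgq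

end MvPolynomial

section

namespace SymbolMap

variable {τ k : Type*} [Field k]

theorem prod_mem_fil_polynomial {κ : Type*} (w : τ → ℤ) (s : Finset κ) (x : κ → MvPolynomial τ k)
    (a : κ → ℤ) (h : ∀ i ∈ s, x i ∈ (polynomial k w).fil (a i)) :
    ∏ i ∈ s, x i ∈ (polynomial k w).fil (∑ i ∈ s, a i) := by
  classical
  induction s using Finset.induction_on with
  | empty => simpa using C_mem_fil_polynomial w (1 : k)
  | insert i s hi ih =>
    rw [Finset.prod_insert hi, Finset.sum_insert hi]
    exact mul_mem_fil _ (h i (Finset.mem_insert_self i s))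
      (ih fun j hj => h j (Finset.mem_insert_of_mem hj))

theorem X_mul_X_mem_fil_polynomial (w : τ → ℤ) {u v : τ} {a : ℤ} (h : a ≤ w u + w v) :
    (MvPolynomial.X u * MvPolynomial.X v : MvPolynomial τ k) ∈ (polynomial k w).fil a :=
  fil_mono _ h (mul_mem_fil _ (X_mem_fil_polynomial w u) (X_mem_fil_polynomial w v))

theorem sum_sub_mem {M κ : Type*} [AddCommGroup M] [DecidableEq κ] (A : AddSubgroup M)
    {s : Finset κ} {k₀ : κ} (hk : k₀ ∈ s) {x : κ → M} (h : ∀ k ∈ s, k ≠ k₀ → x k ∈ A) :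
    ∑ k ∈ s, x k - x k₀ ∈ A := by
  rw [← Finset.add_sum_erase s x hk, add_sub_cancel_left]
  exact sum_mem fun k hk' => h k (Finset.mem_of_mem_erase hk') (Finset.ne_of_mem_erase hk')

end SymbolMap

open MvPolynomial

/-- The variables for two generic square matrices and some free parameters. -/
abbrev PairVar (τ : Type*) (n : ℕ) := τ ⊕ (Fin n × Fin n) ⊕ (Fin n × Fin n)

namespace PairVar

variable (k τ : Type*) [Field k] (n : ℕ)

/-- The first generic matrix. -/
noncomputable def matC : Matrix (Fin n) (Fin n) (MvPolynomial (PairVar τ n) k) :=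
  Matrix.of fun i j => X (Sum.inr (Sum.inl (i, j)))

/-- The second generic matrix. -/
noncomputable def matD : Matrix (Fin n) (Fin n) (MvPolynomial (PairVar τ n) k) :=
  Matrix.of fun i j => X (Sum.inr (Sum.inr (i, j)))

/-- The entries of the product of the two generic matrices below the diagonal. -/
noncomputable def rel (p : {p : Fin n × Fin n // p.2 < p.1}) : MvPolynomial (PairVar τ n) k :=
  (matC k τ n * matD k τ n) p.1.1 p.1.2

/-- The position in the product `(CD)ᵢⱼ` of the leading term. -/
def pos {n : ℕ} (p : {p : Fin n × Fin n // p.2 < p.1}) : Fin n :=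
  ⟨p.1.1 - p.1.2 - 1, by have := p.1.1.isLt; omega⟩

theorem cast_pos {n : ℕ} (p : {p : Fin n × Fin n // p.2 < p.1}) :
    ((pos p : ℕ) : ℤ) = p.1.1 - p.1.2 - 1 := by
  have : (p.1.2 : ℕ) < p.1.1 := p.2
  simp only [pos]
  omega

/-- The weights which single out the leading terms. -/
def wt : PairVar τ n → ℤ :=
  Sum.elim (fun _ => 0) (Sum.elim (fun p => ((p.2 : ℤ) - p.1) ^ 2)
    fun p => 2 * ((p.2 : ℤ) + 1) * (p.1 + 1))

set_option maxHeartbeats 1000000 in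
theorem hasLeads : HasLeads fun o : Option {p : Fin n × Fin n // p.2 < p.1} =>
    o.elim (matC k τ n).det (rel k τ n) := by
  classical
  refine ⟨fun o => o.elim (Finset.univ.image fun i => Sum.inr (Sum.inl (i, i)))
      fun p => {Sum.inr (Sum.inl (p.1.1, pos p)), Sum.inr (Sum.inr (pos p, p.1.2))},
    fun _ => 1, wt τ n, fun _ => one_ne_zero, ?_, ?_⟩
  · have key : ∀ p p' : {p : Fin n × Fin n // p.2 < p.1}, p ≠ p' →
        ¬ (p.1.1 = p'.1.1 ∧ pos p = pos p') ∧ ¬ (pos p = pos p' ∧ p.1.2 = p'.1.2) := by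
      intro p p' hne
      have h1 := cast_pos p
      have h2 := cast_pos p'
      have h3 : ¬ ((p.1.1 : ℕ) = p'.1.1 ∧ (p.1.2 : ℕ) = p'.1.2) := fun h =>
        hne (Subtype.ext (Prod.ext (Fin.ext h.1) (Fin.ext h.2)))
      simp only [Fin.ext_iff]
      constructor <;> omega
    have key2 : ∀ p : {p : Fin n × Fin n // p.2 < p.1}, p.1.1 ≠ pos p := by
      intro p h
      have h1 := cast_pos p
      rw [← h] at h1
      omega
    refine fun o o' hne => Finset.disjoint_left.2 fun v hv hv' => ?_
    rcases o with _ | p <;> rcases o' with _ | p'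
    · exact hne rfl
    · obtain ⟨i, -, rfl⟩ := Finset.mem_image.1 hv
      simp only [Option.elim_some, Finset.mem_insert, Finset.mem_singleton, Sum.inr.injEq,
        Sum.inl.injEq, Prod.mk.injEq, reduceCtorEq, or_false] at hv'
      exact key2 p' (hv'.1.symm.trans hv'.2)
    · obtain ⟨i, -, rfl⟩ := Finset.mem_image.1 hv'
      simp only [Option.elim_some, Finset.mem_insert, Finset.mem_singleton, Sum.inr.injEq,
        Sum.inl.injEq, Prod.mk.injEq, reduceCtorEq, or_false] at hv
      exact key2 p (hv.1.symm.trans hv.2)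
    · have hk := key p p' fun h => hne (congrArg some h)
      simp only [Option.elim_some, Finset.mem_insert, Finset.mem_singleton] at hv hv'
      rcases hv with rfl | rfl
      · simp only [Sum.inr.injEq, Sum.inl.injEq, Prod.mk.injEq, reduceCtorEq, or_false] at hv'
        exact hk.1 hv'
      · simp only [Sum.inr.injEq, Prod.mk.injEq, reduceCtorEq, false_or] at hv'
        exact hk.2 hv'
  · rintro Λ (_ | p)
    · have hinj : ∀ s : Finset (Fin n), Set.InjOn
          (fun i : Fin n => (Sum.inr (Sum.inl (i, i)) : PairVar τ n)) s := by
        intro s i _ j _ h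
        simpa using h
      simp only [Option.elim_none, C_1, one_mul]
      rw [Finset.prod_image (hinj _), Finset.sum_image (hinj _), Matrix.det_apply]
      have h1 : (∏ i, X (Sum.inr (Sum.inl (i, i))) : MvPolynomial (PairVar τ n) k) =
          Equiv.Perm.sign (1 : Equiv.Perm (Fin n)) • ∏ i, matC k τ n ((1 : Equiv.Perm (Fin n)) i) i := by
        simp [matC]
      rw [h1]
      refine SymbolMap.sum_sub_mem _ (Finset.mem_univ _) fun σ _ hσ => ?_
      have h2 : ∏ i, matC k τ n (σ i) i ∈ (SymbolMap.polynomial k fun v : PairVar τ n => wt τ n v - Λ).fil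
          (∑ i : Fin n, (((i : ℤ) - (σ i : ℕ)) ^ 2 - Λ)) :=
        SymbolMap.prod_mem_fil_polynomial _ _ _ _ fun i _ =>
          SymbolMap.X_mem_fil_polynomial (fun v : PairVar τ n => wt τ n v - Λ)
            (Sum.inr (Sum.inl (σ i, i)))
      rw [Units.smul_def]
      refine zsmul_mem (SymbolMap.fil_mono _ ?_ h2) _
      obtain ⟨i, hi⟩ : ∃ i, σ i ≠ i := by
        by_contra! h
        exact hσ (Equiv.ext h)
      simp only [wt, Sum.elim_inr, Sum.elim_inl, sub_self, Finset.sum_sub_distrib]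
      have hpos : 0 < ∑ i : Fin n, ((i : ℤ) - (σ i : ℕ)) ^ 2 :=
        Finset.sum_pos' (fun i _ => sq_nonneg _) ⟨i, Finset.mem_univ _, by
          have : (i : ℤ) - (σ i : ℕ) ≠ 0 := fun h => hi (Fin.ext (by omega))
          positivity⟩
      simp only [ne_eq, OfNat.ofNat_ne_zero, not_false_eq_true, zero_pow, Finset.sum_const_zero]
      linarith
    · have hk := cast_pos p
      simp only [Option.elim_some, C_1, one_mul]
      rw [Finset.prod_pair (by simp), Finset.sum_pair (by simp)]
      simp only [wt, Sum.elim_inr, Sum.elim_inl]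
      rw [rel, Matrix.mul_apply]
      refine SymbolMap.sum_sub_mem _ (Finset.mem_univ (pos p)) fun j _ hj => ?_
      refine SymbolMap.X_mul_X_mem_fil_polynomial _ ?_
      simp only [Sum.elim_inr, Sum.elim_inl]
      have hne : (j : ℤ) - pos p ≠ 0 := fun h => hj (Fin.ext (by omega))
      have : 0 < ((j : ℤ) - pos p) ^ 2 := by positivity
      rw [hk] at this ⊢
      nlinarith
end PairVar

end

section

open MvPolynomial

namespace Matrix

variable {T n : Type*} [CommRing T] [Fintype n] [DecidableEq n] (A : Subring T)

theorem adjugate_mem_subring {M : Matrix n n T} (h : ∀ i j, M i j ∈ A) (i j : n) :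
    M.adjugate i j ∈ A := by
  let M' : Matrix n n A := Matrix.of fun i j => ⟨M i j, h i j⟩
  have h1 : M = A.subtype.mapMatrix M' := by
    ext i j; rfl
  rw [h1, ← RingHom.map_adjugate]
  exact (M'.adjugate i j).2

theorem det_mem_subring {M : Matrix n n T} (h : ∀ i j, M i j ∈ A) : M.det ∈ A := by
  rw [det_apply']
  exact sum_mem fun σ _ => mul_mem (intCast_mem _ _) (prod_mem fun i _ => h _ _)

theorem det_mul_eq_sum_adjugate (M : Matrix n n T) (v : n → T) (i : n) :
    M.det * v i = ∑ j, M.adjugate i j * ∑ l, M j l * v l := by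
  have h := congrFun (congrArg (· *ᵥ v) M.adjugate_mul) i
  simp only [smul_mulVec, one_mulVec, Pi.smul_apply, smul_eq_mul, ← mulVec_mulVec] at h
  exact h.symm

theorem det_mul_mem_subring {M : Matrix n n T} (h : ∀ i j, M i j ∈ A) (v : n → T)
    (hv : ∀ i, ∑ j, M i j * v j ∈ A) (i : n) : M.det * v i ∈ A := by
  rw [det_mul_eq_sum_adjugate]
  exact sum_mem fun j _ => mul_mem (adjugate_mem_subring A h i j) (hv j)

end Matrix

namespace PairVar

variable (k τ : Type*) [Field k] (n : ℕ)

/-- The variables parametrizing a birational model of the relation scheme. -/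
abbrev Param := τ ⊕ (Fin n × Fin n) ⊕ {p : Fin n × Fin n // p.1 ≤ p.2}

/-- The relation ring. -/
abbrev quot := MvPolynomial (PairVar τ n) k ⧸ Ideal.span (Set.range (rel k τ n))

/-- The polynomial ring over which the relation ring is birational. -/
noncomputable def param : MvPolynomial (Param τ n) k →+* quot k τ n :=
  (aeval (Sum.elim (fun t => Ideal.Quotient.mk _ (X (Sum.inl t)))
    (Sum.elim (fun p => Ideal.Quotient.mk _ (matC k τ n p.1 p.2))
      fun p => Ideal.Quotient.mk _ ((matC k τ n * matD k τ n) p.1.1 p.1.2)))).toRingHom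

/-- The generic matrix `C` over the parameters. -/
noncomputable def paramC : Matrix (Fin n) (Fin n) (MvPolynomial (Param τ n) k) :=
  Matrix.of fun i j => X (Sum.inr (Sum.inl (i, j)))

/-- The generic upper triangular matrix over the parameters. -/
noncomputable def paramM : Matrix (Fin n) (Fin n) (MvPolynomial (Param τ n) k) :=
  Matrix.of fun i j => if h : i ≤ j then X (Sum.inr (Sum.inr ⟨(i, j), h⟩)) else 0

theorem det_paramC_ne_zero : (paramC k τ n).det ≠ 0 := by
  intro h
  have h1 := congrArg (aeval (Sum.elim 0 (Sum.elim (fun p => (1 : Matrix (Fin n) (Fin n) k) p.1 p.2) 0) :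
    Param τ n → k)) h
  rw [AlgHom.map_det, map_zero] at h1
  have : (aeval (Sum.elim 0 (Sum.elim (fun p => (1 : Matrix (Fin n) (Fin n) k) p.1 p.2) 0) :
    Param τ n → k)).mapMatrix (paramC k τ n) = 1 := by
    ext i j
    simp [paramC]
  rw [this, Matrix.det_one] at h1
  exact one_ne_zero h1

theorem param_injective : Function.Injective (param k τ n) := by
  set F := FractionRing (MvPolynomial (Param τ n) k)
  let a : MvPolynomial (Param τ n) k →+* F := algebraMap _ F
  let C' : Matrix (Fin n) (Fin n) F := (paramC k τ n).map a
  let M' : Matrix (Fin n) (Fin n) F := (paramM k τ n).map a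
  have hdet : IsUnit C'.det := by
    have : C'.det = a (paramC k τ n).det := (RingHom.map_det a _).symm
    rw [this, isUnit_iff_ne_zero]
    exact (map_ne_zero_iff a (IsFractionRing.injective _ F)).2 (det_paramC_ne_zero k τ n)
  let φ : MvPolynomial (PairVar τ n) k →ₐ[k] F :=
    aeval (Sum.elim (fun t => a (X (Sum.inl t))) (Sum.elim (fun p => C' p.1 p.2)
      fun p => (C'⁻¹ * M') p.1 p.2))
  have hC : (matC k τ n).map φ = C' := by
    ext i j; simp [matC, φ]
  have hD : (matD k τ n).map φ = C'⁻¹ * M' := by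
    ext i j; simp [matD, φ]
  have hCD : (matC k τ n * matD k τ n).map φ = M' := by
    rw [Matrix.map_mul, hC, hD, Matrix.mul_nonsing_inv_cancel_left _ _ hdet]
  have hCD' : ∀ i j, φ ((matC k τ n * matD k τ n) i j) = M' i j := fun i j =>
    congrFun (congrFun hCD i) j
  let φ' : quot k τ n →+* F := Ideal.Quotient.lift _ φ.toRingHom <| by
    intro x hx
    have : Ideal.span (Set.range (rel k τ n)) ≤ RingHom.ker φ.toRingHom := by
      rw [Ideal.span_le]
      rintro _ ⟨p, rfl⟩
      have h := hCD' p.1.1 p.1.2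
      change φ _ = 0
      rw [rel, h]
      simp [M', paramM, not_le.2 p.2]
    exact this hx
  have hcomp : φ'.comp (param k τ n) = a := by
    refine MvPolynomial.ringHom_ext ?_ ?_
    · intro c
      simp only [RingHom.comp_apply, param, AlgHom.toRingHom_eq_coe, RingHom.coe_coe, ← MvPolynomial.algebraMap_eq, AlgHom.commutes]
      change φ (algebraMap _ _ c) = _
      rw [AlgHom.commutes, IsScalarTower.algebraMap_apply k (MvPolynomial (Param τ n) k) F]
    · rintro (t | p | p)
      · simp [param, φ', φ]
      · have := congrFun (congrFun hC p.1) p.2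
        simp only [RingHom.comp_apply, param, AlgHom.toRingHom_eq_coe, RingHom.coe_coe, aeval_X, Sum.elim_inr, Sum.elim_inl]
        change φ _ = _
        rw [Matrix.map_apply] at this
        rw [this]
        rfl
      · simp only [RingHom.comp_apply, param, AlgHom.toRingHom_eq_coe, RingHom.coe_coe, aeval_X, Sum.elim_inr]
        change φ _ = _
        rw [hCD']
        simp [M', paramM, p.2]
  have hinj : Function.Injective (φ'.comp (param k τ n)) := by
    rw [hcomp]; exact IsFractionRing.injective _ F
  rw [RingHom.coe_comp] at hinj
  exact hinj.of_comp

theorem isDomain_and_isIntegrallyClosed [Finite τ] :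
    IsDomain (quot k τ n) ∧ IsIntegrallyClosed (quot k τ n) := by
  have hCr : ∀ i j, Ideal.Quotient.mk (Ideal.span (Set.range (rel k τ n))) (matC k τ n i j) ∈
      (param k τ n).range := fun i j => ⟨X (Sum.inr (Sum.inl (i, j))), by simp [param]⟩
  have hCDr : ∀ i j, Ideal.Quotient.mk (Ideal.span (Set.range (rel k τ n)))
      ((matC k τ n * matD k τ n) i j) ∈ (param k τ n).range := by
    intro i j
    by_cases h : i ≤ j
    · exact ⟨X (Sum.inr (Sum.inr ⟨(i, j), h⟩)), by simp [param]⟩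
    · have : Ideal.Quotient.mk (Ideal.span (Set.range (rel k τ n)))
          ((matC k τ n * matD k τ n) i j) = 0 :=
        Ideal.Quotient.eq_zero_iff_mem.2 (Ideal.subset_span ⟨⟨(i, j), not_le.1 h⟩, rfl⟩)
      rw [this]; exact zero_mem _
  have hdet : Ideal.Quotient.mk (Ideal.span (Set.range (rel k τ n))) (matC k τ n).det ∈
      (param k τ n).range := by
    rw [RingHom.map_det]
    exact Matrix.det_mem_subring _ hCr
  refine isDomain_and_isIntegrallyClosed_of_leads (rel k τ n) {(matC k τ n).det} ?_
    (param k τ n) (param_injective k τ n) ?_ ?_ ?_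
  · rintro _ rfl
    exact hasLeads k τ n
  · intro c
    exact ⟨C c, by simp only [param, AlgHom.toRingHom_eq_coe, RingHom.coe_coe, ← MvPolynomial.algebraMap_eq, AlgHom.commutes]; rfl⟩
  · rintro _ rfl
    exact hdet
  · rintro (t | p | p)
    · exact ⟨1, one_mem _, X (Sum.inl t), by simp [param]⟩
    · exact ⟨1, one_mem _, X (Sum.inr (Sum.inl p)), by simp [param, matC]⟩
    · refine ⟨_, Submonoid.subset_closure ⟨_, rfl, rfl⟩, ?_⟩
      rw [RingHom.map_det]
      refine Matrix.det_mul_mem_subring _ hCr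
        (fun j => Ideal.Quotient.mk _ (matD k τ n j p.2)) (fun i => ?_) p.1
      have := hCDr i p.2
      rw [Matrix.mul_apply, map_sum] at this
      simpa only [map_mul] using this

end PairVar

end

section

open MvPolynomial

namespace SymbolMap

variable {τ k : Type*} [Field k]

theorem det_sub_antidiagonal_mem_fil (w : τ → ℤ) {r : ℕ}
    (M : Matrix (Fin r) (Fin r) (MvPolynomial τ k)) (Λ : ℤ)
    (h : ∀ i j : Fin r, M i j ∈ (polynomial k w).fil (((i : ℤ) + j + 1 - r) ^ 2 - Λ)) :
    M.det - ((Fin.revPerm (n := r)).sign : ℤ) • ∏ j, M j.rev j ∈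
      (polynomial k w).fil (∑ _j : Fin r, (-Λ) + 1) := by
  classical
  rw [Matrix.det_apply]
  have h1 : ((Fin.revPerm (n := r)).sign : ℤ) • ∏ j, M j.rev j =
    (Fin.revPerm (n := r)).sign • ∏ j, M (Fin.revPerm (n := r) j) j := by
    rw [Units.smul_def]; rfl
  rw [h1]
  refine sum_sub_mem _ (Finset.mem_univ _) fun σ _ hσ => ?_
  rw [Units.smul_def]
  refine zsmul_mem (fil_mono _ ?_ (prod_mem_fil_polynomial w _ _ _ fun j _ => h (σ j) j)) _
  obtain ⟨j, hj⟩ : ∃ j, σ j ≠ j.rev := by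
    by_contra! h
    exact hσ (Equiv.ext h)
  have hpos : 0 < ∑ j : Fin r, (((σ j : ℕ) : ℤ) + (j : ℕ) + 1 - r) ^ 2 :=
    Finset.sum_pos' (fun i _ => sq_nonneg _) ⟨j, Finset.mem_univ _, by
      have : ((σ j : ℕ) : ℤ) + (j : ℕ) + 1 - r ≠ 0 := by
        intro h
        apply hj
        ext
        rw [Fin.val_rev]
        omega
      positivity⟩
  rw [Finset.sum_sub_distrib, Finset.sum_neg_distrib]
  linarith

end SymbolMap

theorem pairwise_disjoint_of_owner {ι τ α : Type*} {e : ι → Finset τ} (own : τ → α) (code : ι → α)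
    (hcode : Function.Injective code) (h : ∀ l, ∀ v ∈ e l, own v = code l) :
    Pairwise fun i j => Disjoint (e i) (e j) := fun i j hij =>
  Finset.disjoint_left.2 fun v hi hj => hij (hcode ((h i v hi).symm.trans (h j v hj)))

/-- The variables for four generic square matrices and some free parameters. -/
abbrev QuadVar (ρ : Type*) (n : ℕ) := PairVar (PairVar ρ n) n

namespace QuadVar

variable (k ρ : Type*) [Field k]

section

variable {ρ} {n : ℕ}

/-- A variable of the first matrix. -/
abbrev va (i j : Fin n) : QuadVar ρ n := Sum.inl (Sum.inr (Sum.inl (i, j)))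

/-- A variable of the second matrix. -/
abbrev vb (i j : Fin n) : QuadVar ρ n := Sum.inl (Sum.inr (Sum.inr (i, j)))

/-- A variable of the third matrix. -/
abbrev vc (i j : Fin n) : QuadVar ρ n := Sum.inr (Sum.inl (i, j))

/-- A variable of the fourth matrix. -/
abbrev vd (i j : Fin n) : QuadVar ρ n := Sum.inr (Sum.inr (i, j))

/-- A free variable. -/
abbrev vr (t : ρ) : QuadVar ρ n := Sum.inl (Sum.inl t)

/-- A function on the variables. -/
def elim {α : Type*} (a b c d : Fin n → Fin n → α) (r : ρ → α) : QuadVar ρ n → α :=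
  Sum.elim (Sum.elim r (Sum.elim (fun p => a p.1 p.2) fun p => b p.1 p.2))
    (Sum.elim (fun p => c p.1 p.2) fun p => d p.1 p.2)

variable {α : Type*} (a b c d : Fin n → Fin n → α) (r : ρ → α)

@[simp] theorem elim_va (i j) : elim a b c d r (va i j) = a i j := rfl
@[simp] theorem elim_vb (i j) : elim a b c d r (vb i j) = b i j := rfl
@[simp] theorem elim_vc (i j) : elim a b c d r (vc i j) = c i j := rfl
@[simp] theorem elim_vd (i j) : elim a b c d r (vd i j) = d i j := rfl
@[simp] theorem elim_vr (t) : elim a b c d r (vr t) = r t := rfl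

end

variable (N : ℕ)

/-- The first generic matrix. -/
noncomputable def matA : Matrix (Fin (N + 1)) (Fin (N + 1)) (MvPolynomial (QuadVar ρ (N + 1)) k) :=
  Matrix.of fun i j => X (va i j)

/-- The second generic matrix. -/
noncomputable def matB : Matrix (Fin (N + 1)) (Fin (N + 1)) (MvPolynomial (QuadVar ρ (N + 1)) k) :=
  Matrix.of fun i j => X (vb i j)

/-- The third generic matrix. -/
noncomputable abbrev matC := PairVar.matC k (PairVar ρ (N + 1)) (N + 1)

/-- The fourth generic matrix. -/
noncomputable abbrev matD := PairVar.matD k (PairVar ρ (N + 1)) (N + 1)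

/-- The index set of the relations. -/
abbrev Idx := {p : Fin (N + 1) × Fin (N + 1) // p.2 < p.1} ⊕
  {p : Fin (N + 1) × Fin (N + 1) // p.2 < p.1} ⊕ {i : Fin (N + 1) // i ≠ 0} ⊕ Unit

/-- The part of the diagonal relations involving only the last two matrices. -/
noncomputable def diag (i : Fin (N + 1)) : MvPolynomial (QuadVar ρ (N + 1)) k :=
  (matC k ρ N * matD k ρ N) i i - (matD k ρ N * matC k ρ N) i i

/-- The initial forms of the relations. -/
noncomputable def rel : Idx N → MvPolynomial (QuadVar ρ (N + 1)) k :=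
  Sum.elim (fun p => -(matB k ρ N * matA k ρ N) p.1.2 p.1.1)
    (Sum.elim (PairVar.rel k (PairVar ρ (N + 1)) (N + 1))
      (Sum.elim (fun i => X (va i.1 0) * X (vb 0 i.1) + diag k ρ N i)
        fun _ => X (va (Fin.last N) (Fin.last N)) + X (vc (Fin.last N) (Fin.last N))))

variable {N}

/-- The value `i + 1` cyclically shifted to vanish at the last index. -/
def lam (i : Fin (N + 1)) : ℤ := if i = Fin.last N then 0 else (i : ℤ) + 1

/-- The weights which single out the leading terms. -/
def wt (π : Equiv.Perm (Fin (N + 1))) : QuadVar ρ (N + 1) → ℤ :=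
  elim (fun i j => 2 * ((N : ℤ) + 1 - j) * ((π i : ℕ) + 1))
    (fun i j => ((i : ℤ) + (π j : ℕ) - N) ^ 2)
    (fun i j => 4 * (lam j ^ 2 - 2 * i * lam j) + if i = 0 then 0 else 1)
    (fun i j => 8 * j * lam i) fun _ => 0

/-- The index occuring in the leading term of a diagonal relation. -/
def idx (i : Fin (N + 1)) : Fin (N + 1) := if i = Fin.last N then 0 else i

open scoped Classical in
/-- The leading monomials. -/
noncomputable def lead (π : Equiv.Perm (Fin (N + 1))) : Idx N → Finset (QuadVar ρ (N + 1)) :=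
  Sum.elim (fun p => {vb (ρ := ρ) p.1.2 (π.symm (PairVar.pos p)), va (π.symm (PairVar.pos p)) p.1.1})
    (Sum.elim (fun p => {vc (ρ := ρ) p.1.1 (PairVar.pos p), vd (PairVar.pos p) p.1.2})
      (Sum.elim (fun i => {vc (ρ := ρ) (idx i.1) (Fin.last N), vd (Fin.last N) (idx i.1)})
        fun _ => {vc (ρ := ρ) (Fin.last N) (Fin.last N)}))

/-- The leading coefficients. -/
def leadCoeff : Idx N → k :=
  Sum.elim (fun _ => -1) (Sum.elim (fun _ => 1)
    (Sum.elim (fun i => if i.1 = Fin.last N then -1 else 1) fun _ => 1))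

/-- A label for the relation whose leading term contains a variable. -/
def owner (π : Equiv.Perm (Fin (N + 1))) : QuadVar ρ (N + 1) → ℕ × ℤ × ℤ :=
  elim (fun i j => (0, (j : ℤ) - (π i : ℕ) - 1, (j : ℤ)))
    (fun i j => if (i : ℤ) + (π j : ℕ) = N then (4, 0, 0) else
      (0, (i : ℤ), (i : ℤ) + (π j : ℕ) + 1))
    (fun i j => if j = Fin.last N then (if i = Fin.last N then (3, 0, 0) else (2, (i : ℤ), 0)) else
      (1, (i : ℤ), (i : ℤ) - j - 1))
    (fun i j => if i = Fin.last N then (2, (j : ℤ), 0) else (1, (i : ℤ) + j + 1, (j : ℤ)))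
    fun _ => (5, 0, 0)

/-- The labels of the relations. -/
def code : Option (Idx N) → ℕ × ℤ × ℤ := fun o => o.elim (4, 0, 0)
  (Sum.elim (fun p => (0, (p.1.2 : ℤ), (p.1.1 : ℤ)))
    (Sum.elim (fun p => (1, (p.1.1 : ℤ), (p.1.2 : ℤ)))
      (Sum.elim (fun i => (2, (idx i.1 : ℤ), 0)) fun _ => (3, 0, 0))))

theorem idx_inj {i j : Fin (N + 1)} (hi : i ≠ 0) (hj : j ≠ 0) (h : (idx i : ℤ) = idx j) : i = j := by
  unfold idx at h
  split_ifs at h with h1 h2 h2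
  · exact h1.trans h2.symm
  · exact absurd (Fin.ext (by simpa using h.symm)) hj
  · exact absurd (Fin.ext (by simpa using h)) hi
  · exact Fin.ext (by omega)

theorem idx_ne_last (hN : 1 ≤ N) (i : Fin (N + 1)) : idx i ≠ Fin.last N := by
  unfold idx
  split_ifs with h
  · rw [Ne, Fin.ext_iff, Fin.val_zero, Fin.val_last]
    omega
  · exact h

theorem code_injective : Function.Injective (code (N := N)) := by
  rintro (_ | p | p | i | _) (_ | p' | p' | i' | _) h <;> simp [code] at h
  · rfl
  · rw [show p = p' from Subtype.ext (Prod.ext (Fin.ext (by omega)) (Fin.ext (by omega)))]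
  · rw [show p = p' from Subtype.ext (Prod.ext (Fin.ext (by omega)) (Fin.ext (by omega)))]
  · rw [show i = i' from Subtype.ext (idx_inj i.2 i'.2 (by omega))]
  · rfl

theorem pos_ne_last (p : {p : Fin (N + 1) × Fin (N + 1) // p.2 < p.1}) :
    PairVar.pos p ≠ Fin.last N := by
  intro h
  have h1 := PairVar.cast_pos p
  rw [h, Fin.val_last] at h1
  have := p.1.1.isLt
  omega

open scoped Classical in
theorem owner_eq (hN : 1 ≤ N) (π : Equiv.Perm (Fin (N + 1))) (e : Finset (Fin (N + 1) × Fin (N + 1)))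
    (he : ∀ p ∈ e, (p.1 : ℤ) + (π p.2 : ℕ) = N) (o : Option (Idx N)) (v : QuadVar ρ (N + 1))
    (hv : v ∈ o.elim (e.image fun p => (vb p.1 p.2 : QuadVar ρ (N + 1))) (lead ρ π)) :
    owner ρ π v = code o := by
  rcases o with _ | p | p | i | _
  · obtain ⟨p, hp, rfl⟩ := Finset.mem_image.1 hv
    simp [owner, code, he p hp]
  · have hk := PairVar.cast_pos p
    simp only [Option.elim_some, lead, Sum.elim_inl, Finset.mem_insert, Finset.mem_singleton] at hv
    have := p.1.1.isLt
    rcases hv with rfl | rfl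
    · simp only [owner, elim_vb, Equiv.apply_symm_apply, hk, code, Option.elim_some, Sum.elim_inl]
      rw [if_neg (by omega)]
      simp
      ring
    · simp only [owner, elim_va, Equiv.apply_symm_apply, hk, code, Option.elim_some, Sum.elim_inl]
      simp
      ring
  · have hk := PairVar.cast_pos p
    simp only [Option.elim_some, lead, Sum.elim_inl, Sum.elim_inr, Finset.mem_insert, Finset.mem_singleton] at hv
    rcases hv with rfl | rfl
    · simp [owner, code, hk, pos_ne_last]
      ring
    · simp [owner, code, hk, pos_ne_last]
      ring
  · simp only [Option.elim_some, lead, Sum.elim_inl, Sum.elim_inr, Finset.mem_insert, Finset.mem_singleton] at hv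
    rcases hv with rfl | rfl
    · simp [owner, code, idx_ne_last hN]
    · simp [owner, code]
  · simp only [Option.elim_some, lead, Sum.elim_inr, Finset.mem_singleton] at hv
    rw [hv]
    simp [owner, code]

set_option maxHeartbeats 1000000 in
theorem hasLeads (hN : 1 ≤ N) (π : Equiv.Perm (Fin (N + 1)))
    (e : Finset (Fin (N + 1) × Fin (N + 1)))
    (he : ∀ p ∈ e, (p.1 : ℤ) + (π p.2 : ℕ) = N) (h : MvPolynomial (QuadVar ρ (N + 1)) k)
    {c : k} (hc : c ≠ 0) (hh : ∀ Λ : ℤ, h - C c * ∏ p ∈ e, X (vb p.1 p.2) ∈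
      (SymbolMap.polynomial k fun v => wt ρ π v - Λ).fil (∑ _p ∈ e, (-Λ) + 1)) :
    HasLeads fun o : Option (Idx N) => o.elim h (rel k ρ N) := by
  classical
  refine ⟨fun o => o.elim (e.image fun p => (vb p.1 p.2 : QuadVar ρ (N + 1))) (lead ρ π),
    fun o => o.elim c (leadCoeff k), wt ρ π, ?_,
    pairwise_disjoint_of_owner (owner ρ π) code code_injective fun o v hv =>
      owner_eq ρ hN π e he o v (by convert hv), ?_⟩
  · rintro (_ | p | p | i | _)
    · exact hc
    · simp [leadCoeff]
    · simp [leadCoeff]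
    · simp only [leadCoeff, Option.elim_some, Sum.elim_inr, Sum.elim_inl]
      split_ifs <;> simp
    · simp [leadCoeff]
  · rintro Λ (_ | p | p | i | _)
    · have hinj : Set.InjOn (fun p : Fin (N + 1) × Fin (N + 1) =>
          (vb p.1 p.2 : QuadVar ρ (N + 1))) e := by
        intro p _ p' _ h
        simpa [Prod.ext_iff] using h
      simp only [Option.elim_none]
      rw [Finset.prod_image hinj, Finset.sum_image hinj]
      have : ∑ p ∈ e, (wt ρ π (vb p.1 p.2) - Λ) = ∑ p ∈ e, (-Λ) := Finset.sum_congr rfl fun p hp => by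
        simp [wt, he p hp]
      rw [this]
      exact hh Λ
    · have hk := PairVar.cast_pos p
      simp only [Option.elim_some, leadCoeff, rel, lead, Sum.elim_inl, C_neg, C_1, neg_mul, one_mul]
      rw [Finset.prod_pair (by simp), Finset.sum_pair (by simp), Matrix.mul_apply, sub_neg_eq_add, neg_add_eq_sub, ← neg_mem_iff, neg_sub]
      refine SymbolMap.sum_sub_mem _ (Finset.mem_univ (π.symm (PairVar.pos p)))
        (x := fun j => matB k ρ N p.1.2 j * matA k ρ N j p.1.1) fun j _ hj => ?_
      refine SymbolMap.X_mul_X_mem_fil_polynomial _ ?_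
      simp only [wt, elim_va, elim_vb, Equiv.apply_symm_apply, hk]
      have hne : ((π j : ℕ) : ℤ) - PairVar.pos p ≠ 0 := fun h => hj (by
        rw [Equiv.eq_symm_apply]; exact Fin.ext (by omega))
      have : 0 < (((π j : ℕ) : ℤ) - PairVar.pos p) ^ 2 := by positivity
      rw [hk] at this
      nlinarith
    · have hk := PairVar.cast_pos p
      simp only [Option.elim_some, leadCoeff, rel, lead, Sum.elim_inl, Sum.elim_inr, C_1, one_mul]
      rw [Finset.prod_pair (by simp), Finset.sum_pair (by simp), PairVar.rel, Matrix.mul_apply]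
      refine SymbolMap.sum_sub_mem _ (Finset.mem_univ (PairVar.pos p))
        (x := fun j => matC k ρ N p.1.1 j * matD k ρ N j p.1.2) fun j _ hj => ?_
      refine SymbolMap.X_mul_X_mem_fil_polynomial _ ?_
      simp only [wt, elim_vc, elim_vd]
      have hl : lam (PairVar.pos p) = (p.1.1 : ℤ) - p.1.2 := by
        rw [lam, if_neg (pos_ne_last p)]; omega
      have hne : lam j - ((p.1.1 : ℤ) - p.1.2) ≠ 0 := by
        intro h
        have h1 : (p.1.2 : ℕ) < p.1.1 := p.2
        unfold lam at h
        split_ifs at h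
        · omega
        · exact hj (Fin.ext (by omega))
      have : 0 < (lam j - ((p.1.1 : ℤ) - p.1.2)) ^ 2 := by positivity
      rw [hl]
      nlinarith
    · have hi0 : 0 < (i.1 : ℕ) := Fin.pos_iff_ne_zero.2 i.2
      have hlam : ∀ j : Fin (N + 1), 0 ≤ lam j := fun j => by
        unfold lam; split_ifs <;> omega
      have hlam' : ∀ j : Fin (N + 1), j ≠ Fin.last N → 1 ≤ lam j := fun j hj => by
        unfold lam; rw [if_neg hj]; omega
      have hlast : lam (Fin.last N) = 0 := if_pos rfl
      simp only [Option.elim_some, leadCoeff, rel, lead, Sum.elim_inl, Sum.elim_inr]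
      rw [Finset.prod_pair (by simp), Finset.sum_pair (by simp), diag, Matrix.mul_apply,
        Matrix.mul_apply]
      have hab : X (va i.1 0) * X (vb 0 i.1) ∈
          (SymbolMap.polynomial k fun v => wt ρ π v - Λ).fil (5 - 2 * Λ) := by
        refine SymbolMap.X_mul_X_mem_fil_polynomial _ ?_
        simp only [wt, elim_va, elim_vb, Fin.val_zero]
        have h1 : (1 : ℤ) ≤ N := by exact_mod_cast hN
        have h2 : (0 : ℤ) ≤ (π i.1 : ℕ) := Int.natCast_nonneg _
        push_cast
        nlinarith
      have hcd : ∀ j, j ≠ Fin.last N → matC k ρ N i.1 j * matD k ρ N j i.1 ∈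
          (SymbolMap.polynomial k fun v => wt ρ π v - Λ).fil (5 - 2 * Λ) := by
        intro j hj
        refine SymbolMap.X_mul_X_mem_fil_polynomial _ ?_
        simp only [wt, elim_vc, elim_vd, if_neg i.2]
        nlinarith [hlam' j hj]
      have hcd' : matC k ρ N i.1 (Fin.last N) * matD k ρ N (Fin.last N) i.1 ∈
          (SymbolMap.polynomial k fun v => wt ρ π v - Λ).fil (1 - 2 * Λ) := by
        refine SymbolMap.X_mul_X_mem_fil_polynomial _ ?_
        simp only [wt, elim_vc, elim_vd, if_neg i.2, hlast]
        nlinarith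
      have hdc : ∀ j, matD k ρ N i.1 j * matC k ρ N j i.1 ∈
          (SymbolMap.polynomial k fun v => wt ρ π v - Λ).fil
            (4 * lam i.1 ^ 2 + (if j = 0 then 0 else 1) - 2 * Λ) := by
        intro j
        refine SymbolMap.X_mul_X_mem_fil_polynomial _ ?_
        simp only [wt, elim_vc, elim_vd]
        nlinarith
      by_cases hi : i.1 = Fin.last N
      · have hidx : idx i.1 = 0 := if_pos hi
        have hw : wt ρ π (vc (idx i.1) (Fin.last N)) - Λ +
            (wt ρ π (vd (Fin.last N) (idx i.1)) - Λ) + 1 = 1 - 2 * Λ := by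
          simp only [hidx, wt, elim_vc, elim_vd, hlast, if_true, Fin.val_zero]
          push_cast
          ring
        rw [hw, hidx, if_pos hi]
        have hd := SymbolMap.sum_sub_mem ((SymbolMap.polynomial k fun v => wt ρ π v - Λ).fil
          (1 - 2 * Λ)) (Finset.mem_univ (0 : Fin (N + 1)))
          (x := fun j => matD k ρ N i.1 j * matC k ρ N j i.1) fun j _ hj =>
            SymbolMap.fil_mono _ (by rw [if_neg hj]; nlinarith [hlam i.1]) (hdc j)
        have hc' : ∑ j, matC k ρ N i.1 j * matD k ρ N j i.1 ∈
            (SymbolMap.polynomial k fun v => wt ρ π v - Λ).fil (1 - 2 * Λ) := by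
          refine sum_mem fun j _ => ?_
          by_cases hj : j = Fin.last N
          · rw [hj]; exact hcd'
          · exact SymbolMap.fil_mono _ (by omega) (hcd j hj)
        have := sub_mem (add_mem (SymbolMap.fil_mono _ (by omega : 1 - 2 * Λ ≤ _) hab) hc') hd
        convert this using 1
        simp only [PairVar.matC, PairVar.matD, Matrix.of_apply, hi, map_neg, map_one]
        ring
      · have hidx : idx i.1 = i.1 := if_neg hi
        have hw : wt ρ π (vc (idx i.1) (Fin.last N)) - Λ +
            (wt ρ π (vd (Fin.last N) (idx i.1)) - Λ) + 1 = 2 - 2 * Λ := by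
          simp only [hidx, wt, elim_vc, elim_vd, hlast, if_neg i.2]
          ring
        rw [hw, hidx, if_neg hi]
        have hd := SymbolMap.sum_sub_mem ((SymbolMap.polynomial k fun v => wt ρ π v - Λ).fil
          (2 - 2 * Λ)) (Finset.mem_univ (Fin.last N))
          (x := fun j => matC k ρ N i.1 j * matD k ρ N j i.1) fun j _ hj =>
            SymbolMap.fil_mono _ (by omega) (hcd j hj)
        have hc' : ∑ j, matD k ρ N i.1 j * matC k ρ N j i.1 ∈
            (SymbolMap.polynomial k fun v => wt ρ π v - Λ).fil (2 - 2 * Λ) := by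
          refine sum_mem fun j _ => SymbolMap.fil_mono _ ?_ (hdc j)
          have := hlam' i.1 hi
          split_ifs <;> nlinarith
        have := sub_mem (add_mem (SymbolMap.fil_mono _ (by omega : 2 - 2 * Λ ≤ _) hab) hd) hc'
        convert this using 1
        simp only [PairVar.matC, PairVar.matD, Matrix.of_apply, map_one]
        ring
    · simp only [Option.elim_some, leadCoeff, rel, lead, Sum.elim_inr, C_1, one_mul,
        Finset.prod_singleton, Finset.sum_singleton, add_sub_cancel_right]
      refine SymbolMap.fil_mono _ ?_ (SymbolMap.X_mem_fil_polynomial _ _)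
      simp only [wt, elim_va, elim_vc, lam, Fin.val_last, if_true]
      rw [if_neg (by rw [Fin.ext_iff, Fin.val_zero, Fin.val_last]; omega)]
      nlinarith [(π (Fin.last N)).isLt]

theorem hasLeads_X (hN : 1 ≤ N) (j : Fin (N + 1)) :
    HasLeads fun o : Option (Idx N) => o.elim (X (vb 0 j)) (rel k ρ N) := by
  refine hasLeads k ρ hN (Equiv.swap j (Fin.last N)) {(0, j)} ?_ _ (one_ne_zero (α := k)) ?_
  · intro p hp
    rw [Finset.mem_singleton.1 hp]
    simp
  · intro Λ
    simp

theorem hasLeads_det (hN : 1 ≤ N) :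
    HasLeads fun o : Option (Idx N) => o.elim (matB k ρ N).det (rel k ρ N) := by
  have hinj : Set.InjOn (fun j : Fin (N + 1) => (j.rev, j)) (Finset.univ : Finset (Fin (N + 1))) :=
    fun i _ j _ h => (Prod.ext_iff.1 h).2
  refine hasLeads k ρ hN 1 (Finset.univ.image fun j : Fin (N + 1) => (j.rev, j)) ?_ _
    (c := (((Fin.revPerm (n := N + 1)).sign : ℤ) : k)) ?_ ?_
  · intro p hp
    obtain ⟨j, -, rfl⟩ := Finset.mem_image.1 hp
    simp only [Fin.val_rev, Equiv.Perm.coe_one, id_eq]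
    omega
  · rcases Int.units_eq_one_or (Fin.revPerm (n := N + 1)).sign with h | h <;> simp [h]
  · intro Λ
    rw [Finset.prod_image hinj, Finset.sum_image hinj]
    have := SymbolMap.det_sub_antidiagonal_mem_fil (fun v => wt ρ 1 v - Λ) (matB k ρ N) Λ
      fun i j => SymbolMap.fil_mono _ (le_of_eq (by simp [wt]))
        (SymbolMap.X_mem_fil_polynomial _ (vb i j))
    rw [zsmul_eq_mul] at this
    simpa [matB] using this

/-- The minor obtained by deleting the last row and the last column of the second matrix. -/
noncomputable def minorB (N : ℕ) : MvPolynomial (QuadVar ρ (N + 1)) k :=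
  ((matB k ρ N).submatrix Fin.castSucc Fin.castSucc).det

theorem hasLeads_minorB (hN : 1 ≤ N) :
    HasLeads fun o : Option (Idx N) => o.elim (minorB k ρ N) (rel k ρ N) := by
  have hinj : Set.InjOn (fun j : Fin N => (j.rev.castSucc, j.castSucc))
      (Finset.univ : Finset (Fin N)) :=
    fun i _ j _ h => Fin.castSucc_injective _ (Prod.ext_iff.1 h).2
  refine hasLeads k ρ hN (finRotate (N + 1))
    (Finset.univ.image fun j : Fin N => (j.rev.castSucc, j.castSucc)) ?_ _
    (c := (((Fin.revPerm (n := N)).sign : ℤ) : k)) ?_ ?_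
  · intro p hp
    obtain ⟨j, -, rfl⟩ := Finset.mem_image.1 hp
    simp only [finRotate_apply, Fin.val_castSucc, Fin.val_rev, Fin.coeSucc_eq_succ, Fin.val_succ]
    omega
  · rcases Int.units_eq_one_or (Fin.revPerm (n := N)).sign with h | h <;> simp [h]
  · intro Λ
    rw [Finset.prod_image hinj, Finset.sum_image hinj]
    have := SymbolMap.det_sub_antidiagonal_mem_fil (fun v => wt ρ (finRotate (N + 1)) v - Λ)
      ((matB k ρ N).submatrix Fin.castSucc Fin.castSucc) Λ
      fun i j => SymbolMap.fil_mono _ (by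
          simp only [wt, elim_vb, finRotate_apply, Fin.val_castSucc, Fin.coeSucc_eq_succ,
            Fin.val_succ]
          push_cast
          simp [add_assoc])
        (SymbolMap.X_mem_fil_polynomial _ (vb i.castSucc j.castSucc))
    rw [zsmul_eq_mul] at this
    simpa [matB, minorB] using this

end QuadVar

end

section

open MvPolynomial

namespace PairVar

variable (k τ : Type*) [Field k] (n : ℕ)

/-- The quotient map to the relation ring. -/
noncomputable abbrev mk : MvPolynomial (PairVar τ n) k →+* quot k τ n := Ideal.Quotient.mk _

/-- Specialization of the free parameters, with the two matrices sent to zero. -/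
noncomputable def special (x : τ → k) : quot k τ n →+* k :=
  Ideal.Quotient.lift _ (aeval (Sum.elim x fun _ => 0) : MvPolynomial (PairVar τ n) k →ₐ[k] k).toRingHom
    fun y hy => by
      have : Ideal.span (Set.range (rel k τ n)) ≤ RingHom.ker
          (aeval (Sum.elim x fun _ => 0) : MvPolynomial (PairVar τ n) k →ₐ[k] k).toRingHom := by
        rw [Ideal.span_le]
        rintro _ ⟨p, rfl⟩
        change aeval _ (rel k τ n p) = 0
        simp [rel, Matrix.mul_apply, matC]
      exact this hy

@[simp] theorem special_X (x : τ → k) (t : τ) : special k τ n x (mk k τ n (X (Sum.inl t))) = x t := by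
  simp [special]

end PairVar

namespace QuadVar

variable (k ρ : Type*) [Field k] (N : ℕ)

/-- The free entries of the product `BA`. -/
abbrev Free := {p : Fin (N + 1) × Fin (N + 1) // p.2 ≠ 0 ∧ p.2 ≤ p.1 ∧ p ≠ (Fin.last N, Fin.last N)}

/-- The free parameters of the birational model. -/
abbrev Param := Option ρ ⊕ (Fin (N + 1) × Fin (N + 1)) ⊕ Free N

/-- The ring of initial forms. -/
abbrev quot := MvPolynomial (QuadVar ρ (N + 1)) k ⧸ Ideal.span (Set.range (rel k ρ N))

/-- The quotient map to the ring of initial forms. -/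
noncomputable abbrev mk : MvPolynomial (QuadVar ρ (N + 1)) k →+* quot k ρ N := Ideal.Quotient.mk _

/-- The birational model. -/
abbrev model := PairVar.quot k (Param ρ N) (N + 1)

/-- The map from the polynomial ring to the ring of initial forms, on generators. -/
noncomputable def paramAux : MvPolynomial (PairVar (Param ρ N) (N + 1)) k →ₐ[k] quot k ρ N :=
  aeval (Sum.elim (Sum.elim (fun o => mk k ρ N (o.elim (X (va 0 0)) fun t => X (vr t)))
    (Sum.elim (fun p => mk k ρ N (X (vb p.1 p.2)))
      fun p => mk k ρ N ((matB k ρ N * matA k ρ N) p.1.1 p.1.2)))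
    (Sum.elim (fun p => mk k ρ N (X (vc p.1 p.2))) fun p => mk k ρ N (X (vd p.1 p.2))))

theorem paramAux_rel (p) : paramAux k ρ N (PairVar.rel k (Param ρ N) (N + 1) p) = 0 := by
  have h : paramAux k ρ N (PairVar.rel k (Param ρ N) (N + 1) p) =
      mk k ρ N (rel k ρ N (Sum.inr (Sum.inl p))) := by
    simp [PairVar.rel, rel, Matrix.mul_apply, PairVar.matC, PairVar.matD, paramAux]
  rw [h]
  exact Ideal.Quotient.eq_zero_iff_mem.2 (Ideal.subset_span ⟨_, rfl⟩)

/-- The map from the birational model to the ring of initial forms. -/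
noncomputable def param : model k ρ N →+* quot k ρ N :=
  Ideal.Quotient.lift _ (paramAux k ρ N).toRingHom fun y hy => by
    have : Ideal.span (Set.range (PairVar.rel k (Param ρ N) (N + 1))) ≤
        RingHom.ker (paramAux k ρ N).toRingHom := by
      rw [Ideal.span_le]
      rintro _ ⟨p, rfl⟩
      exact paramAux_rel k ρ N p
    exact this hy

theorem param_mk (x) : param k ρ N (PairVar.mk k (Param ρ N) (N + 1) x) = paramAux k ρ N x := rfl

section

variable {k ρ N}

/-- A variable of the birational model. -/
noncomputable abbrev pX (v : PairVar (Param ρ N) (N + 1)) : model k ρ N :=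
  PairVar.mk k (Param ρ N) (N + 1) (X v)

end

/-- The second matrix in the birational model. -/
noncomputable def paramB : Matrix (Fin (N + 1)) (Fin (N + 1)) (model k ρ N) :=
  Matrix.of fun i j => pX (Sum.inl (Sum.inr (Sum.inl (i, j))))

theorem exists_special (B : Matrix (Fin (N + 1)) (Fin (N + 1)) k) :
    ∃ f : model k ρ N →+* k, (paramB k ρ N).map f = B := by
  refine ⟨PairVar.special k (Param ρ N) (N + 1) (Sum.elim 0 (Sum.elim (fun p => B p.1 p.2) 0)), ?_⟩
  ext i j
  simp [paramB]

theorem det_paramB_ne_zero : (paramB k ρ N).det ≠ 0 := by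
  obtain ⟨f, hf⟩ := exists_special k ρ N 1
  intro h
  have := congrArg f h
  rw [RingHom.map_det, RingHom.mapMatrix_apply, hf] at this
  simp at this

theorem adjugate_paramB_ne_zero : (paramB k ρ N).adjugate (Fin.last N) (Fin.last N) ≠ 0 := by
  obtain ⟨f, hf⟩ := exists_special k ρ N 1
  intro h
  have h1 : (paramB k ρ N).adjugate.map f (Fin.last N) (Fin.last N) = 0 := by
    rw [Matrix.map_apply, h, map_zero]
  rw [← RingHom.mapMatrix_apply, RingHom.map_adjugate, RingHom.mapMatrix_apply, hf] at h1
  simp at h1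

theorem paramB_ne_zero (i j) : paramB k ρ N i j ≠ 0 := by
  obtain ⟨f, hf⟩ := exists_special k ρ N (Matrix.of fun _ _ => 1)
  intro h
  have h1 : (paramB k ρ N).map f i j = 0 := by
    rw [Matrix.map_apply, h, map_zero]
  rw [hf] at h1
  simp at h1

end QuadVar

end

section

open MvPolynomial

theorem StronglyRegular.comp {G ι κ : Type*} [CommRing G] {g : ι → G} (hg : StronglyRegular g)
    {f : κ → ι} (hf : Function.Injective f) : StronglyRegular (g ∘ f) := by
  classical
  intro s r hr x hx
  have h : (g ∘ f) '' s = g '' (s.image f : Finset ι) := by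
    rw [Set.image_comp, Finset.coe_image]
  rw [h] at hx ⊢
  refine hg _ (f r) ?_ x hx
  rw [Finset.mem_image]
  rintro ⟨a, ha, h⟩
  exact hr (hf h ▸ ha)

namespace QuadVar

variable (k ρ : Type*) [Field k] (N : ℕ)

set_option maxHeartbeats 1000000 in
theorem param_injective [Finite ρ] (hN : 1 ≤ N) : Function.Injective (param k ρ N) := by
  classical
  obtain ⟨hdom, -⟩ := PairVar.isDomain_and_isIntegrallyClosed k (Param ρ N) (N + 1)
  set F := FractionRing (model k ρ N) with hF
  let al : model k ρ N →+* F := algebraMap _ F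
  have hal : Function.Injective al := IsFractionRing.injective _ F
  let B : Matrix (Fin (N + 1)) (Fin (N + 1)) F := (paramB k ρ N).map al
  let c : Fin (N + 1) → Fin (N + 1) → F := fun i j => al (pX (Sum.inr (Sum.inl (i, j))))
  let d : Fin (N + 1) → Fin (N + 1) → F := fun i j => al (pX (Sum.inr (Sum.inr (i, j))))
  let Y : Matrix (Fin (N + 1)) (Fin (N + 1)) F := Matrix.of fun i j =>
    if h : j ≠ 0 ∧ j ≤ i ∧ (i, j) ≠ (Fin.last N, Fin.last N) then
      al (pX (Sum.inl (Sum.inr (Sum.inr ⟨(i, j), h⟩))))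
    else if j ≤ i then -c (Fin.last N) (Fin.last N) / B⁻¹ (Fin.last N) (Fin.last N) else 0
  let e : Fin (N + 1) → F := fun i => ∑ l, c i l * d l i - ∑ l, d i l * c l i
  let A : Matrix (Fin (N + 1)) (Fin (N + 1)) F := Matrix.of fun i j =>
    if j = 0 then (if i = 0 then al (pX (Sum.inl (Sum.inl none))) else -e i / B 0 i)
    else (B⁻¹ * Y) i j
  have hdetB : B.det = al (paramB k ρ N).det := (RingHom.map_det al _).symm
  have hdet0 : B.det ≠ 0 := by
    rw [hdetB]
    exact (map_ne_zero_iff al hal).2 (det_paramB_ne_zero k ρ N)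
  have hdet : IsUnit B.det := isUnit_iff_ne_zero.2 hdet0
  have hB0 : ∀ i j, B i j ≠ 0 := fun i j =>
    (map_ne_zero_iff al hal).2 (paramB_ne_zero k ρ N i j)
  have hinv0 : B⁻¹ (Fin.last N) (Fin.last N) ≠ 0 := by
    have h : B.adjugate (Fin.last N) (Fin.last N) ≠ 0 := by
      have h1 : B.adjugate = (paramB k ρ N).adjugate.map al := by
        rw [← RingHom.mapMatrix_apply, RingHom.map_adjugate, RingHom.mapMatrix_apply]
      rw [h1, Matrix.map_apply]
      exact (map_ne_zero_iff al hal).2 (adjugate_paramB_ne_zero k ρ N)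
    rw [Matrix.inv_def, Matrix.smul_apply, smul_eq_mul, Ring.inverse_eq_inv']
    exact mul_ne_zero (inv_ne_zero hdet0) h
  have hBA : ∀ i j, j ≠ 0 → (B * A) i j = Y i j := by
    intro i j hj
    have h1 : (B * (B⁻¹ * Y)) i j = Y i j := by
      rw [Matrix.mul_nonsing_inv_cancel_left _ _ hdet]
    rw [← h1, Matrix.mul_apply, Matrix.mul_apply]
    exact Finset.sum_congr rfl fun l _ => by rw [show A l j = (B⁻¹ * Y) l j from if_neg hj]
  let φ : MvPolynomial (QuadVar ρ (N + 1)) k →ₐ[k] F :=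
    aeval (QuadVar.elim (fun i j => A i j) (fun i j => B i j) c d
      fun t => al (pX (Sum.inl (Sum.inl (some t)))))
  have hφ : ∀ v, φ (X v) = QuadVar.elim (fun i j => A i j) (fun i j => B i j) c d
      (fun t => al (pX (Sum.inl (Sum.inl (some t))))) v := fun v => aeval_X _ _
  have hφBA : ∀ i j, φ ((matB k ρ N * matA k ρ N) i j) = (B * A) i j := by
    intro i j
    simp only [Matrix.mul_apply, map_sum, map_mul, matA, matB, Matrix.of_apply, hφ, elim_va, elim_vb]
  have hφdiag : ∀ i, φ (diag k ρ N i) = e i := by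
    intro i
    simp only [diag, Matrix.mul_apply, map_sub, map_sum, map_mul, PairVar.matC, PairVar.matD,
      Matrix.of_apply]
    simp only [hφ]
    rfl
  have hφCD : ∀ p, φ (PairVar.rel k (PairVar ρ (N + 1)) (N + 1) p) = 0 := by
    intro p
    have h1 : al (PairVar.mk k (Param ρ N) (N + 1) (PairVar.rel k (Param ρ N) (N + 1) p)) = 0 := by
      rw [Ideal.Quotient.eq_zero_iff_mem.2 (Ideal.subset_span (Set.mem_range_self p)), map_zero]
    rw [← h1]
    simp only [PairVar.rel, Matrix.mul_apply, map_sum, map_mul, PairVar.matC, PairVar.matD,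
      Matrix.of_apply]
    simp only [hφ]
    rfl
  let φ' : quot k ρ N →+* F := Ideal.Quotient.lift _ φ.toRingHom <| by
    intro x hx
    have : Ideal.span (Set.range (rel k ρ N)) ≤ RingHom.ker φ.toRingHom := by
      rw [Ideal.span_le]
      rintro _ ⟨p | p | i | _, rfl⟩
      · change φ (-_) = 0
        have hlt : (p.1.2 : ℕ) < p.1.1 := p.2
        rw [map_neg, hφBA, hBA _ _ (fun h => by simp [h] at hlt), neg_eq_zero]
        simp only [Y, Matrix.of_apply]
        rw [dif_neg (fun h => not_lt.2 h.2.1 p.2), if_neg (not_le.2 p.2)]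
      · exact hφCD p
      · change φ (_ * _ + _) = 0
        rw [map_add, map_mul, hφdiag, hφ, hφ, elim_va, elim_vb]
        simp only [A, Matrix.of_apply, if_true, if_neg i.2]
        rw [div_mul_cancel₀ _ (hB0 _ _), neg_add_cancel]
      · change φ (_ + _) = 0
        rw [map_add, hφ, hφ, elim_va, elim_vc]
        have hl : Fin.last N ≠ 0 := by
          rw [Ne, Fin.ext_iff, Fin.val_zero, Fin.val_last]; omega
        simp only [A, Matrix.of_apply, if_neg hl]
        rw [Matrix.mul_apply, Finset.sum_eq_single (Fin.last N)]
        · simp only [Y, Matrix.of_apply]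
          rw [dif_neg (by simp), if_pos le_rfl, mul_div_cancel₀ _ hinv0, neg_add_cancel]
        · intro j _ hj
          have : ¬ Fin.last N ≤ j := fun h => hj (le_antisymm (Fin.le_last j) h)
          simp only [Y, Matrix.of_apply]
          rw [dif_neg (fun h => this h.2.1), if_neg this, mul_zero]
        · simp
    exact this hx
  have hcomp : φ'.comp (param k ρ N) = al := by
    refine Ideal.Quotient.ringHom_ext (MvPolynomial.ringHom_ext ?_ ?_)
    · intro c
      change φ' (paramAux k ρ N (algebraMap k _ c)) = al (PairVar.mk k (Param ρ N) (N + 1) (algebraMap k _ c))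
      rw [AlgHom.commutes]
      change φ (algebraMap k _ c) = _
      rw [AlgHom.commutes, IsScalarTower.algebraMap_apply k (model k ρ N) F]
      rfl
    · intro v
      change φ' (paramAux k ρ N (X v)) = _
      rw [paramAux, aeval_X]
      rcases v with ((_ | t) | p | p) | p | p
      · change φ (X (va 0 0)) = _
        rw [hφ]
        simp only [elim_va, A, Matrix.of_apply, if_true]
        rfl
      · change φ (X (vr t)) = _
        rw [hφ]
        rfl
      · change φ (X (vb p.1 p.2)) = _
        rw [hφ]
        rfl
      · change φ ((matB k ρ N * matA k ρ N) p.1.1 p.1.2) = _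
        rw [hφBA, hBA _ _ p.2.1]
        simp only [Y, Matrix.of_apply]
        rw [dif_pos p.2]
        rfl
      · change φ (X (vc p.1 p.2)) = _
        rw [hφ]
        rfl
      · change φ (X (vd p.1 p.2)) = _
        rw [hφ]
        rfl
  have hinj : Function.Injective (φ'.comp (param k ρ N)) := by
    rw [hcomp]; exact hal
  rw [RingHom.coe_comp] at hinj
  exact hinj.of_comp

theorem isDomain_and_isIntegrallyClosed [Finite ρ] (hN : 1 ≤ N) :
    IsDomain (quot k ρ N) ∧ IsIntegrallyClosed (quot k ρ N) := by
  classical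
  obtain ⟨hdom, hint⟩ := PairVar.isDomain_and_isIntegrallyClosed k (Param ρ N) (N + 1)
  have hvar : ∀ v, paramAux k ρ N (X v) ∈ (param k ρ N).range := fun v => ⟨_, param_mk k ρ N _⟩
  have hB : ∀ i j, mk k ρ N (matB k ρ N i j) ∈ (param k ρ N).range := fun i j => by
    simpa [paramAux, matB] using hvar (Sum.inl (Sum.inr (Sum.inl (i, j))))
  have hc : ∀ i j, mk k ρ N (X (vc i j)) ∈ (param k ρ N).range := fun i j => by
    simpa [paramAux] using hvar (Sum.inr (Sum.inl (i, j)))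
  have hd : ∀ i j, mk k ρ N (X (vd i j)) ∈ (param k ρ N).range := fun i j => by
    simpa [paramAux] using hvar (Sum.inr (Sum.inr (i, j)))
  have hrel : ∀ l, mk k ρ N (rel k ρ N l) = 0 := fun l =>
    Ideal.Quotient.eq_zero_iff_mem.2 (Ideal.subset_span (Set.mem_range_self l))
  have hBA : ∀ i j, j ≠ 0 → (i, j) ≠ (Fin.last N, Fin.last N) →
      mk k ρ N ((matB k ρ N * matA k ρ N) i j) ∈ (param k ρ N).range := by
    intro i j hj hne
    by_cases hij : j ≤ i
    · simpa [paramAux] using hvar (Sum.inl (Sum.inr (Sum.inr ⟨(i, j), hj, hij, hne⟩)))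
    · have h := hrel (Sum.inl ⟨(j, i), not_le.1 hij⟩)
      simp only [rel, Sum.elim_inl, map_neg, neg_eq_zero] at h
      rw [h]
      exact zero_mem _
  have hdet : mk k ρ N (matB k ρ N).det ∈ (param k ρ N).range := by
    rw [RingHom.map_det]
    exact Matrix.det_mem_subring _ hB
  have hminor : mk k ρ N (minorB k ρ N) ∈ (param k ρ N).range := by
    rw [minorB, RingHom.map_det]
    exact Matrix.det_mem_subring _ fun i j => hB i.castSucc j.castSucc
  have hadj : minorB k ρ N = (matB k ρ N).adjugate (Fin.last N) (Fin.last N) := by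
    rw [Matrix.adjugate_fin_succ_eq_det_submatrix, minorB]
    simp [Fin.succAbove_last, ← two_mul]
  have hAN : mk k ρ N (X (va (Fin.last N) (Fin.last N))) = -mk k ρ N (X (vc (Fin.last N) (Fin.last N))) := by
    have h := hrel (Sum.inr (Sum.inr (Sum.inr ())))
    simp only [rel, Sum.elim_inr, map_add] at h
    exact eq_neg_of_add_eq_zero_left h
  have hl : Fin.last N ≠ 0 := by
    rw [Ne, Fin.ext_iff, Fin.val_zero, Fin.val_last]; omega
  set H : Set (MvPolynomial (QuadVar ρ (N + 1)) k) := {(matB k ρ N).det, minorB k ρ N} ∪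
    Set.range fun j => X (vb 0 j) with hH
  have hHdet : mk k ρ N (matB k ρ N).det ∈ Submonoid.closure (mk k ρ N '' H) :=
    Submonoid.subset_closure ⟨_, Or.inl (Or.inl rfl), rfl⟩
  have hHmin : mk k ρ N (minorB k ρ N) ∈ Submonoid.closure (mk k ρ N '' H) :=
    Submonoid.subset_closure ⟨_, Or.inl (Or.inr rfl), rfl⟩
  refine isDomain_and_isIntegrallyClosed_of_leads (rel k ρ N) H ?_
    (param k ρ N) (param_injective k ρ N hN) ?_ ?_ ?_
  · rintro _ ((rfl | rfl) | ⟨j, rfl⟩)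
    · exact hasLeads_det k ρ hN
    · exact hasLeads_minorB k ρ hN
    · exact hasLeads_X k ρ hN j
  · intro c
    exact ⟨PairVar.mk k (Param ρ N) (N + 1) (C c), (paramAux k ρ N).commutes c⟩
  · rintro _ ((rfl | rfl) | ⟨j, rfl⟩)
    · exact hdet
    · exact hminor
    · exact hB 0 j
  · rintro ((t | p | p) | p | p)
    · exact ⟨1, one_mem _, by simpa [paramAux] using hvar (Sum.inl (Sum.inl (some t)))⟩
    · obtain ⟨i, j⟩ := p
      by_cases hj : j = 0
      · subst hj
        by_cases hi : i = 0
        · subst hi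
          exact ⟨1, one_mem _, by simpa [paramAux] using hvar (Sum.inl (Sum.inl none))⟩
        · refine ⟨mk k ρ N (X (vb 0 i)), Submonoid.subset_closure ⟨_, Or.inr ⟨i, rfl⟩, rfl⟩, ?_⟩
          have h := hrel (Sum.inr (Sum.inr (Sum.inl ⟨i, hi⟩)))
          simp only [rel, Sum.elim_inr, Sum.elim_inl, map_add, map_mul] at h
          rw [mul_comm, eq_neg_of_add_eq_zero_left h]
          refine neg_mem ?_
          simp only [diag, Matrix.mul_apply, map_sub, map_sum, map_mul]
          exact sub_mem (sum_mem fun l _ => mul_mem (hc i l) (hd l i))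
            (sum_mem fun l _ => mul_mem (hd i l) (hc l i))
      · by_cases hjN : j = Fin.last N
        · subst hjN
          refine ⟨_, mul_mem hHdet hHmin, ?_⟩
          have hkey : mk k ρ N (minorB k ρ N) *
              mk k ρ N ((matB k ρ N * matA k ρ N) (Fin.last N) (Fin.last N)) ∈ (param k ρ N).range := by
            have h1 := Matrix.det_mul_eq_sum_adjugate (matB k ρ N)
              (fun l => matA k ρ N l (Fin.last N)) (Fin.last N)
            have h2 := congrArg (mk k ρ N) h1
            rw [map_sum, ← Finset.add_sum_erase _ _ (Finset.mem_univ (Fin.last N)), ← hadj, map_mul,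
              map_mul] at h2
            have h3 : mk k ρ N (matA k ρ N (Fin.last N) (Fin.last N)) ∈ (param k ρ N).range := by
              change mk k ρ N (X _) ∈ _
              rw [hAN]
              exact neg_mem (hc _ _)
            rw [Matrix.mul_apply, eq_sub_of_add_eq h2.symm]
            refine sub_mem (mul_mem hdet h3) (sum_mem fun l hl' => ?_)
            rw [map_mul]
            refine mul_mem ?_ ?_
            · have := Matrix.adjugate_mem_subring _ (M := (matB k ρ N).map (mk k ρ N)) hB
                (Fin.last N) l
              rwa [← RingHom.mapMatrix_apply, ← RingHom.map_adjugate] at this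
            · have := hBA l (Fin.last N) hl (by simpa using Finset.ne_of_mem_erase hl')
              rwa [Matrix.mul_apply] at this
          have := Matrix.det_mul_mem_subring _ (M := (matB k ρ N).map (mk k ρ N)) hB
            (fun l => mk k ρ N (minorB k ρ N) * mk k ρ N (matA k ρ N l (Fin.last N)))
            (fun l => ?_) i
          · rw [← RingHom.mapMatrix_apply, ← RingHom.map_det, ← mul_assoc] at this
            exact this
          · have h1 : ∑ j, (matB k ρ N).map (mk k ρ N) l j *
                (mk k ρ N (minorB k ρ N) * mk k ρ N (matA k ρ N j (Fin.last N))) =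
                mk k ρ N (minorB k ρ N) * mk k ρ N ((matB k ρ N * matA k ρ N) l (Fin.last N)) := by
              rw [Matrix.mul_apply, map_sum, Finset.mul_sum]
              refine Finset.sum_congr rfl fun j _ => ?_
              rw [map_mul, Matrix.map_apply]
              ring
            rw [h1]
            by_cases hlN : l = Fin.last N
            · rw [hlN]; exact hkey
            · exact mul_mem hminor (hBA l _ hl (by simpa using hlN))
        · refine ⟨_, hHdet, ?_⟩
          have := Matrix.det_mul_mem_subring _ (M := (matB k ρ N).map (mk k ρ N)) hB
            (fun l => mk k ρ N (matA k ρ N l j)) (fun l => ?_) i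
          · rw [← RingHom.mapMatrix_apply, ← RingHom.map_det] at this
            exact this
          · have := hBA l j hj (by simp [hjN])
            rw [Matrix.mul_apply, map_sum] at this
            simpa only [map_mul, Matrix.map_apply] using this
    · exact ⟨1, one_mem _, by rw [one_mul]; exact hB p.1 p.2⟩
    · exact ⟨1, one_mem _, by rw [one_mul]; exact hc p.1 p.2⟩
    · exact ⟨1, one_mem _, by rw [one_mul]; exact hd p.1 p.2⟩

theorem stronglyRegular [Finite ρ] (hN : 1 ≤ N) : StronglyRegular (rel k ρ N) := by
  have h := (hasLeads_det k ρ hN).stronglyRegular.comp (Option.some_injective _)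
  exact h

theorem completelyIntClosed [Finite ρ] (hN : 1 ≤ N) : CompletelyIntClosed (quot k ρ N) := by
  obtain ⟨_, _⟩ := isDomain_and_isIntegrallyClosed k ρ N hN
  exact completelyIntClosed_of_isIntegrallyClosed _

end QuadVar

end

namespace Matrix

variable {R : Type*} [CommRing R] {n : ℕ}

theorem det_one_add_of_mul_eq_zero {M : Matrix (Fin n) (Fin n) R}
    (h : ∀ i j i' j', M i j * M i' j' = 0) : (1 + M).det = 1 + M.trace := by
  classical
  have hprod : ∀ s : Finset (Fin n), ∏ i ∈ s, (1 + M i i) = 1 + ∑ i ∈ s, M i i := by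
    intro s
    induction s using Finset.induction_on with
    | empty => simp
    | insert i s hi ih =>
      have hz : M i i * ∑ j ∈ s, M j j = 0 := by
        rw [Finset.mul_sum]
        exact Finset.sum_eq_zero fun j _ => h _ _ _ _
      rw [Finset.prod_insert hi, Finset.sum_insert hi, ih]
      linear_combination hz
  rw [det_apply, ← Finset.add_sum_erase _ _ (Finset.mem_univ 1), Finset.sum_eq_zero, add_zero]
  · simp only [Equiv.Perm.sign_one, one_smul, Equiv.Perm.coe_one, id_eq, add_apply, one_apply_eq]
    exact hprod _
  · intro σ hσ
    have hσ := Finset.ne_of_mem_erase hσ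
    obtain ⟨i, hi⟩ : ∃ i, σ i ≠ i := by
      by_contra! h
      exact hσ (Equiv.ext h)
    have hi' : σ (σ i) ≠ σ i := fun h => hi (σ.injective h)
    rw [← Finset.mul_prod_erase _ _ (Finset.mem_univ i), ← Finset.mul_prod_erase _ _
      (Finset.mem_erase.2 ⟨hi, Finset.mem_univ (σ i)⟩), ← mul_assoc, add_apply, add_apply,
      one_apply_ne hi, one_apply_ne hi', zero_add, zero_add, h, zero_mul, smul_zero]

theorem mul_eq_zero_of_entries {M P : Matrix (Fin n) (Fin n) R}
    (h : ∀ i j i' j', M i j * P i' j' = 0) : M * P = 0 := by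
  ext i j
  rw [mul_apply]
  exact Finset.sum_eq_zero fun _ _ => h _ _ _ _

theorem mul_mul_eq_zero_of_entries {M P Q : Matrix (Fin n) (Fin n) R}
    (h : ∀ i j i' j' i'' j'', M i j * P i' j' * Q i'' j'' = 0) : M * P * Q = 0 := by
  refine mul_eq_zero_of_entries fun i j i' j' => ?_
  rw [mul_apply, Finset.sum_mul]
  exact Finset.sum_eq_zero fun _ _ => h _ _ _ _ _ _

theorem isUnit_det_one_add {M : Matrix (Fin n) (Fin n) R} (h : M * M * M = 0) :
    IsUnit (1 + M).det := by
  refine isUnit_det_of_right_inverse (B := 1 - M + M * M) ?_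
  calc (1 + M) * (1 - M + M * M) = 1 + M * M * M := by noncomm_ring
    _ = 1 := by rw [h, add_zero]

end Matrix

section

variable {R S : Type*} [CommRing R] [CommRing S] {n : ℕ}

theorem matComm_one_add {P Q : Matrix (Fin n) (Fin n) R} (h1 : P * P * P = 0) (h2 : Q * Q * Q = 0)
    (h3 : P * Q * P = 0) (h4 : P * Q * Q = 0) (h5 : Q * P * P = 0) (h6 : Q * P * Q = 0) :
    matComm (1 + P) (1 + Q) = 1 + (P * Q - Q * P) := by
  have key : (1 + P) * (1 + Q) = (1 + (P * Q - Q * P)) * (1 + Q) * (1 + P) := by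
    have h7 : P * Q * Q * P = 0 := by rw [h4, zero_mul]
    have h8 : Q * P * Q * P = 0 := by rw [h6, zero_mul]
    calc (1 + P) * (1 + Q) = 1 + P + Q + P * Q := by noncomm_ring
      _ = 1 + P + Q + P * Q + P * Q * P - Q * P * P + P * Q * Q - Q * P * Q + P * Q * Q * P
          - Q * P * Q * P := by rw [h7, h8, h3, h4, h5, h6]; simp
      _ = _ := by noncomm_ring
  rw [matComm, key, Matrix.mul_nonsing_inv_cancel_right _ _ (Matrix.isUnit_det_one_add h1),
    Matrix.mul_nonsing_inv_cancel_right _ _ (Matrix.isUnit_det_one_add h2)]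

theorem matComm_map (φ : R →+* S) {A B : Matrix (Fin n) (Fin n) R} (hA : IsUnit A.det)
    (hB : IsUnit B.det) : (matComm A B).map φ = matComm (A.map φ) (B.map φ) := by
  have key : ∀ {A : Matrix (Fin n) (Fin n) R}, IsUnit A.det → A⁻¹.map φ = (A.map φ)⁻¹ := by
    intro A hA
    refine (Matrix.inv_eq_right_inv ?_).symm
    rw [← Matrix.map_mul, Matrix.mul_nonsing_inv _ hA, Matrix.map_one _ (map_zero φ) (map_one φ)]
  simp only [matComm, Matrix.map_mul, key hA, key hB]

theorem isUnit_det_Xt (N n : ℕ) (k : Fin N) : IsUnit (Xt (A := R) N n k).det := by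
  rw [MvPowerSeries.isUnit_iff_constantCoeff, RingHom.map_det]
  have : MvPowerSeries.constantCoeff.mapMatrix (Xt (A := R) N n k) = 1 := by
    ext i j
    by_cases h : i = j <;> simp [Xt, varMatrix, Matrix.one_apply, h]
  rw [this, Matrix.det_one]
  exact isUnit_one

theorem relMatrix_map {q m : ℕ} (φ : MvPowerSeries (Fin (2 * m + 2) × Fin n × Fin n) R →+* S) :
    (relMatrix q m n).map φ = ((Xt (2 * m + 2) n ⟨0, by omega⟩).map φ) ^ q *
      (List.ofFn (fun i : Fin (m + 1) =>
        matComm ((Xt (2 * m + 2) n ⟨2 * i, by have := i.isLt; omega⟩).map φ)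
          ((Xt (2 * m + 2) n ⟨2 * i + 1, by have := i.isLt; omega⟩).map φ))).prod := by
  rw [← RingHom.mapMatrix_apply, relMatrix, map_mul, map_pow, map_list_prod, List.map_ofFn]
  congr 3
  funext i
  exact matComm_map φ (isUnit_det_Xt _ _ _) (isUnit_det_Xt _ _ _)

theorem Xt_map (φ : R →+* S) (N n : ℕ) (k : Fin N) :
    (Xt N n k).map (MvPowerSeries.map φ) = Xt N n k := by
  ext i j : 2
  simp [Xt, varMatrix, Matrix.one_apply, apply_ite]

theorem relMatrix_map_map (φ : R →+* S) (q m n : ℕ) :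
    (relMatrix q m n).map (MvPowerSeries.map φ) = relMatrix q m n := by
  simp only [relMatrix_map, Xt_map]
  rfl

theorem det_relMatrix (q m n : ℕ) :
    (relMatrix (A := R) q m n).det = (Xt (2 * m + 2) n ⟨0, by omega⟩).det ^ q := by
  have h : ∀ A B : Matrix (Fin n) (Fin n) (MvPowerSeries (Fin (2 * m + 2) × Fin n × Fin n) R),
      IsUnit A.det → IsUnit B.det → (matComm A B).det = 1 := by
    intro A B hA hB
    rw [matComm, Matrix.det_mul, Matrix.det_mul, Matrix.det_mul,
      show A.det * B.det * A⁻¹.det * B⁻¹.det = (A.det * A⁻¹.det) * (B.det * B⁻¹.det) by ring,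
      ← Matrix.det_mul, ← Matrix.det_mul, Matrix.mul_nonsing_inv _ hA, Matrix.mul_nonsing_inv _ hB,
      Matrix.det_one, one_mul]
  rw [relMatrix, Matrix.det_mul, Matrix.det_pow]
  have : ∀ l : List (Matrix (Fin n) (Fin n) (MvPowerSeries (Fin (2 * m + 2) × Fin n × Fin n) R)),
      (∀ M ∈ l, M.det = 1) → l.prod.det = 1 := by
    intro l
    induction l with
    | nil => simp
    | cons M l ih =>
      intro h
      rw [List.prod_cons, Matrix.det_mul, h M (by simp), ih fun M hM => h M (by simp [hM]), one_mul]
  rw [this, mul_one]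
  intro M hM
  obtain ⟨i, rfl⟩ := (List.mem_ofFn' _ _).1 hM
  exact h _ _ (isUnit_det_Xt _ _ _) (isUnit_det_Xt _ _ _)

end

namespace MvPowerSeries

variable {τ k : Type*} [CommRing k]

theorem mem_span_X_pow (r : ℕ) (s : Finset τ) {x : MvPowerSeries τ k}
    (hx : ∀ d : τ →₀ ℕ, (∀ v ∈ s, d v < r) → coeff d x = 0) :
    x ∈ Ideal.span (Set.range fun v : τ => (X v : MvPowerSeries τ k) ^ r) := by
  classical
  induction s using Finset.induction_on generalizing x with
  | empty =>
    have : x = 0 := by ext d; simpa using hx d (by simp)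
    rw [this]
    exact zero_mem _
  | insert v s hv ih =>
    let y : MvPowerSeries τ k := fun d => if r ≤ d v then coeff d x else 0
    have hy : ∀ d, coeff d y = if r ≤ d v then coeff d x else 0 := fun d => rfl
    rw [← sub_add_cancel x y]
    refine add_mem (ih fun d hd => ?_) ?_
    · rw [map_sub, hy]
      split_ifs with h
      · rw [sub_self]
      · rw [sub_zero, hx]
        intro u hu
        rcases Finset.mem_insert.1 hu with rfl | hu
        · omega
        · exact hd u hu
    · obtain ⟨z, hz⟩ := X_pow_dvd_iff.2 (fun d (hd : d v < r) => (by rw [hy, if_neg (by omega)] :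
        coeff d y = 0))
      rw [hz]
      exact Ideal.mul_mem_right _ _ (Ideal.subset_span ⟨v, rfl⟩)

end MvPowerSeries

namespace SymbolMap

section

variable {τ k : Type*} [CommRing k]

theorem weightedHomogeneous_mem_fil {w : τ → ℤ} {a : ℤ} {x : MvPolynomial τ k}
    (hx : x.IsWeightedHomogeneous w a) : x ∈ (polynomial k w).fil a := by
  refine mem_fil_polynomial.2 fun d hd => ?_
  by_contra h
  exact hd.ne (hx h)

theorem weight_nonneg {w : τ → ℤ} (hw : ∀ v, 0 < w v) (d : τ →₀ ℕ) : 0 ≤ Finsupp.weight w d := by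
  rw [Finsupp.weight_apply]
  exact Finset.sum_nonneg fun v _ => by
    change 0 ≤ d v • w v
    rw [nsmul_eq_mul]; exact mul_nonneg (Int.natCast_nonneg _) (hw v).le

variable [Finite τ] {w : τ → ℤ} (hw : ∀ v, 0 < w v)

theorem coe_mem_fil_powerSeries {a : ℤ} {x : MvPolynomial τ k} (hx : x ∈ (polynomial k w).fil a) :
    (x : MvPowerSeries τ k) ∈ (powerSeries k w hw).fil a := by
  refine mem_fil_powerSeries.2 fun d hd => ?_
  rw [MvPolynomial.coeff_coe]
  exact mem_fil_polynomial.1 hx d hd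

theorem symb_coe_of_isWeightedHomogeneous {a : ℤ} {g : MvPolynomial τ k}
    (hg : g.IsWeightedHomogeneous w a) : (powerSeries k w hw).symb a (g : MvPowerSeries τ k) = g := by
  classical
  ext d
  rw [coeff_powerSeries_symb, MvPolynomial.coeff_coe]
  split_ifs with h
  · rfl
  · by_contra h'
    exact h (hg (Ne.symm h'))

theorem hasSymb_powerSeries {ι : Type*} {f : ι → MvPowerSeries τ k} {g : ι → MvPolynomial τ k}
    {d : ι → ℤ} (hg : ∀ l, (g l).IsWeightedHomogeneous w (d l))
    (h : ∀ l, f l - g l ∈ (powerSeries k w hw).fil (d l + 1)) : (powerSeries k w hw).HasSymb f g d := by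
  intro l
  have h1 := fil_mono _ (by omega : d l ≤ d l + 1) (h l)
  have h2 := coe_mem_fil_powerSeries hw (weightedHomogeneous_mem_fil (hg l))
  refine ⟨by simpa using add_mem h1 h2, ?_⟩
  have h3 := h l (d l) (by omega)
  rw [map_sub, symb_coe_of_isWeightedHomogeneous hw (hg l), sub_eq_zero] at h3
  exact h3

theorem mem_fil_zero_powerSeries (x : MvPowerSeries τ k) : x ∈ (powerSeries k w hw).fil 0 :=
  mem_fil_powerSeries.2 fun d hd => absurd hd (weight_nonneg hw d).not_gt

/-- The filtration of a power series ring consists of ideals. -/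
noncomputable def filIdeal (a : ℤ) : Ideal (MvPowerSeries τ k) where
  __ := (powerSeries k w hw).fil a
  smul_mem' := fun c x hx => by
    have := mul_mem_fil _ (mem_fil_zero_powerSeries hw c) hx
    rwa [zero_add] at this

theorem mem_filIdeal {a : ℤ} {x : MvPowerSeries τ k} :
    x ∈ filIdeal hw a ↔ x ∈ (powerSeries k w hw).fil a := Iff.rfl

theorem symb_one_powerSeries : (powerSeries k w hw).symb 0 1 = 1 := by
  have := symb_coe_of_isWeightedHomogeneous hw (MvPolynomial.isWeightedHomogeneous_one k w)
  simpa using this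

end

theorem closed_powerSeries {τ k : Type*} [Field k] [Finite τ] {w : τ → ℤ} (hw : ∀ v, 0 < w v)
    (I : Ideal (MvPowerSeries τ k)) : (powerSeries k w hw).Closed I := by
  classical
  have := Fintype.ofFinite τ
  intro x hx
  by_cases hI : I = ⊤
  · rw [hI]; trivial
  have : Nontrivial (MvPowerSeries τ k ⧸ I) := Ideal.Quotient.nontrivial_iff.2 hI
  have : IsLocalRing (MvPowerSeries τ k ⧸ I) :=
    IsLocalRing.of_surjective' (Ideal.Quotient.mk I) Ideal.Quotient.mk_surjective
  set 𝔪 : Ideal (MvPowerSeries τ k ⧸ I) :=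
    (IsLocalRing.maximalIdeal (MvPowerSeries τ k)).map (Ideal.Quotient.mk I)
  have h𝔪 : 𝔪 ≠ ⊤ := fun h => by
    have := Ideal.comap_map_of_surjective (Ideal.Quotient.mk I) Ideal.Quotient.mk_surjective
      (IsLocalRing.maximalIdeal (MvPowerSeries τ k))
    rw [show Ideal.map _ _ = 𝔪 from rfl, h, Ideal.comap_top, ← RingHom.ker_eq_comap_bot,
      Ideal.mk_ker, sup_eq_left.2 (IsLocalRing.le_maximalIdeal hI)] at this
    exact (Ideal.IsPrime.ne_top inferInstance) this.symm
  have key := Ideal.iInf_pow_eq_bot_of_isLocalRing 𝔪 h𝔪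
  rw [← Ideal.Quotient.eq_zero_iff_mem, ← Ideal.mem_bot, ← key, Ideal.mem_iInf]
  intro r
  obtain ⟨y, hy, hxy⟩ := hx (r * ∑ v, w v + 1)
  rw [← Ideal.map_pow, ← sub_add_cancel x y, map_add, Ideal.Quotient.eq_zero_iff_mem.2 hy, add_zero]
  refine Ideal.mem_map_of_mem _ ?_
  have h1 := MvPowerSeries.mem_span_X_pow r Finset.univ (x := x - y) fun d hd => ?_
  · refine Ideal.span_le.2 ?_ h1
    rintro _ ⟨v, rfl⟩
    refine Ideal.pow_mem_pow ?_ r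
    rw [IsLocalRing.mem_maximalIdeal, mem_nonunits_iff, MvPowerSeries.isUnit_iff_constantCoeff]
    simp
  · refine mem_fil_powerSeries.1 hxy d ?_
    rw [Finsupp.weight_apply, Finsupp.sum_fintype _ _ (by simp), Finset.mul_sum, Int.lt_add_one_iff]
    refine Finset.sum_le_sum fun v hv => ?_
    rw [nsmul_eq_mul]
    exact mul_le_mul_of_nonneg_right (by exact_mod_cast (hd v hv).le) (hw v).le

end SymbolMap

section

open MvPolynomial

namespace QuadVar

variable (k ρ : Type*) [Field k] {N : ℕ}

/-- The positive weights for which the relations of the framed deformation ring have the expected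
initial forms. -/
def gwt : QuadVar ρ (N + 1) → ℤ :=
  elim (fun i j => 100 * (N + 1) + (if j = 0 then 0 else 1) + i - 4 * j + (2 * N - 1))
    (fun i j => 100 * (N + 1) + (if i = 0 then 0 else 1) + 4 * i - j - (2 * N - 1))
    (fun _ j => 100 * (N + 1) - j) (fun i _ => 100 * (N + 1) + i) fun _ => 200 * (N + 1)

theorem le_gwt (v : QuadVar ρ (N + 1)) : 96 * ((N : ℤ) + 1) ≤ gwt ρ v := by
  rcases v with (t | ⟨i, j⟩ | ⟨i, j⟩) | ⟨i, j⟩ | ⟨i, j⟩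
  · change _ ≤ gwt ρ (vr t)
    simp only [gwt, elim_vr]; omega
  · change _ ≤ gwt ρ (va i j)
    simp only [gwt, elim_va]; split_ifs <;> omega
  · change _ ≤ gwt ρ (vb i j)
    simp only [gwt, elim_vb]; split_ifs <;> omega
  · change _ ≤ gwt ρ (vc i j)
    simp only [gwt, elim_vc]; omega
  · change _ ≤ gwt ρ (vd i j)
    simp only [gwt, elim_vd]; omega

theorem gwt_pos (v : QuadVar ρ (N + 1)) : 0 < gwt ρ v :=
  lt_of_lt_of_le (by positivity) (le_gwt ρ v)

/-- The degrees of the initial forms. -/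
def deg : Idx N → ℤ :=
  Sum.elim (fun p => 200 * (N + 1) + (if p.1.2 = 0 then 0 else 1) + 1 + 4 * ((p.1.2 : ℤ) - p.1.1))
    (Sum.elim (fun _ => 200 * (N + 1)) (Sum.elim (fun _ => 200 * (N + 1)) fun _ => 100 * (N + 1) - N))

variable (N) in
/-- The quadratic approximation of the relation matrix. -/
noncomputable def quad : Matrix (Fin (N + 1)) (Fin (N + 1)) (MvPolynomial (QuadVar ρ (N + 1)) k) :=
  matA k ρ N * matB k ρ N - matB k ρ N * matA k ρ N +
    (matC k ρ N * matD k ρ N - matD k ρ N * matC k ρ N)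

/-- The selected relations, given the relation matrix and the determinant. -/
def select {R : Type*} (M : Matrix (Fin (N + 1)) (Fin (N + 1)) R) (δ : R) : Idx N → R :=
  Sum.elim (fun p => M p.1.2 p.1.1) (Sum.elim (fun p => M p.1.1 p.1.2)
    (Sum.elim (fun i => M i.1 i.1) fun _ => δ))

theorem ne_zero_of_lt (p : {p : Fin (N + 1) × Fin (N + 1) // p.2 < p.1}) : p.1.1 ≠ 0 := fun h => by
  have := p.2
  rw [h] at this
  exact absurd this (Fin.not_lt_zero _)

theorem isWeightedHomogeneous_rel (hN : 1 ≤ N) (l : Idx N) :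
    (rel k ρ N l).IsWeightedHomogeneous (gwt ρ) (deg l) := by
  have hmul : ∀ {u v : QuadVar ρ (N + 1)} {a : ℤ}, gwt ρ u + gwt ρ v = a →
      (X u * X v : MvPolynomial _ k).IsWeightedHomogeneous (gwt ρ) a := fun h =>
    h ▸ (isWeightedHomogeneous_X k _ _).mul (isWeightedHomogeneous_X k _ _)
  have hneg : ∀ {x : MvPolynomial (QuadVar ρ (N + 1)) k} {a : ℤ}, x.IsWeightedHomogeneous (gwt ρ) a →
      (-x).IsWeightedHomogeneous (gwt ρ) a := fun {x a} h =>
    (mem_weightedHomogeneousSubmodule k (gwt ρ) a _).1 (neg_mem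
      ((mem_weightedHomogeneousSubmodule k (gwt ρ) a x).2 h))
  have hCD : ∀ i j, ((matC k ρ N * matD k ρ N) i j).IsWeightedHomogeneous (gwt ρ)
      (200 * (N + 1)) := fun i j => by
    rw [Matrix.mul_apply]
    refine IsWeightedHomogeneous.sum _ _ _ fun r _ => hmul ?_
    simp only [gwt, elim_vc, elim_vd]; ring
  rcases l with p | p | i | _
  · simp only [rel, deg, Sum.elim_inl]
    rw [Matrix.mul_apply]
    refine hneg (IsWeightedHomogeneous.sum _ _ _ fun r _ => hmul ?_)
    simp only [gwt, elim_va, elim_vb, if_neg (ne_zero_of_lt p)]; ring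
  · exact hCD _ _
  · simp only [rel, deg, Sum.elim_inl, Sum.elim_inr, diag, sub_eq_add_neg]
    refine (hmul ?_).add ((hCD _ _).add (hneg ?_))
    · simp only [gwt, elim_va, elim_vb, Fin.val_zero, if_true]; push_cast; ring
    · rw [Matrix.mul_apply]
      refine IsWeightedHomogeneous.sum _ _ _ fun r _ => hmul ?_
      simp only [gwt, elim_vc, elim_vd]; ring
  · simp only [rel, deg, Sum.elim_inr]
    refine IsWeightedHomogeneous.add ?_ ?_
    · convert isWeightedHomogeneous_X k (gwt ρ) (va (Fin.last N) (Fin.last N)) using 1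
      have : ((Fin.last N : Fin (N + 1)) = 0) ↔ N = 0 := by rw [Fin.ext_iff]; simp
      simp only [gwt, elim_va, this, Fin.val_last, if_neg (by omega : ¬ N = 0)]
      ring
    · convert isWeightedHomogeneous_X k (gwt ρ) (vc (Fin.last N) (Fin.last N)) using 1
      simp only [gwt, elim_vc, Fin.val_last]

theorem select_sub_rel_mem (hN : 1 ≤ N) (l : Idx N) :
    select (quad k ρ N) (matA k ρ N + matC k ρ N).trace l - rel k ρ N l ∈
      (SymbolMap.polynomial k (gwt ρ)).fil (deg l + 1) := by
  have hAB : ∀ i j r : Fin (N + 1), matA k ρ N i r * matB k ρ N r j ∈ (SymbolMap.polynomial k (gwt ρ)).fil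
      (200 * (N + 1) + (if r = 0 then 0 else 2) + (i : ℤ) - j) := fun i j r => by
    refine SymbolMap.X_mul_X_mem_fil_polynomial _ (le_of_eq ?_)
    simp only [gwt, elim_va, elim_vb]; split_ifs <;> ring
  have hBA : ∀ i j : Fin (N + 1), (matB k ρ N * matA k ρ N) i j ∈ (SymbolMap.polynomial k (gwt ρ)).fil
      (200 * (N + 1) + (if i = 0 then 0 else 1) + (if j = 0 then 0 else 1) + 4 * ((i : ℤ) - j)) :=
    fun i j => by
    rw [Matrix.mul_apply]
    refine sum_mem fun r _ => SymbolMap.X_mul_X_mem_fil_polynomial _ (le_of_eq ?_)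
    simp only [gwt, elim_va, elim_vb]; ring
  have hCD : ∀ i j, (matC k ρ N * matD k ρ N) i j ∈ (SymbolMap.polynomial k (gwt ρ)).fil
      (200 * (N + 1)) := fun i j => by
    rw [Matrix.mul_apply]
    refine sum_mem fun r _ => SymbolMap.X_mul_X_mem_fil_polynomial _ (le_of_eq ?_)
    simp only [gwt, elim_vc, elim_vd]; ring
  have hDC : ∀ i j : Fin (N + 1), (matD k ρ N * matC k ρ N) i j ∈ (SymbolMap.polynomial k (gwt ρ)).fil
      (200 * (N + 1) + i - j) := fun i j => by
    rw [Matrix.mul_apply]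
    refine sum_mem fun r _ => SymbolMap.X_mul_X_mem_fil_polynomial _ (le_of_eq ?_)
    simp only [gwt, elim_vc, elim_vd]; ring
  have hAB' : ∀ i j : Fin (N + 1), (matA k ρ N * matB k ρ N) i j ∈ (SymbolMap.polynomial k (gwt ρ)).fil
      (200 * (N + 1) + (i : ℤ) - j) := fun i j => by
    rw [Matrix.mul_apply]
    exact sum_mem fun r _ => SymbolMap.fil_mono _ (by split_ifs <;> omega) (hAB i j r)
  rcases l with p | p | i | _
  · have hp : (p.1.2 : ℕ) < p.1.1 := p.2
    simp only [select, rel, deg, Sum.elim_inl, quad, Matrix.add_apply, Matrix.sub_apply]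
    set a := (matB k ρ N * matA k ρ N) p.1.2 p.1.1
    rw [show ∀ x y z : MvPolynomial (QuadVar ρ (N + 1)) k, x - a + (y - z) - -a = x + (y - z) by
      intros; ring]
    have hle : (if p.1.2 = 0 then (0 : ℤ) else 1) ≤ 1 := by split_ifs <;> omega
    exact add_mem (SymbolMap.fil_mono _ (by omega) (hAB' _ _))
      (sub_mem (SymbolMap.fil_mono _ (by omega) (hCD _ _)) (SymbolMap.fil_mono _ (by omega) (hDC _ _)))
  · have hp : (p.1.2 : ℕ) < p.1.1 := p.2
    simp only [select, rel, deg, Sum.elim_inl, Sum.elim_inr, quad, Matrix.add_apply, Matrix.sub_apply,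
      PairVar.rel]
    set a := (matC k ρ N * matD k ρ N) p.1.1 p.1.2
    rw [show ∀ x y z : MvPolynomial (QuadVar ρ (N + 1)) k, x - y + (a - z) - a = x - y - z by
      intros; ring]
    exact sub_mem (sub_mem (SymbolMap.fil_mono _ (by omega) (hAB' _ _))
      (SymbolMap.fil_mono _ (by split_ifs <;> omega) (hBA _ _)))
      (SymbolMap.fil_mono _ (by omega) (hDC _ _))
  · simp only [select, rel, deg, Sum.elim_inl, Sum.elim_inr, quad, Matrix.add_apply, Matrix.sub_apply,
      diag]
    have h1 := hBA i.1 i.1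
    rw [if_neg i.2] at h1
    have h2 := SymbolMap.sum_sub_mem ((SymbolMap.polynomial k (gwt ρ)).fil (200 * (N + 1) + 1))
      (Finset.mem_univ (0 : Fin (N + 1))) (x := fun r => matA k ρ N i.1 r * matB k ρ N r i.1)
      fun r _ hr => SymbolMap.fil_mono _ (by rw [if_neg hr]; omega) (hAB i.1 i.1 r)
    rw [← Matrix.mul_apply] at h2
    convert sub_mem h2 (SymbolMap.fil_mono _ (by omega : 200 * ((N : ℤ) + 1) + 1 ≤ _) h1) using 1
    simp only [matA, matB, Matrix.of_apply]
    ring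
  · simp only [select, rel, deg, Sum.elim_inr, Matrix.trace, Matrix.diag, Matrix.add_apply]
    refine SymbolMap.sum_sub_mem _ (Finset.mem_univ (Fin.last N))
      (x := fun i => matA k ρ N i i + matC k ρ N i i) fun i _ hi => add_mem ?_ ?_
    · refine SymbolMap.fil_mono _ ?_ (SymbolMap.X_mem_fil_polynomial _ (va i i))
      have : (i : ℕ) ≠ N := fun h => hi (Fin.ext h)
      have h0 : i = 0 ↔ (i : ℕ) = 0 := by rw [Fin.ext_iff]; simp
      simp only [gwt, elim_va, h0]
      split_ifs <;> omega
    · refine SymbolMap.fil_mono _ ?_ (SymbolMap.X_mem_fil_polynomial _ (vc i i))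
      have : (i : ℕ) ≠ N := fun h => hi (Fin.ext h)
      simp only [gwt, elim_vc]
      omega

end QuadVar

end

theorem Matrix.triple_mul_eq_zero {R : Type*} [CommRing R] {n : ℕ} {κ : Type*}
    {P : κ → Matrix (Fin n) (Fin n) R}
    (h : ∀ a b c i j i' j' i'' j'', P a i j * P b i' j' * P c i'' j'' = 0) (a b c : κ) :
    P a * P b * P c = 0 :=
  Matrix.mul_mul_eq_zero_of_entries fun _ _ _ _ _ _ => h _ _ _ _ _ _ _ _ _

theorem relMatrix_map_of_mul_eq_zero {R Q : Type*} [CommRing R] [CommRing Q] {p s q m n : ℕ}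
    [Fact p.Prime] (hq : q = p ^ s) (hq3 : 3 ≤ q)
    (φ : MvPowerSeries (Fin (2 * (m + 1) + 2) × Fin n × Fin n) R →+* Q) (hp : (p : Q) = 0)
    (P : ℕ → Matrix (Fin n) (Fin n) Q)
    (hP : ∀ κ (h : κ < 2 * (m + 1) + 2), (varMatrix _ n ⟨κ, h⟩).map φ = P κ)
    (h3 : ∀ a b c i j i' j' i'' j'', P a i j * P b i' j' * P c i'' j'' = 0)
    (h2 : ∀ a b, 4 ≤ a → 4 ≤ b → P a * P b = 0) :
    (relMatrix q (m + 1) n).map φ = 1 + (P 0 * P 1 - P 1 * P 0 + (P 2 * P 3 - P 3 * P 2)) := by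
  have h3' := Matrix.triple_mul_eq_zero h3
  have hX : ∀ κ (h : κ < 2 * (m + 1) + 2), (Xt _ n ⟨κ, h⟩).map φ = 1 + P κ := by
    intro κ h
    rw [← hP κ h, ← RingHom.mapMatrix_apply, ← RingHom.mapMatrix_apply, Xt, map_add, map_one]
  have hcomm : ∀ a b, matComm (1 + P a) (1 + P b) = 1 + (P a * P b - P b * P a) := fun a b =>
    matComm_one_add (h3' _ _ _) (h3' _ _ _) (h3' _ _ _) (h3' _ _ _) (h3' _ _ _) (h3' _ _ _)
  have hpow : (1 + P 0) ^ q = 1 := by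
    obtain ⟨r, hr⟩ := (Commute.one_left (P 0)).exists_add_pow_prime_pow_eq (Fact.out : p.Prime) s
    have hp' : (p : Matrix (Fin n) (Fin n) Q) = 0 := by
      rw [← Matrix.diagonal_natCast, hp, Matrix.diagonal_zero]
    rw [hq, hr, ← hq, hp', zero_mul, zero_mul, zero_mul, one_pow, add_zero]
    obtain ⟨r, rfl⟩ := Nat.exists_eq_add_of_le hq3
    rw [pow_add, pow_succ, pow_two, h3', zero_mul, add_zero]
  rw [relMatrix_map]
  simp only [hX]
  rw [hpow, one_mul, List.ofFn_succ, List.ofFn_succ, List.prod_cons, List.prod_cons,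
    List.prod_eq_one, mul_one]
  · simp only [Fin.val_zero, Fin.val_succ, mul_zero, zero_add, mul_one]
    rw [hcomm, hcomm, show 2 + 1 = 3 from rfl]
    have e1 := h3' 0 1 2
    have e2 := h3' 0 1 3
    have e3 := h3' 1 0 2
    have e4 := h3' 1 0 3
    calc (1 + (P 0 * P 1 - P 1 * P 0)) * (1 + (P 2 * P 3 - P 3 * P 2)) =
        1 + (P 0 * P 1 - P 1 * P 0 + (P 2 * P 3 - P 3 * P 2)) +
          (P 0 * P 1 * P 2 * P 3 - P 0 * P 1 * P 3 * P 2 - P 1 * P 0 * P 2 * P 3 +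
            P 1 * P 0 * P 3 * P 2) := by noncomm_ring
      _ = _ := by rw [e1, e2, e3, e4]; simp
  · intro M hM
    obtain ⟨i, rfl⟩ := (List.mem_ofFn' _ _).1 hM
    simp only [Fin.val_succ]
    rw [hcomm, h2 _ _ (by omega) (by omega), h2 _ _ (by omega) (by omega), sub_zero, add_zero]

section

open QuadVar

/-- The variables of the power series ring for matrices of size `N + 1`. -/
abbrev GenVar (m N : ℕ) := Fin (2 * (m + 1) + 2) × Fin (N + 1) × Fin (N + 1)

/-- The variables not belonging to the first four matrices. -/
abbrev RestVar (m N : ℕ) := {t : GenVar m N // 4 ≤ (t.1 : ℕ)}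

section

variable (k : Type*) [CommRing k] (m N : ℕ)

/-- The change of variables adapted to the initial forms. -/
noncomputable def chg (t : GenVar m N) : MvPowerSeries (QuadVar (RestVar m N) (N + 1)) k :=
  if h : 4 ≤ (t.1 : ℕ) then MvPowerSeries.X (vr ⟨t, h⟩)
  else if (t.1 : ℕ) = 0 then MvPowerSeries.X (va t.2.1 t.2.2) + MvPowerSeries.X (vc t.2.1 t.2.2)
  else if (t.1 : ℕ) = 1 then MvPowerSeries.X (vb t.2.1 t.2.2)
  else if (t.1 : ℕ) = 2 then MvPowerSeries.X (vc t.2.1 t.2.2)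
  else MvPowerSeries.X (vd t.2.1 t.2.2) - MvPowerSeries.X (vb t.2.1 t.2.2)

/-- The inverse change of variables. -/
noncomputable def chgInv : QuadVar (RestVar m N) (N + 1) → MvPowerSeries (GenVar m N) k :=
  elim (fun i j => MvPowerSeries.X (⟨0, by omega⟩, i, j) - MvPowerSeries.X (⟨2, by omega⟩, i, j))
    (fun i j => MvPowerSeries.X (⟨1, by omega⟩, i, j))
    (fun i j => MvPowerSeries.X (⟨2, by omega⟩, i, j))
    (fun i j => MvPowerSeries.X (⟨3, by omega⟩, i, j) + MvPowerSeries.X (⟨1, by omega⟩, i, j))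
    fun t => MvPowerSeries.X t.1

theorem hasSubst_chg : MvPowerSeries.HasSubst (chg k m N) :=
  MvPowerSeries.hasSubst_of_constantCoeff_zero fun t => by
    unfold chg
    split_ifs <;> simp

theorem hasSubst_chgInv : MvPowerSeries.HasSubst (chgInv k m N) :=
  MvPowerSeries.hasSubst_of_constantCoeff_zero fun t => by
    rcases t with (t | ⟨i, j⟩ | ⟨i, j⟩) | ⟨i, j⟩ | ⟨i, j⟩ <;> simp [chgInv, elim]

theorem subst_chgInv_chg (t : GenVar m N) :
    MvPowerSeries.subst (chgInv k m N) (chg k m N t) = (MvPowerSeries.X t : MvPowerSeries _ k) := by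
  rw [← MvPowerSeries.coe_substAlgHom (hasSubst_chgInv k m N)]
  obtain ⟨⟨κ, hκ⟩, i, j⟩ := t
  unfold chg
  split_ifs with h1 h2 h3 h4
  · rw [MvPowerSeries.substAlgHom_X]
    rfl
  · obtain rfl : κ = 0 := h2
    rw [map_add, MvPowerSeries.substAlgHom_X, MvPowerSeries.substAlgHom_X]
    exact sub_add_cancel _ _
  · obtain rfl : κ = 1 := h3
    rw [MvPowerSeries.substAlgHom_X]
    rfl
  · obtain rfl : κ = 2 := h4
    rw [MvPowerSeries.substAlgHom_X]
    rfl
  · obtain rfl : κ = 3 := by simp only at h1 h2 h3 h4; omega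
    rw [map_sub, MvPowerSeries.substAlgHom_X, MvPowerSeries.substAlgHom_X]
    exact add_sub_cancel_right _ _

theorem subst_chg_chgInv (v : QuadVar (RestVar m N) (N + 1)) :
    MvPowerSeries.subst (chg k m N) (chgInv k m N v) = (MvPowerSeries.X v : MvPowerSeries _ k) := by
  have hX := fun t => MvPowerSeries.substAlgHom_X (R := k) (hasSubst_chg k m N) t
  rw [← MvPowerSeries.coe_substAlgHom (hasSubst_chg k m N)]
  rcases v with (t | ⟨i, j⟩ | ⟨i, j⟩) | ⟨i, j⟩ | ⟨i, j⟩
  · have h : chgInv k m N (Sum.inl (Sum.inl t)) = MvPowerSeries.X t.1 := rfl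
    rw [h, hX, chg, dif_pos t.2]
  · have h : chgInv k m N (Sum.inl (Sum.inr (Sum.inl (i, j)))) =
      MvPowerSeries.X (⟨0, by omega⟩, i, j) - MvPowerSeries.X (⟨2, by omega⟩, i, j) := rfl
    rw [h, map_sub, hX, hX]
    exact add_sub_cancel_right _ _
  · have h : chgInv k m N (Sum.inl (Sum.inr (Sum.inr (i, j)))) =
      MvPowerSeries.X (⟨1, by omega⟩, i, j) := rfl
    rw [h, hX]
    rfl
  · have h : chgInv k m N (Sum.inr (Sum.inl (i, j))) =
      MvPowerSeries.X (⟨2, by omega⟩, i, j) := rfl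
    rw [h, hX]
    rfl
  · have h : chgInv k m N (Sum.inr (Sum.inr (i, j))) =
      MvPowerSeries.X (⟨3, by omega⟩, i, j) + MvPowerSeries.X (⟨1, by omega⟩, i, j) := rfl
    rw [h, map_add, hX, hX]
    exact sub_add_cancel _ _

/-- The change of variables as a ring isomorphism. -/
noncomputable def chgEquiv :
    MvPowerSeries (GenVar m N) k ≃+* MvPowerSeries (QuadVar (RestVar m N) (N + 1)) k :=
  RingEquiv.ofRingHom (MvPowerSeries.substAlgHom (hasSubst_chg k m N)).toRingHom
    (MvPowerSeries.substAlgHom (hasSubst_chgInv k m N)).toRingHom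
    (by
      ext1 x
      change (MvPowerSeries.substAlgHom (hasSubst_chg k m N))
        (MvPowerSeries.substAlgHom (hasSubst_chgInv k m N) x) = x
      rw [MvPowerSeries.coe_substAlgHom, MvPowerSeries.coe_substAlgHom,
        MvPowerSeries.subst_comp_subst_apply (hasSubst_chgInv k m N) (hasSubst_chg k m N),
        funext (subst_chg_chgInv k m N), MvPowerSeries.subst_self, id])
    (by
      ext1 x
      change (MvPowerSeries.substAlgHom (hasSubst_chgInv k m N))
        (MvPowerSeries.substAlgHom (hasSubst_chg k m N) x) = x
      rw [MvPowerSeries.coe_substAlgHom, MvPowerSeries.coe_substAlgHom,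
        MvPowerSeries.subst_comp_subst_apply (hasSubst_chg k m N) (hasSubst_chgInv k m N),
        funext (subst_chgInv_chg k m N), MvPowerSeries.subst_self, id])

theorem chgEquiv_X (t : GenVar m N) : chgEquiv k m N (MvPowerSeries.X t) = chg k m N t :=
  MvPowerSeries.substAlgHom_X (hasSubst_chg k m N) _

end

section

variable (k : Type*) [CommRing k] (q m N : ℕ)

/-- The relations cutting out the locus where the relation matrix is scalar and the first matrix has
determinant `ζ`. -/
noncomputable def famRel (ζ : k) : Idx N → MvPowerSeries (GenVar m N) k :=
  select (relMatrix q (m + 1) (N + 1) - 1)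
    ((Xt (2 * (m + 1) + 2) (N + 1) ⟨0, by omega⟩).det - MvPowerSeries.C ζ)

end

section

variable (k : Type*) [Field k] (m N : ℕ)

theorem chg_mem_fil (t : GenVar m N) :
    chg k m N t ∈ (SymbolMap.powerSeries k _ (gwt_pos (RestVar m N))).fil (96 * (N + 1)) := by
  have hX : ∀ v, (MvPowerSeries.X v : MvPowerSeries (QuadVar (RestVar m N) (N + 1)) k) ∈
      (SymbolMap.powerSeries k _ (gwt_pos (RestVar m N))).fil (96 * (N + 1)) := fun v => by
    have := SymbolMap.coe_mem_fil_powerSeries (gwt_pos (RestVar m N))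
      (SymbolMap.X_mem_fil_polynomial (k := k) (gwt (RestVar m N)) v)
    rw [MvPolynomial.coe_X] at this
    exact SymbolMap.fil_mono _ (le_gwt _ v) this
  unfold chg
  split_ifs
  · exact hX _
  · exact add_mem (hX _) (hX _)
  · exact hX _
  · exact hX _
  · exact sub_mem (hX _) (hX _)

theorem chg_mem_fil_of_le (t : GenVar m N) (ht : 4 ≤ (t.1 : ℕ)) :
    chg k m N t ∈ (SymbolMap.powerSeries k _ (gwt_pos (RestVar m N))).fil (200 * (N + 1)) := by
  have h : gwt (N := N) (RestVar m N) (vr ⟨t, ht⟩) = 200 * (N + 1) := rfl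
  have := SymbolMap.coe_mem_fil_powerSeries (gwt_pos (RestVar m N))
    (SymbolMap.X_mem_fil_polynomial (k := k) (gwt (N := N) (RestVar m N)) (vr ⟨t, ht⟩))
  rw [MvPolynomial.coe_X, h] at this
  rw [chg, dif_pos ht]
  exact this

/-- The image of the `κ`-th generic matrix under the change of variables. -/
noncomputable def chgMatrix (κ : ℕ) : Matrix (Fin (N + 1)) (Fin (N + 1))
    (MvPowerSeries (QuadVar (RestVar m N) (N + 1)) k) :=
  if h : κ < 2 * (m + 1) + 2 then Matrix.of fun i j => chg k m N (⟨κ, h⟩, i, j) else 0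

theorem chgMatrix_mem_fil (κ : ℕ) (i j) : chgMatrix k m N κ i j ∈
    (SymbolMap.powerSeries k _ (gwt_pos (RestVar m N))).fil (96 * (N + 1)) := by
  unfold chgMatrix
  split_ifs
  · exact chg_mem_fil k m N _
  · exact zero_mem _

theorem chgMatrix_mem_fil_of_le (κ : ℕ) (hκ : 4 ≤ κ) (i j) : chgMatrix k m N κ i j ∈
    (SymbolMap.powerSeries k _ (gwt_pos (RestVar m N))).fil (200 * (N + 1)) := by
  unfold chgMatrix
  split_ifs
  · exact chg_mem_fil_of_le k m N _ hκ
  · exact zero_mem _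

/-- The inclusion of polynomials into power series, in the new variables. -/
noncomputable abbrev toSeries : MvPolynomial (QuadVar (RestVar m N) (N + 1)) k →+*
    MvPowerSeries (QuadVar (RestVar m N) (N + 1)) k :=
  MvPolynomial.coeToMvPowerSeries.ringHom

theorem chgMatrix_eq :
    chgMatrix k m N 0 = (matA k (RestVar m N) N).map (toSeries k m N) + (matC k (RestVar m N) N).map (toSeries k m N) ∧
    chgMatrix k m N 1 = (matB k (RestVar m N) N).map (toSeries k m N) ∧
    chgMatrix k m N 2 = (matC k (RestVar m N) N).map (toSeries k m N) ∧
    chgMatrix k m N 3 = (matD k (RestVar m N) N).map (toSeries k m N) - (matB k (RestVar m N) N).map (toSeries k m N) := by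
  have h3 : 3 < 2 * (m + 1) + 2 := by omega
  refine ⟨?_, ?_, ?_, ?_⟩ <;> ext1 i j <;>
    simp [chgMatrix, chg, matA, matB, PairVar.matC, PairVar.matD, h3]

variable {p s q : ℕ} [Fact p.Prime]

theorem comm_add_comm_sub {R : Type*} [Ring R] (a b c d : R) :
    (a + c) * b - b * (a + c) + (c * (d - b) - (d - b) * c) =
      a * b - b * a + (c * d - d * c) := by
  noncomm_ring

theorem relMatrix_sub_quad_mem_fil (hq : q = p ^ s) (hq3 : 3 ≤ q) (hp : (p : k) = 0) (i j) :
    chgEquiv k m N ((relMatrix q (m + 1) (N + 1) - 1 : Matrix _ _ (MvPowerSeries _ k)) i j) - (toSeries k m N) (quad k (RestVar m N) N i j) ∈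
      (SymbolMap.powerSeries k _ (gwt_pos (RestVar m N))).fil (288 * (N + 1)) := by
  have hmem : ∀ {x y : MvPowerSeries (QuadVar (RestVar m N) (N + 1)) k},
      Ideal.Quotient.mk (SymbolMap.filIdeal (gwt_pos (RestVar m N)) (288 * (N + 1))) x =
        Ideal.Quotient.mk _ y → x - y ∈
      (SymbolMap.powerSeries k _ (gwt_pos (RestVar m N))).fil (288 * (N + 1)) := fun h =>
    (SymbolMap.mem_filIdeal _).1 (Ideal.Quotient.eq.1 h)
  set π := Ideal.Quotient.mk
    (SymbolMap.filIdeal (k := k) (gwt_pos (RestVar m N)) (288 * (N + 1))) with hπ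
  have h0 : ∀ {x : MvPowerSeries (QuadVar (RestVar m N) (N + 1)) k} {a : ℤ}, 288 * (N + 1) ≤ a →
      x ∈ (SymbolMap.powerSeries k _ (gwt_pos (RestVar m N))).fil a → π x = 0 := fun ha hx =>
    Ideal.Quotient.eq_zero_iff_mem.2 ((SymbolMap.mem_filIdeal _).2 (SymbolMap.fil_mono _ ha hx))
  have key := relMatrix_map_of_mul_eq_zero hq hq3 (m := m) (n := N + 1) (R := k)
    (π.comp (chgEquiv k m N : _ →+* _)) ?_ (fun κ => (chgMatrix k m N κ).map π) ?_ ?_ ?_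
  · refine hmem ?_
    obtain ⟨e0, e1, e2, e3⟩ := chgMatrix_eq k m N
    have h1 : (relMatrix q (m + 1) (N + 1) - 1 : Matrix _ _ (MvPowerSeries _ k)).map (π.comp (chgEquiv k m N : _ →+* _)) =
        ((quad k (RestVar m N) N).map (toSeries k m N)).map π := by
      rw [← RingHom.mapMatrix_apply, map_sub, map_one, RingHom.mapMatrix_apply, key]
      simp only [e0, e1, e2, e3, quad, ← RingHom.mapMatrix_apply, map_sub, map_add, map_mul]
      rw [add_sub_cancel_left, comm_add_comm_sub]
    exact congrFun (congrFun h1 i) j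
  · rw [← map_natCast (π.comp (MvPowerSeries.C (σ := QuadVar (RestVar m N) (N + 1)) (R := k))) p,
      hp, map_zero]
  · intro κ h
    ext1 i j
    simp only [Matrix.map_apply, varMatrix, Matrix.of_apply, chgMatrix, dif_pos h]
    exact congrArg π (chgEquiv_X k m N _)
  · intro a b c i j i' j' i'' j''
    simp only [Matrix.map_apply, ← map_mul]
    exact h0 (by omega) (SymbolMap.mul_mem_fil _ (SymbolMap.mul_mem_fil _
      (chgMatrix_mem_fil k m N a i j) (chgMatrix_mem_fil k m N b i' j'))
      (chgMatrix_mem_fil k m N c i'' j''))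
  · intro a b ha hb
    refine Matrix.mul_eq_zero_of_entries fun i j i' j' => ?_
    simp only [Matrix.map_apply, ← map_mul]
    exact h0 (by omega) (SymbolMap.mul_mem_fil _
      (chgMatrix_mem_fil_of_le k m N a ha i j) (chgMatrix_mem_fil_of_le k m N b hb i' j'))

theorem det_sub_trace_mem_fil :
    chgEquiv k m N ((Xt (2 * (m + 1) + 2) (N + 1) ⟨0, by omega⟩).det - 1) -
      (toSeries k m N) (matA k (RestVar m N) N + matC k (RestVar m N) N).trace ∈
      (SymbolMap.powerSeries k _ (gwt_pos (RestVar m N))).fil (192 * (N + 1)) := by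
  set π := Ideal.Quotient.mk
    (SymbolMap.filIdeal (k := k) (gwt_pos (RestVar m N)) (192 * (N + 1))) with hπ
  refine (SymbolMap.mem_filIdeal _).1 (Ideal.Quotient.eq.1 ?_)
  have h1 : (Xt (2 * (m + 1) + 2) (N + 1) ⟨0, by omega⟩).map (chgEquiv k m N) =
      1 + chgMatrix k m N 0 := by
    change (chgEquiv k m N).toRingHom.mapMatrix _ = _
    rw [Xt, map_add, map_one]
    congr 1
    ext1 i j
    simp only [RingHom.mapMatrix_apply, Matrix.map_apply, varMatrix, Matrix.of_apply, chgMatrix,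
      dif_pos (show 0 < 2 * (m + 1) + 2 by omega)]
    exact chgEquiv_X k m N _
  have h2 : (toSeries k m N) (matA k (RestVar m N) N + matC k (RestVar m N) N).trace =
      (chgMatrix k m N 0).trace := by
    rw [(chgMatrix_eq k m N).1, Matrix.trace, Matrix.trace, map_sum]
    exact Finset.sum_congr rfl fun i _ => by simp
  have h3 : chgEquiv k m N (Xt (2 * (m + 1) + 2) (N + 1) ⟨0, by omega⟩).det =
      (1 + chgMatrix k m N 0).det := by
    rw [← h1]
    exact RingEquiv.map_det _ _
  rw [map_sub, map_one, h2, h3, map_sub, map_one, RingHom.map_det, map_add, map_one,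
    Matrix.det_one_add_of_mul_eq_zero, add_sub_cancel_left]
  · exact (AddMonoidHom.map_trace π.toAddMonoidHom _).symm
  · intro i j i' j'
    simp only [RingHom.mapMatrix_apply, Matrix.map_apply, ← map_mul]
    refine Ideal.Quotient.eq_zero_iff_mem.2 ((SymbolMap.mem_filIdeal _).2 (SymbolMap.fil_mono _ ?_
      (SymbolMap.mul_mem_fil _ (chgMatrix_mem_fil k m N 0 i j) (chgMatrix_mem_fil k m N 0 i' j'))))
    omega

end

end

section

open QuadVar

section

theorem QuadVar.map_select {R R' : Type*} [CommRing R] [CommRing R'] {N : ℕ} (φ : R →+* R')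
    (M : Matrix (Fin (N + 1)) (Fin (N + 1)) R) (δ : R) (l : Idx N) :
    φ (select M δ l) = select (M.map φ) (φ δ) l := by
  rcases l with _ | _ | _ | _ <;> rfl

theorem StronglyRegular.of_ringEquiv {R R' ι : Type*} [CommRing R] [CommRing R'] (e : R ≃+* R')
    {f : ι → R} (h : StronglyRegular fun l => e (f l)) : StronglyRegular f := by
  have key : ∀ (s : Finset ι) x, x ∈ Ideal.span (f '' s) ↔
      e x ∈ Ideal.span ((fun l => e (f l)) '' s) := fun s x => by
    rw [show (fun l => e (f l)) '' (s : Set ι) = e '' (f '' s) by rw [Set.image_image],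
      ← Ideal.map_span]
    refine ⟨fun hx => Ideal.mem_map_of_mem _ hx, fun hx => ?_⟩
    obtain ⟨y, hy, hxy⟩ := (Ideal.mem_map_of_equiv e _).1 hx
    exact e.injective hxy ▸ hy
  intro s r hr x hx
  rw [key] at hx ⊢
  rw [map_mul] at hx
  exact h s r hr _ hx

theorem CompletelyIntClosed.of_ringEquiv {A B : Type*} [CommRing A] [CommRing B] (e : A ≃+* B)
    (h : CompletelyIntClosed B) : CompletelyIntClosed A := by
  intro a b d hb hd H
  have := h (e a) (e b) (e d) (by simpa using hb) (by simpa using hd) fun m => by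
    simpa using map_dvd e (H m)
  simpa using map_dvd e.symm this

variable (k : Type*) [Field k] (m : ℕ) {N : ℕ} {p s q : ℕ} [Fact p.Prime]

theorem hasSymb_famRel (hq : q = p ^ s) (hq3 : 3 ≤ q) (hp : (p : k) = 0) (hN : 1 ≤ N) :
    (SymbolMap.powerSeries k _ (gwt_pos (RestVar m N))).HasSymb
      (fun l => chgEquiv k m N (famRel k q m N 1 l)) (rel k (RestVar m N) N) deg := by
  refine SymbolMap.hasSymb_powerSeries _ (isWeightedHomogeneous_rel k _ hN) fun l => ?_
  have h1 := SymbolMap.coe_mem_fil_powerSeries (gwt_pos (RestVar m N))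
    (select_sub_rel_mem k (RestVar m N) hN l)
  have h2 : chgEquiv k m N (famRel k q m N 1 l) - toSeries k m N
      (select (quad k (RestVar m N) N) (matA k (RestVar m N) N + matC k (RestVar m N) N).trace l) ∈
      (SymbolMap.powerSeries k _ (gwt_pos (RestVar m N))).fil (deg l + 1) := by
    have h3 := relMatrix_sub_quad_mem_fil k m N hq hq3 hp
    have h4 := det_sub_trace_mem_fil k m N
    rw [← map_one MvPowerSeries.C] at h4
    rcases l with l | l | l | l
    · refine SymbolMap.fil_mono _ ?_ (h3 _ _)
      have := l.2
      simp only [deg, Sum.elim_inl]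
      split_ifs <;> omega
    · refine SymbolMap.fil_mono _ ?_ (h3 _ _)
      simp only [deg, Sum.elim_inl, Sum.elim_inr]
      omega
    · refine SymbolMap.fil_mono _ ?_ (h3 _ _)
      simp only [deg, Sum.elim_inl, Sum.elim_inr]
      omega
    · refine SymbolMap.fil_mono _ ?_ h4
      simp only [deg, Sum.elim_inr]
      omega
  have h5 := add_mem h2 h1
  have h6 := map_sub (toSeries k m N)
    (select (quad k (RestVar m N) N) (matA k (RestVar m N) N + matC k (RestVar m N) N).trace l)
    (rel k (RestVar m N) N l)
  rw [MvPolynomial.coeToMvPowerSeries.ringHom_apply] at h6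
  rwa [h6, sub_add_sub_cancel] at h5

theorem stronglyRegular_famRel (hq : q = p ^ s) (hq3 : 3 ≤ q) (hp : (p : k) = 0) (hN : 1 ≤ N) :
    StronglyRegular (famRel k q m N 1) :=
  .of_ringEquiv (chgEquiv k m N) <| (hasSymb_famRel k m hq hq3 hp hN).stronglyRegular
    (QuadVar.stronglyRegular k _ N hN) (SymbolMap.closed_powerSeries _)

theorem isDomain_and_completelyIntClosed_famRel (hq : q = p ^ s) (hq3 : 3 ≤ q) (hp : (p : k) = 0)
    (hN : 1 ≤ N) :
    IsDomain (MvPowerSeries (GenVar m N) k ⧸ Ideal.span (Set.range (famRel k q m N 1))) ∧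
    CompletelyIntClosed
      (MvPowerSeries (GenVar m N) k ⧸ Ideal.span (Set.range (famRel k q m N 1))) := by
  classical
  have : IsDomain (MvPolynomial (QuadVar (RestVar m N) (N + 1)) k ⧸
      Ideal.span (Set.range (rel k (RestVar m N) N))) :=
    (QuadVar.isDomain_and_isIntegrallyClosed k _ N hN).1
  obtain ⟨h1, h2⟩ := (hasSymb_famRel k m hq hq3 hp hN).completelyIntClosed
    (QuadVar.stronglyRegular k _ N hN) (SymbolMap.closed_powerSeries _)
    (SymbolMap.mem_fil_zero_powerSeries _ _) (SymbolMap.symb_one_powerSeries _)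
    (QuadVar.completelyIntClosed k _ N hN)
  let e : (MvPowerSeries (GenVar m N) k ⧸ Ideal.span (Set.range (famRel k q m N 1))) ≃+*
      (MvPowerSeries (QuadVar (RestVar m N) (N + 1)) k ⧸
        Ideal.span (Set.range fun l => chgEquiv k m N (famRel k q m N 1 l))) :=
    Ideal.quotientEquiv _ _ (chgEquiv k m N) (by
      rw [Ideal.map_span, ← Set.range_comp]
      rfl)
  exact ⟨e.toMulEquiv.isDomain _, .of_ringEquiv e h2⟩

end

end

theorem Ideal.mem_of_forall_exists_pow_dvd_sub {A : Type*} [CommRing A] [IsNoetherianRing A]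
    [IsLocalRing A] {ϖ : A} (hϖ : ¬ IsUnit ϖ) (I : Ideal A) {x : A}
    (h : ∀ n : ℕ, ∃ y ∈ I, ϖ ^ n ∣ x - y) : x ∈ I := by
  by_cases hI : I = ⊤
  · rw [hI]; trivial
  have : Nontrivial (A ⧸ I) := Ideal.Quotient.nontrivial_iff.2 hI
  have : IsLocalRing (A ⧸ I) :=
    IsLocalRing.of_surjective' (Ideal.Quotient.mk I) Ideal.Quotient.mk_surjective
  have hne : Ideal.span {Ideal.Quotient.mk I ϖ} ≠ ⊤ := fun h => by
    have := IsLocalHom.of_surjective (Ideal.Quotient.mk I) Ideal.Quotient.mk_surjective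
    rw [Ideal.span_singleton_eq_top] at h
    exact hϖ ((isUnit_map_iff (Ideal.Quotient.mk I) ϖ).1 h)
  rw [← Ideal.Quotient.eq_zero_iff_mem, ← Ideal.mem_bot,
    ← Ideal.iInf_pow_eq_bot_of_isLocalRing _ hne, Ideal.mem_iInf]
  intro n
  obtain ⟨y, hy, z, hz⟩ := h n
  rw [Ideal.span_singleton_pow, Ideal.mem_span_singleton]
  refine ⟨Ideal.Quotient.mk I z, ?_⟩
  rw [← map_pow, ← map_mul, ← hz, map_sub, Ideal.Quotient.eq_zero_iff_mem.2 hy, sub_zero]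

section

variable {A B : Type*} [CommRing A] [CommRing B]

theorem Prime.pow_dvd_of_pow_dvd_pow_mul [IsDomain A] {ϖ b x : A} (hϖ : Prime ϖ) (hb : ¬ ϖ ∣ b)
    {m r : ℕ} (h : b ^ m ∣ ϖ ^ r * x) : b ^ m ∣ x := by
  obtain ⟨c, hc⟩ := h
  obtain ⟨e, rfl⟩ := hϖ.pow_dvd_of_dvd_mul_left r (fun h => hb (hϖ.dvd_of_dvd_pow h))
    (Dvd.intro x hc)
  refine ⟨e, mul_left_cancel₀ (pow_ne_zero r hϖ.ne_zero) ?_⟩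
  rw [hc]; ring

theorem isDomain_and_completelyIntClosed_of_surjective [IsNoetherianRing A] [IsLocalRing A]
    [IsDomain B] (hB : CompletelyIntClosed B) (ψ : A →+* B) (hψ : Function.Surjective ψ) {ϖ : A}
    (hker : ∀ x, ψ x = 0 ↔ ϖ ∣ x) (hϖ : ∀ x, ϖ * x = 0 → x = 0) :
    IsDomain A ∧ CompletelyIntClosed A := by
  have hu : ¬ IsUnit ϖ := fun h => (h.map ψ).ne_zero ((hker ϖ).2 dvd_rfl)
  have hpow : ∀ n x, ϖ ^ n * x = 0 → x = 0 := fun n => by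
    induction n with
    | zero => simp
    | succ n ih => exact fun x hx => ih x (hϖ _ (by rw [← mul_assoc, ← pow_succ', hx]))
  have hmul : ∀ {x}, x ≠ 0 → ∃ n y, x = ϖ ^ n * y ∧ ¬ ϖ ∣ y := fun {x} hx => by
    have : FiniteMultiplicity ϖ x := by
      by_contra h
      refine hx (Ideal.mem_bot.1 (Ideal.mem_of_forall_exists_pow_dvd_sub hu _ fun n =>
        ⟨0, zero_mem _, ?_⟩))
      rw [sub_zero]
      exact FiniteMultiplicity.not_iff_forall.1 h n
    obtain ⟨y, hy⟩ := this.exists_eq_pow_mul_and_not_dvd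
    exact ⟨_, y, hy⟩
  have hdvd : ∀ {x y}, ϖ ∣ x * y → ϖ ∣ x ∨ ϖ ∣ y := fun {x y} h => by
    rwa [← hker, map_mul, mul_eq_zero, hker, hker] at h
  have hdom : IsDomain A := by
    have : NoZeroDivisors A := ⟨fun {x y} h => by
      by_contra! hxy
      obtain ⟨n, x', rfl, hx'⟩ := hmul hxy.1
      obtain ⟨r, y', rfl, hy'⟩ := hmul hxy.2
      have := hpow (n + r) (x' * y') (by rw [← h]; ring)
      exact (hdvd (this ▸ dvd_zero ϖ)).elim hx' hy'⟩
    exact NoZeroDivisors.to_isDomain A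
  refine ⟨hdom, ?_⟩
  have hprime : Prime ϖ :=
    ⟨fun h => hu (by
      have h1 : (1 : A) = 0 := hϖ 1 (by rw [h, zero_mul])
      exact absurd h1 one_ne_zero), hu, fun _ _ => hdvd⟩
  have main : ∀ a b d : A, ¬ ϖ ∣ b → ¬ ϖ ∣ d → (∀ m, b ^ m ∣ d * a ^ m) → b ∣ a := by
    intro a b d hb hd H
    rw [← Ideal.mem_span_singleton]
    refine Ideal.mem_of_forall_exists_pow_dvd_sub hu _ fun n => ?_
    induction n with
    | zero => exact ⟨0, zero_mem _, by simp⟩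
    | succ n ih =>
      obtain ⟨y, hy, a', ha'⟩ := ih
      obtain ⟨y, rfl⟩ := Ideal.mem_span_singleton.1 hy
      have h1 : ∀ m, b ^ m ∣ d * a' ^ m := fun m => by
        refine hprime.pow_dvd_of_pow_dvd_pow_mul hb (r := n * m) ?_
        have : ϖ ^ (n * m) * (d * a' ^ m) = d * (a + b * (-y)) ^ m := by
          rw [mul_neg, ← sub_eq_add_neg, ha']; ring
        rw [this, add_pow, Finset.mul_sum]
        refine Finset.dvd_sum fun i hi => ?_
        have him : i + (m - i) = m := by have := Finset.mem_range.1 hi; omega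
        have : d * (a ^ i * (b * -y) ^ (m - i) * (m.choose i : A)) =
            (d * a ^ i) * b ^ (m - i) * ((-y) ^ (m - i) * (m.choose i : A)) := by
          rw [mul_pow]; ring
        rw [this, ← him, Nat.add_sub_cancel_left, pow_add, him]
        exact Dvd.dvd.mul_right (mul_dvd_mul_right (H i) _) _
      have h2 : ψ b ∣ ψ a' := hB _ _ (ψ d) (by rwa [Ne, hker]) (by rwa [Ne, hker]) fun m => by
        simpa using map_dvd ψ (h1 m)
      obtain ⟨c, hc⟩ := h2
      obtain ⟨c, rfl⟩ := hψ c
      obtain ⟨e, he⟩ := (hker (a' - b * c)).1 (by rw [map_sub, map_mul, hc, sub_self])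
      refine ⟨b * (y + ϖ ^ n * c), Ideal.mem_span_singleton.2 (dvd_mul_right _ _), e, ?_⟩
      rw [pow_succ, mul_assoc, ← he, mul_sub, ← ha']
      ring
  intro a b d hb hd H
  rcases eq_or_ne a 0 with rfl | ha
  · exact dvd_zero _
  obtain ⟨β, b, rfl, hb'⟩ := hmul hb
  obtain ⟨δ, d, rfl, hd'⟩ := hmul hd
  obtain ⟨α, a, rfl, ha'⟩ := hmul ha
  have hβα : β ≤ α := by
    have h1 := H (δ + 1)
    have h2 : ¬ ϖ ∣ d * a ^ (δ + 1) := fun h =>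
      (hdvd h).elim hd' fun h => ha' (hprime.dvd_of_dvd_pow h)
    have h3 : ϖ ^ (β * (δ + 1)) ∣ ϖ ^ (δ + α * (δ + 1)) * (d * a ^ (δ + 1)) := by
      refine (Dvd.intro (b ^ (δ + 1)) ?_).trans (h1.trans (dvd_of_eq ?_)) <;> ring
    have h4 := (pow_dvd_pow_iff hprime.ne_zero hu).1
      (hprime.pow_dvd_of_dvd_mul_right _ h2 h3)
    by_contra! h5
    nlinarith
  obtain ⟨γ, rfl⟩ := Nat.exists_eq_add_of_le hβα
  rw [pow_add, mul_assoc]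
  refine mul_dvd_mul_left _ (main _ _ d hb' hd' fun m => ?_)
  refine hprime.pow_dvd_of_pow_dvd_pow_mul hb' (r := δ) ?_
  refine (mul_dvd_mul_iff_left (pow_ne_zero (β * m) hprime.ne_zero)).1 ?_
  refine (dvd_of_eq ?_).trans ((H m).trans (dvd_of_eq ?_)) <;> ring

theorem mem_span_of_mul_mem {ι : Type*} {ϖ : A} (hϖ : ∀ x, ϖ * x = 0 → x = 0) (φ : A →+* B)
    (hφ : Function.Surjective φ) (hker : ∀ x, φ x = 0 ↔ ϖ ∣ x) {f : ι → A}
    (hf : StronglyRegular fun l => φ (f l)) (s : Finset ι) :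
    ∀ x, ϖ * x ∈ Ideal.span (f '' s) → x ∈ Ideal.span (f '' s) := by
  classical
  induction s using Finset.induction_on with
  | empty => simpa using hϖ
  | insert r s hr ih =>
    intro x hx
    rw [Finset.coe_insert, Set.image_insert_eq] at hx ⊢
    obtain ⟨a, z, hz, hxz⟩ := Ideal.mem_span_insert.1 hx
    have himg : (fun l => φ (f l)) '' (s : Set ι) = φ '' (f '' s) := by rw [Set.image_image]
    have h1 : φ a ∈ Ideal.span ((fun l => φ (f l)) '' s) := by
      refine hf s r hr _ ?_
      have h2 : φ (f r) * φ a = - φ z := by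
        have := (hker (ϖ * x)).2 (dvd_mul_right _ _)
        rw [hxz, map_add, map_mul] at this
        linear_combination this
      dsimp only
      rw [h2, himg, ← Ideal.map_span]
      exact neg_mem (Ideal.mem_map_of_mem _ hz)
    rw [himg, ← Ideal.map_span] at h1
    obtain ⟨w, hw, hwa⟩ := (Ideal.mem_map_iff_of_surjective φ hφ).1 h1
    obtain ⟨c, hc⟩ := (hker (a - w)).1 (by rw [map_sub, hwa, sub_self])
    have h3 : x - c * f r ∈ Ideal.span (f '' s) := ih _ (by
      have : ϖ * (x - c * f r) = w * f r + z := by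
        linear_combination hxz + f r * hc
      rw [this]
      exact add_mem (Ideal.mul_mem_right _ _ hw) hz)
    exact Ideal.mem_span_insert.2 ⟨c, _, h3, by ring⟩

theorem isDomain_and_completelyIntClosed_quotient_span {ι : Type*} [Finite ι] [IsNoetherianRing A]
    [IsLocalRing A] {ϖ : A} (hϖ : ∀ x, ϖ * x = 0 → x = 0) (φ : A →+* B)
    (hφ : Function.Surjective φ) (hker : ∀ x, φ x = 0 ↔ ϖ ∣ x) {f : ι → A}
    (hf : StronglyRegular fun l => φ (f l))
    [IsDomain (B ⧸ Ideal.span (Set.range fun l => φ (f l)))]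
    (hB : CompletelyIntClosed (B ⧸ Ideal.span (Set.range fun l => φ (f l)))) :
    IsDomain (A ⧸ Ideal.span (Set.range f)) ∧
      CompletelyIntClosed (A ⧸ Ideal.span (Set.range f)) := by
  classical
  have := Fintype.ofFinite ι
  set I := Ideal.span (Set.range f) with hI
  set J := Ideal.span (Set.range fun l => φ (f l)) with hJ
  have hmap : I.map φ = J := by
    rw [hI, Ideal.map_span, ← Set.range_comp]; rfl
  have hIJ : I ≤ J.comap φ := Ideal.map_le_iff_le_comap.1 hmap.le
  let ψ := Ideal.quotientMap J φ hIJ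
  have hψ : Function.Surjective ψ := Ideal.quotientMap_surjective hφ
  have : Nontrivial (A ⧸ I) := ψ.domain_nontrivial
  have : IsLocalRing (A ⧸ I) :=
    IsLocalRing.of_surjective' (Ideal.Quotient.mk I) Ideal.Quotient.mk_surjective
  refine isDomain_and_completelyIntClosed_of_surjective hB ψ hψ (ϖ := Ideal.Quotient.mk I ϖ)
    (fun x => ?_) fun x hx => ?_
  · obtain ⟨x, rfl⟩ := Ideal.Quotient.mk_surjective x
    rw [Ideal.quotientMap_mk, Ideal.Quotient.eq_zero_iff_mem, ← hmap]
    constructor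
    · intro h
      obtain ⟨y, hy, hxy⟩ := (Ideal.mem_map_iff_of_surjective φ hφ).1 h
      have := map_dvd (Ideal.Quotient.mk I) ((hker (x - y)).1 (by rw [map_sub, hxy, sub_self]))
      rwa [map_sub, Ideal.Quotient.eq_zero_iff_mem.2 hy, sub_zero] at this
    · rintro ⟨y, hy⟩
      obtain ⟨y, rfl⟩ := Ideal.Quotient.mk_surjective y
      rw [← map_mul, Ideal.Quotient.eq] at hy
      have := Ideal.mem_map_of_mem φ hy
      rwa [map_sub, (hker (ϖ * y)).2 (dvd_mul_right _ _), sub_zero] at this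
  · obtain ⟨x, rfl⟩ := Ideal.Quotient.mk_surjective x
    rw [← map_mul, Ideal.Quotient.eq_zero_iff_mem] at hx
    rw [Ideal.Quotient.eq_zero_iff_mem]
    have e : Set.range f = f '' (Finset.univ : Finset ι) := by simp
    rw [hI, e] at hx ⊢
    exact mem_span_of_mul_mem hϖ φ hφ hker hf _ _ hx

end

section

open QuadVar

theorem famRel_map {R R' : Type*} [CommRing R] [CommRing R'] (φ : R →+* R') (q m N : ℕ) (ζ : R)
    (l : Idx N) : MvPowerSeries.map φ (famRel R q m N ζ l) = famRel R' q m N (φ ζ) l := by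
  rw [famRel, map_select, famRel, map_sub, MvPowerSeries.map_C, RingHom.map_det,
    RingHom.mapMatrix_apply, Xt_map, ← RingHom.mapMatrix_apply, map_sub, map_one,
    RingHom.mapMatrix_apply, relMatrix_map_map]

theorem isDomain_and_completelyIntClosed_famRel_of_dvr {𝒪 : Type*} [CommRing 𝒪] [IsDomain 𝒪]
    [IsDiscreteValuationRing 𝒪] (m : ℕ) {N p s q : ℕ} [Fact p.Prime] (hq : q = p ^ s) (hq3 : 3 ≤ q)
    (hp : (p : IsLocalRing.ResidueField 𝒪) = 0) (hN : 1 ≤ N) {ζ : 𝒪}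
    (hζ : IsLocalRing.residue 𝒪 ζ = 1) :
    IsDomain (MvPowerSeries (GenVar m N) 𝒪 ⧸ Ideal.span (Set.range (famRel 𝒪 q m N ζ))) ∧
    CompletelyIntClosed
      (MvPowerSeries (GenVar m N) 𝒪 ⧸ Ideal.span (Set.range (famRel 𝒪 q m N ζ))) := by
  obtain ⟨ϖ, hϖ⟩ := IsDiscreteValuationRing.exists_irreducible 𝒪
  have hfam : (fun l => MvPowerSeries.map (IsLocalRing.residue 𝒪) (famRel 𝒪 q m N ζ l)) =
      famRel (IsLocalRing.ResidueField 𝒪) q m N 1 := by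
    ext1 l
    rw [famRel_map, hζ]
  obtain ⟨h1, h2⟩ := isDomain_and_completelyIntClosed_famRel (IsLocalRing.ResidueField 𝒪) m
    hq hq3 hp hN
  have h3 := stronglyRegular_famRel (IsLocalRing.ResidueField 𝒪) m hq hq3 hp hN
  rw [← hfam] at h1 h2 h3
  refine isDomain_and_completelyIntClosed_quotient_span (ϖ := MvPowerSeries.C ϖ) (fun x hx => ?_)
    (MvPowerSeries.map (IsLocalRing.residue 𝒪)) ?_ (fun x => ⟨fun h => ?_, ?_⟩) h3 h2
  · ext d
    have := congrArg (MvPowerSeries.coeff d) hx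
    rw [MvPowerSeries.coeff_C_mul, map_zero] at this
    rw [map_zero]
    exact (mul_eq_zero.1 this).resolve_left hϖ.ne_zero
  · intro x
    choose y hy using fun d => IsLocalRing.residue_surjective (MvPowerSeries.coeff d x)
    let y' : MvPowerSeries (GenVar m N) 𝒪 := y
    refine ⟨y', ?_⟩
    ext d
    rw [MvPowerSeries.coeff_map, ← hy]
    rfl
  · have h4 : ∀ d, ∃ y, MvPowerSeries.coeff d x = ϖ * y := fun d => by
      have := congrArg (MvPowerSeries.coeff d) h
      rw [MvPowerSeries.coeff_map, map_zero, IsLocalRing.residue_eq_zero_iff,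
        hϖ.maximalIdeal_eq, Ideal.mem_span_singleton] at this
      exact this
    choose y hy using h4
    let y' : MvPowerSeries (GenVar m N) 𝒪 := y
    refine ⟨y', ?_⟩
    ext d
    rw [MvPowerSeries.coeff_C_mul, hy]
    rfl
  · rintro ⟨y, rfl⟩
    have : IsLocalRing.residue 𝒪 ϖ = 0 := by
      rw [IsLocalRing.residue_eq_zero_iff, hϖ.maximalIdeal_eq]
      exact Ideal.mem_span_singleton_self ϖ
    rw [map_mul, MvPowerSeries.map_C, this, map_zero, zero_mul]

end

theorem isDomain_and_isIntegrallyClosed_of_surjective {R R' T : Type*} [CommRing R] [CommRing R']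
    [CommRing T] [Algebra R T] (P : Ideal R) [P.IsPrime] [IsLocalization.AtPrime T P]
    (f : R →+* R') (hf : Function.Surjective f) (hker : ∀ x, f x = 0 → algebraMap R T x = 0)
    [IsDomain R'] [IsIntegrallyClosed R'] : IsDomain T ∧ IsIntegrallyClosed T := by
  let g : R' →+* T := RingHom.liftOfSurjective f hf
    ⟨algebraMap R T, fun x hx => hker x hx⟩
  have hg : ∀ x, g (f x) = algebraMap R T x := fun x =>
    RingHom.liftOfRightInverse_comp_apply f _ _ ⟨algebraMap R T, fun x hx => hker x hx⟩ x
  let : Algebra R' T := g.toAlgebra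
  have hM : P.primeCompl.map f ≤ nonZeroDivisors R' := by
    refine le_nonZeroDivisors_of_noZeroDivisors ?_
    rintro ⟨x, hx, hx0⟩
    have h1 := IsLocalization.map_units T (⟨x, hx⟩ : P.primeCompl)
    rw [hker x hx0] at h1
    have := IsLocalization.AtPrime.nontrivial T P
    exact not_isUnit_zero h1
  have hloc : IsLocalization (P.primeCompl.map f) T := by
    refine ⟨?_, ?_, ?_⟩
    · rintro ⟨_, x, hx, rfl⟩
      have h1 := IsLocalization.map_units T (⟨x, hx⟩ : P.primeCompl)
      rw [← hg] at h1
      exact h1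
    · intro z
      obtain ⟨⟨x, s⟩, h⟩ := IsLocalization.surj P.primeCompl z
      refine ⟨⟨f x, ⟨f s, s, s.2, rfl⟩⟩, ?_⟩
      rw [← hg, ← hg] at h
      exact h
    · intro x y h
      obtain ⟨x, rfl⟩ := hf x
      obtain ⟨y, rfl⟩ := hf y
      change g (f x) = g (f y) at h
      rw [hg, hg] at h
      obtain ⟨c, hc⟩ := IsLocalization.exists_of_eq (M := P.primeCompl) h
      refine ⟨⟨f c, c, c.2, rfl⟩, ?_⟩
      rw [← map_mul, hc, map_mul]
  exact ⟨IsLocalization.isDomain_of_le_nonZeroDivisors T hM,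
    isIntegrallyClosed_of_isLocalization T _ hM⟩

theorem isIrreducible_connectedComponent {X : Type*} [TopologicalSpace X]
    [TopologicalSpace.NoetherianSpace X]
    (h : ∀ Z ∈ irreducibleComponents X, ∀ W ∈ irreducibleComponents X, ∀ x ∈ Z, x ∈ W → Z = W)
    (x : X) : IsIrreducible (connectedComponent x) := by
  set Z := irreducibleComponent x with hZdef
  have hZ := irreducibleComponent_mem_irreducibleComponents x
  rw [← hZdef] at hZ
  have hx : x ∈ Z := mem_irreducibleComponent
  have hcompl : Zᶜ = ⋃₀ (irreducibleComponents X \ {Z}) := by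
    ext y
    constructor
    · intro hy
      refine ⟨irreducibleComponent y, ⟨irreducibleComponent_mem_irreducibleComponents y, ?_⟩,
        mem_irreducibleComponent⟩
      intro h1
      rw [Set.mem_singleton_iff] at h1
      exact hy (h1 ▸ mem_irreducibleComponent)
    · rintro ⟨W, ⟨hW, hWZ⟩, hy⟩ hyZ
      exact hWZ (h W hW Z hZ y hy hyZ)
  have hclopen : IsClopen Z := by
    refine ⟨isClosed_of_mem_irreducibleComponents Z hZ, ?_⟩
    rw [← isClosed_compl_iff, hcompl, Set.sUnion_eq_biUnion]
    exact (TopologicalSpace.NoetherianSpace.finite_irreducibleComponents.sdiff).isClosed_biUnion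
      fun W hW => isClosed_of_mem_irreducibleComponents W hW.1
  have : connectedComponent x = Z := (hclopen.connectedComponent_subset hx).antisymm
    (isIrreducible_irreducibleComponent.isConnected.isPreconnected.subset_connectedComponent hx)
  rw [this]
  exact isIrreducible_irreducibleComponent

theorem isIrreducible_connectedComponent_of_isDomain {Q : Type*} [CommRing Q] [IsNoetherianRing Q]
    (h : ∀ (P : Ideal Q) (hP : P.IsPrime), IsDomain (@Localization.AtPrime _ _ P hP))
    (x : PrimeSpectrum Q) : IsIrreducible (connectedComponent x) := by
  refine isIrreducible_connectedComponent (fun Z hZ W hW y hyZ hyW => ?_) x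
  have := h y.asIdeal y.2
  let k := RingHom.ker (algebraMap Q (Localization.AtPrime y.asIdeal))
  have hk : k.IsPrime := RingHom.ker_isPrime _
  have key : ∀ V ∈ irreducibleComponents (PrimeSpectrum Q), y ∈ V →
      PrimeSpectrum.vanishingIdeal V = k := by
    intro V hV hyV
    have hmin : PrimeSpectrum.vanishingIdeal V ∈ minimalPrimes Q := by
      rw [← PrimeSpectrum.vanishingIdeal_irreducibleComponents]
      exact ⟨V, hV, rfl⟩
    have hle : k ≤ PrimeSpectrum.vanishingIdeal V := by
      intro z hz
      obtain ⟨c, hc⟩ := (IsLocalization.map_eq_zero_iff y.asIdeal.primeCompl _ z).1 hz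
      have hp : (PrimeSpectrum.vanishingIdeal V).IsPrime := hmin.1.1
      refine (hp.mem_or_mem (x := (c : Q)) (y := z) (by rw [hc]; exact Ideal.zero_mem _)).resolve_left
        fun hcV => c.2 ?_
      exact (PrimeSpectrum.mem_vanishingIdeal _ _).1 hcV y hyV
    exact le_antisymm (hmin.2 ⟨hk, bot_le⟩ hle) hle
  have hcl := isClosed_of_mem_irreducibleComponents (X := PrimeSpectrum Q)
  rw [← (hcl Z hZ).closure_eq, ← (hcl W hW).closure_eq,
    ← PrimeSpectrum.zeroLocus_vanishingIdeal_eq_closure,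
    ← PrimeSpectrum.zeroLocus_vanishingIdeal_eq_closure, key Z hZ hyZ, key W hW hyW]

section RingOfIntegers
variable (p : ℕ) [Fact p.Prime] (L : Type*) [Field L] [Algebra ℚ_[p] L] [Algebra ℤ_[p] L]

theorem natCast_ne_zero_integralClosure : (p : integralClosure ℤ_[p] L) ≠ 0 := by
  intro h
  have h1 := congrArg (algebraMap (integralClosure ℤ_[p] L) L) h
  rw [map_natCast, map_zero, ← map_natCast (algebraMap ℚ_[p] L), map_eq_zero] at h1
  exact (Fact.out : p.Prime).ne_zero (by exact_mod_cast h1)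

variable [IsScalarTower ℤ_[p] ℚ_[p] L]

theorem not_isUnit_natCast_integralClosure : ¬ IsUnit (p : integralClosure ℤ_[p] L) := by
  intro h
  have hinj : Function.Injective (algebraMap ℤ_[p] L) := by
    rw [IsScalarTower.algebraMap_eq ℤ_[p] ℚ_[p] L]
    exact (algebraMap ℚ_[p] L).injective.comp (IsFractionRing.injective ℤ_[p] ℚ_[p])
  have : FaithfulSMul ℤ_[p] L := (faithfulSMul_iff_algebraMap_injective _ _).2 hinj
  have hi : IsLocalHom (algebraMap ℤ_[p] (integralClosure ℤ_[p] L)) :=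
    Algebra.IsIntegral.isLocalHom ..
  rw [← map_natCast (algebraMap ℤ_[p] _)] at h
  exact PadicInt.p_nonunit (isUnit_of_map_unit _ _ h)

theorem natCast_residueField_eq_zero [IsLocalRing (integralClosure ℤ_[p] L)] :
    (p : IsLocalRing.ResidueField (integralClosure ℤ_[p] L)) = 0 := by
  rw [← map_natCast (IsLocalRing.residue _), IsLocalRing.residue_eq_zero_iff]
  exact not_isUnit_natCast_integralClosure p L

variable [FiniteDimensional ℚ_[p] L]

theorem isIntegral_of_spectralNorm_le_one {x : L} (hx : spectralNorm ℚ_[p] L x ≤ 1) :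
    IsIntegral ℤ_[p] x := by
  have hint : IsIntegral ℚ_[p] x := Algebra.IsIntegral.isIntegral x
  have hmon := minpoly.monic hint
  have h1 := (spectralValue_le_one_iff hmon).1 hx
  have hl : minpoly ℚ_[p] x ∈ Polynomial.lifts (algebraMap ℤ_[p] ℚ_[p]) := by
    rw [Polynomial.lifts_iff_coeff_lifts]
    exact fun n => ⟨⟨_, h1 n⟩, rfl⟩
  obtain ⟨P, hP, -, hPm⟩ := Polynomial.lifts_and_natDegree_eq_and_monic hl hmon
  refine ⟨P, hPm, ?_⟩
  rw [IsScalarTower.algebraMap_eq ℤ_[p] ℚ_[p] L, ← Polynomial.eval₂_map, hP]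
  exact minpoly.aeval _ _

instance : IsFractionRing (integralClosure ℤ_[p] L) L :=
  integralClosure.isFractionRing_of_finite_extension ℚ_[p] L

theorem valuationRing_integralClosure : ValuationRing (integralClosure ℤ_[p] L) := by
  rw [ValuationRing.iff_isInteger_or_isInteger _ L]
  intro x
  have key : ∀ y : L, spectralNorm ℚ_[p] L y ≤ 1 →
      IsLocalization.IsInteger (integralClosure ℤ_[p] L) y := fun y hy =>
    ⟨⟨y, isIntegral_of_spectralNorm_le_one p L hy⟩, rfl⟩
  by_cases hx : spectralNorm ℚ_[p] L x ≤ 1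
  · exact Or.inl (key x hx)
  · refine Or.inr (key _ ?_)
    rcases eq_or_ne x 0 with rfl | h0
    · rw [inv_zero, spectralNorm_zero]; exact zero_le_one
    have h1 : spectralMulAlgNorm ℚ_[p] L (x * x⁻¹) = _ := map_mul _ _ _
    rw [mul_inv_cancel₀ h0, map_one] at h1
    change 1 = spectralNorm ℚ_[p] L x * spectralNorm ℚ_[p] L x⁻¹ at h1
    have := spectralNorm_nonneg (K := ℚ_[p]) x⁻¹
    push Not at hx
    nlinarith

theorem isDiscreteValuationRing_integralClosure :
    IsDiscreteValuationRing (integralClosure ℤ_[p] L) := by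
  have := valuationRing_integralClosure p L
  have : IsNoetherianRing (integralClosure ℤ_[p] L) :=
    IsIntegralClosure.isNoetherianRing ℤ_[p] ℚ_[p] L _
  have hf : ¬ IsField (integralClosure ℤ_[p] L) := fun h =>
    not_isUnit_natCast_integralClosure p L
      ((h.mul_inv_cancel (natCast_ne_zero_integralClosure p L)).elim fun _ => .of_mul_eq_one _)
  exact ((IsDiscreteValuationRing.TFAE _ hf).out 0 1 rfl rfl).2 inferInstance

end RingOfIntegers

theorem residue_eq_one_of_pow_eq_one {𝒪 : Type*} [CommRing 𝒪] [IsLocalRing 𝒪] {p s : ℕ}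
    [Fact p.Prime] (hp : (p : IsLocalRing.ResidueField 𝒪) = 0) {ζ : 𝒪} (hζ : ζ ^ p ^ s = 1) :
    IsLocalRing.residue 𝒪 ζ = 1 := by
  have : CharP (IsLocalRing.ResidueField 𝒪) p :=
    ringChar.of_eq (CharP.ringChar_of_prime_eq_zero Fact.out hp)
  rw [← sub_eq_zero]
  apply eq_zero_of_pow_eq_zero (n := p ^ s)
  rw [sub_pow_char_pow, ← map_pow, hζ, map_one, one_pow, sub_self]

theorem exists_isPrimitiveRoot_of_le_card {L : Type*} [Field L] {p s : ℕ} (hp : p.Prime)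
    (h0 : 2 ≤ p ^ s)
    (h : p ^ s ≤ Nat.card {ζ : L // ∃ t : ℕ, ζ ^ p ^ t = 1}) :
    ∃ ζ : L, IsPrimitiveRoot ζ (p ^ s) := by
  classical
  have hfin : Finite {ζ : L // ∃ t : ℕ, ζ ^ p ^ t = 1} :=
    Nat.finite_of_card_ne_zero (by omega)
  by_contra! hno
  have hs : s ≠ 0 := by rintro rfl; simp at h0
  have hpos : 0 < p ^ (s - 1) := pow_pos hp.pos _
  have key : ∀ ζ : L, (∃ t : ℕ, ζ ^ p ^ t = 1) → ζ ∈ Polynomial.nthRootsFinset (p ^ (s - 1)) (1 : L) := by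
    rintro ζ ⟨t, ht⟩
    rw [Polynomial.mem_nthRootsFinset hpos]
    obtain ⟨k, -, hk⟩ := (Nat.dvd_prime_pow hp).1 (orderOf_dvd_of_pow_eq_one ht)
    by_cases hks : s ≤ k
    · refine absurd ?_ (hno (ζ ^ p ^ (k - s)))
      refine (IsPrimitiveRoot.orderOf ζ).pow (by rw [hk]; exact pow_pos hp.pos _) ?_
      rw [hk, ← pow_add]
      congr 1
      omega
    · rw [← orderOf_dvd_iff_pow_eq_one, hk]
      exact pow_dvd_pow _ (by omega)
  have h1 : Nat.card {ζ : L // ∃ t : ℕ, ζ ^ p ^ t = 1} ≤ p ^ (s - 1) := by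
    let f : {ζ : L // ∃ t : ℕ, ζ ^ p ^ t = 1} → Polynomial.nthRootsFinset (p ^ (s - 1)) (1 : L) :=
      fun x => ⟨x.1, key x.1 x.2⟩
    have hf : Function.Injective f := fun x y hxy => by
      have := Subtype.ext_iff.1 hxy
      exact Subtype.ext this
    refine (Nat.card_le_card_of_injective f hf).trans ?_
    rw [Nat.card_eq_fintype_card, Fintype.card_coe]
    refine (Multiset.toFinset_card_le _).trans (Polynomial.card_nthRoots _ _)
  have h2 : p ^ (s - 1) < p ^ s := Nat.pow_lt_pow_right hp.one_lt (by omega)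
  omega

theorem exists_isPrimitiveRoot_integralClosure {A L : Type*} [CommRing A] [Field L] [Algebra A L]
    {k : ℕ} (hk : 0 < k) {ζ : L} (hζ : IsPrimitiveRoot ζ k) :
    ∃ ξ : integralClosure A L, IsPrimitiveRoot ξ k := by
  have hint : IsIntegral A ζ := hζ.isIntegral hk |>.tower_top
  refine ⟨⟨ζ, hint⟩, ?_⟩
  exact IsPrimitiveRoot.of_map_of_injective (f := (integralClosure A L).val) hζ Subtype.val_injective

section

open QuadVar

theorem Matrix.eq_one_of_det_eq_one {R : Type*} [CommRing R] {N : ℕ}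
    {M : Matrix (Fin (N + 1)) (Fin (N + 1)) R}
    (h : ∀ i j, (i, j) ≠ (0, 0) → M i j = (1 : Matrix (Fin (N + 1)) (Fin (N + 1)) R) i j)
    (hdet : M.det = 1) : M = 1 := by
  have hM : M = Matrix.diagonal fun i => if i = 0 then M 0 0 else 1 := by
    ext i j
    by_cases hij : (i, j) = (0, 0)
    · obtain ⟨rfl, rfl⟩ := Prod.mk.inj hij
      simp
    · rw [h i j hij]
      rcases eq_or_ne i j with rfl | hne
      · have : i ≠ 0 := fun h0 => hij (by rw [h0])
        simp [this]
      · rw [Matrix.one_apply_ne hne, Matrix.diagonal_apply_ne _ hne]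
  have h0 : M 0 0 = 1 := by
    rw [hM, Matrix.det_diagonal, Finset.prod_ite_eq' Finset.univ] at hdet
    simpa using hdet
  rw [hM, h0]
  simp

section
variable {𝒪 : Type*} [CommRing 𝒪] {q m N : ℕ}

/-- The determinant of the first generic matrix. -/
noncomputable abbrev detXt (𝒪 : Type*) [CommRing 𝒪] (m N : ℕ) : MvPowerSeries (GenVar m N) 𝒪 :=
  (Xt (2 * (m + 1) + 2) (N + 1) ⟨0, by omega⟩).det

theorem relMatrix_map_eq_one_iff {R : Type*} [CommRing R]
    (f : MvPowerSeries (GenVar m N) 𝒪 →+* R) :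
    (relMatrix q (m + 1) (N + 1)).map f = 1 ↔ relIdeal q (m + 1) (N + 1) ≤ RingHom.ker f := by
  rw [relIdeal, Ideal.span_le, ← sub_eq_zero, ← Matrix.map_one f (map_zero f) (map_one f),
    ← Matrix.map_sub _ (map_sub f)]
  constructor
  · rintro h _ ⟨⟨i, j⟩, rfl⟩
    exact congrFun (congrFun h i) j
  · intro h
    ext i j
    exact h ⟨(i, j), rfl⟩

theorem relIdeal_le_span_famRel {ζ : 𝒪} (hζ : ζ ^ q = 1) :
    relIdeal q (m + 1) (N + 1) ≤ Ideal.span (Set.range (famRel 𝒪 q m N ζ)) := by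
  set I := Ideal.span (Set.range (famRel 𝒪 q m N ζ))
  have hmem : ∀ l, famRel 𝒪 q m N ζ l ∈ I := fun l => Ideal.subset_span ⟨l, rfl⟩
  rw [← Ideal.mk_ker (I := I), ← relMatrix_map_eq_one_iff]
  apply Matrix.eq_one_of_det_eq_one
  · intro i j hij
    have h1 : (relMatrix q (m + 1) (N + 1) - 1 : Matrix _ _ (MvPowerSeries (GenVar m N) 𝒪)) i j ∈
        I := by
      rcases lt_trichotomy i j with hlt | rfl | hlt
      · exact hmem (Sum.inl ⟨(j, i), hlt⟩)
      · exact hmem (Sum.inr (Sum.inr (Sum.inl ⟨i, fun h => hij (by rw [h])⟩)))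
      · exact hmem (Sum.inr (Sum.inl ⟨(i, j), hlt⟩))
    rw [Matrix.sub_apply, ← Ideal.Quotient.mk_eq_mk_iff_sub_mem] at h1
    rw [Matrix.map_apply, h1, ← Matrix.map_apply (f := Ideal.Quotient.mk I),
      Matrix.map_one _ (map_zero _) (map_one _)]
  · have h1 : detXt 𝒪 m N - MvPowerSeries.C ζ ∈ I := hmem (Sum.inr (Sum.inr (Sum.inr ())))
    rw [← Ideal.Quotient.mk_eq_mk_iff_sub_mem] at h1
    rw [← RingHom.mapMatrix_apply, ← RingHom.map_det, det_relMatrix, map_pow, h1, ← map_pow,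
      ← map_pow, hζ, map_one, map_one]

theorem span_famRel_le {ζ : 𝒪} {J : Ideal (MvPowerSeries (GenVar m N) 𝒪)}
    (hJ : relIdeal q (m + 1) (N + 1) ≤ J) (hζ : detXt 𝒪 m N - MvPowerSeries.C ζ ∈ J) :
    Ideal.span (Set.range (famRel 𝒪 q m N ζ)) ≤ J := by
  have key : ∀ i j, (relMatrix q (m + 1) (N + 1) - 1 :
      Matrix _ _ (MvPowerSeries (GenVar m N) 𝒪)) i j ∈ J := fun i j =>
    hJ (Ideal.subset_span ⟨(i, j), rfl⟩)
  rw [Ideal.span_le]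
  rintro _ ⟨p | p | p | p, rfl⟩
  · exact key _ _
  · exact key _ _
  · exact key _ _
  · exact hζ

theorem detXt_pow_eq_one :
    (Ideal.Quotient.mk (relIdeal q (m + 1) (N + 1)) (detXt 𝒪 m N)) ^ q = 1 := by
  have h := (relMatrix_map_eq_one_iff (q := q) (Ideal.Quotient.mk
    (relIdeal (A := 𝒪) q (m + 1) (N + 1)))).2 (by rw [Ideal.mk_ker])
  rw [← map_pow, ← det_relMatrix, RingHom.map_det, RingHom.mapMatrix_apply, h, Matrix.det_one]

end

theorem exists_mk_eq_zero_of_isPrimitiveRoot {𝒪 R T : Type*} [CommRing 𝒪] [IsDomain 𝒪]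
    [CommRing R] [Algebra 𝒪 R] [CommRing T] [IsLocalRing T] [Algebra R T] {q : ℕ} (hq : 0 < q)
    {ζ : 𝒪} (hζ : IsPrimitiveRoot ζ q) {δ : R} (hδ : δ ^ q = 1)
    (hunit : ∀ c : 𝒪, c ≠ 0 → IsUnit (algebraMap R T (algebraMap 𝒪 R c))) :
    ∃ ξ : 𝒪, ξ ^ q = 1 ∧ algebraMap R T (δ - algebraMap 𝒪 R ξ) = 0 := by
  have hprod : ∏ ξ ∈ Polynomial.nthRootsFinset q (1 : 𝒪),
      algebraMap R T (δ - algebraMap 𝒪 R ξ) = 0 := by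
    have h := congrArg (Polynomial.aeval δ) (Polynomial.X_pow_sub_one_eq_prod hq hζ)
    rw [map_sub, map_pow, Polynomial.aeval_X, map_one, hδ, sub_self, map_prod] at h
    rw [← map_prod, ← map_zero (algebraMap R T), h]
    congr 1
    refine Finset.prod_congr rfl fun ξ _ => ?_
    rw [map_sub, Polynomial.aeval_X, Polynomial.aeval_C]
  obtain ⟨ξ, hξ, hnu⟩ : ∃ ξ ∈ Polynomial.nthRootsFinset q (1 : 𝒪),
      ¬ IsUnit (algebraMap R T (δ - algebraMap 𝒪 R ξ)) := by
    by_contra! hall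
    have h := (IsUnit.submonoid T).prod_mem hall
    rw [hprod] at h
    exact not_isUnit_zero h
  refine ⟨ξ, (Polynomial.mem_nthRootsFinset hq _).1 hξ, ?_⟩
  classical
  rw [← Finset.mul_prod_erase _ _ hξ] at hprod
  refine (IsUnit.mul_left_eq_zero ((IsUnit.submonoid T).prod_mem fun η hη => ?_)).1 hprod
  by_contra hnu'
  refine IsLocalRing.nonunits_add hnu' (mem_nonunits_iff.2 fun h => hnu (IsUnit.neg_iff _ |>.1 h)) ?_
  have h := hunit (ξ - η) (sub_ne_zero.2 (Finset.ne_of_mem_erase hη).symm)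
  rw [← sub_eq_add_neg, ← map_sub, sub_sub_sub_cancel_left, ← map_sub]
  exact h

end

section

open QuadVar

theorem isUnit_algebraMap_of_ne_zero {𝒪 R T : Type*} [CommRing 𝒪] [IsDomain 𝒪]
    [IsDiscreteValuationRing 𝒪] [CommRing R] [Algebra 𝒪 R] [CommRing T] [Algebra R T]
    (P : Ideal R) [hP : P.IsPrime] [IsLocalization.AtPrime T P] {x : 𝒪}
    (hx : ¬ IsUnit x) (hxP : algebraMap 𝒪 R x ∉ P) {c : 𝒪} (hc : c ≠ 0) :
    IsUnit (algebraMap R T (algebraMap 𝒪 R c)) := by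
  refine IsLocalization.map_units T (⟨algebraMap 𝒪 R c, fun hcP => hxP ?_⟩ : P.primeCompl)
  have hJ : (P.comap (algebraMap 𝒪 R)).IsPrime := Ideal.comap_isPrime _ _
  have hmax : (P.comap (algebraMap 𝒪 R)).IsMaximal :=
    hJ.isMaximal fun h => hc (by rw [← Ideal.mem_bot, ← h]; exact hcP)
  have hx' : x ∈ IsLocalRing.maximalIdeal 𝒪 := hx
  rw [← IsLocalRing.eq_maximalIdeal hmax] at hx'
  exact hx'

theorem isDomain_and_isIntegrallyClosed_of_notMem {𝒪 : Type*} [CommRing 𝒪] [IsDomain 𝒪]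
    [IsDiscreteValuationRing 𝒪] {m N p s q : ℕ} [Fact p.Prime] (hq : q = p ^ s) (hq3 : 3 ≤ q)
    (hp : (p : IsLocalRing.ResidueField 𝒪) = 0) (hN : 1 ≤ N) {ζ : 𝒪} (hζ : IsPrimitiveRoot ζ q)
    {T : Type*} [CommRing T] [Algebra (defRing (A := 𝒪) q (m + 1) (N + 1)) T]
    (P : Ideal (defRing (A := 𝒪) q (m + 1) (N + 1))) [P.IsPrime] [IsLocalization.AtPrime T P]
    (hpP : (p : defRing (A := 𝒪) q (m + 1) (N + 1)) ∉ P) :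
    IsDomain T ∧ IsIntegrallyClosed T := by
  have hloc : IsLocalRing T := IsLocalization.AtPrime.isLocalRing T P
  have hpu : ¬ IsUnit (p : 𝒪) := by
    rwa [← map_natCast (IsLocalRing.residue 𝒪), IsLocalRing.residue_eq_zero_iff] at hp
  obtain ⟨ξ, hξ, hξT⟩ := exists_mk_eq_zero_of_isPrimitiveRoot (T := T) (by omega) hζ
    (detXt_pow_eq_one (𝒪 := 𝒪) (q := q) (m := m) (N := N)) fun c hc =>
      isUnit_algebraMap_of_ne_zero P hpu (by rwa [map_natCast]) hc
  have hres : IsLocalRing.residue 𝒪 ξ = 1 := residue_eq_one_of_pow_eq_one (s := s) hp (hq ▸ hξ)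
  obtain ⟨h1, h2⟩ := isDomain_and_completelyIntClosed_famRel_of_dvr m hq hq3 hp hN hres
  have h3 := h2.isIntegrallyClosed
  refine isDomain_and_isIntegrallyClosed_of_surjective P
    (Ideal.Quotient.factor (relIdeal_le_span_famRel (m := m) (N := N) hξ))
    (Ideal.Quotient.factor_surjective _) fun x hx => ?_
  obtain ⟨x, rfl⟩ := Ideal.Quotient.mk_surjective x
  rw [Ideal.Quotient.factor_mk, Ideal.Quotient.eq_zero_iff_mem] at hx
  refine (span_famRel_le (J := RingHom.ker ((algebraMap _ T).comp
    (Ideal.Quotient.mk (relIdeal q (m + 1) (N + 1))))) ?_ ?_) hx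
  · intro y hy
    rw [RingHom.mem_ker, RingHom.comp_apply, Ideal.Quotient.eq_zero_iff_mem.2 hy, map_zero]
  · exact hξT

instance (p : ℕ) (A : Type*) [CommRing A] (q m n : ℕ) :
    IsLocalization.Away (p : defRing (A := A) q m n) (genericFiberRing p A q m n) :=
  inferInstanceAs (IsLocalization.Away _ (Localization.Away (p : defRing (A := A) q m n)))

instance (p : ℕ) (A : Type*) [CommRing A] [IsNoetherianRing A] (q m n : ℕ) :
    IsNoetherianRing (genericFiberRing p A q m n) :=
  IsLocalization.isNoetherianRing (.powers (p : defRing (A := A) q m n)) _ inferInstance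

theorem isDomain_and_isIntegrallyClosed_localization_genericFiberRing {𝒪 : Type*} [CommRing 𝒪]
    [IsDomain 𝒪] [IsDiscreteValuationRing 𝒪] {m N p s q : ℕ} [Fact p.Prime] (hq : q = p ^ s)
    (hq3 : 3 ≤ q) (hp : (p : IsLocalRing.ResidueField 𝒪) = 0) (hN : 1 ≤ N) {ζ : 𝒪}
    (hζ : IsPrimitiveRoot ζ q) (P : Ideal (genericFiberRing p 𝒪 q (m + 1) (N + 1)))
    [hP : P.IsPrime] :
    IsDomain (Localization.AtPrime P) ∧ IsIntegrallyClosed (Localization.AtPrime P) := by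
  let R := defRing (A := 𝒪) q (m + 1) (N + 1)
  have := IsLocalization.isLocalization_isLocalization_atPrime_isLocalization (.powers (p : R))
    (Localization.AtPrime P) P
  refine isDomain_and_isIntegrallyClosed_of_notMem hq hq3 hp hN hζ
    (P.comap (algebraMap R (genericFiberRing p 𝒪 q (m + 1) (N + 1)))) fun h => ?_
  exact hP.ne_top (Ideal.eq_top_of_isUnit_mem _ h
    (IsLocalization.map_units _ (⟨(p : R), Submonoid.mem_powers _⟩ : Submonoid.powers (p : R))))

end

/-- `X^□ = Spec R[1/p]` is normal: the localization of `R[1/p]` at any prime is an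
integrally closed domain.  In particular the connected components of `Spec R[1/p]` are
irreducible. -/
theorem generic_fiber_is_normal
    (p s q m n : ℕ) (hs : 1 ≤ s) (hq : q = p ^ s) (hq3 : 3 ≤ q)
    (hm : 1 ≤ m) (hn : 2 ≤ n) [Fact p.Prime]
    (L : Type) [Field L] [Algebra ℚ_[p] L] [FiniteDimensional ℚ_[p] L]
    [Algebra ℤ_[p] L] [IsScalarTower ℤ_[p] ℚ_[p] L]
    (K : Type) [Field K] [Algebra ℚ_[p] K] [FiniteDimensional ℚ_[p] K]
    (hd : Module.finrank ℚ_[p] K = 2 * m)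
    (hK : Nat.card {ζ : K // ∃ t : ℕ, ζ ^ p ^ t = 1} = q)
    (hL : q ≤ Nat.card {ζ : L // ∃ t : ℕ, ζ ^ p ^ t = 1}) :
    (∀ (P : Ideal (genericFiberRing p (RingOfIntegers p L) q m n)) (hP : P.IsPrime),
      IsDomain (@Localization.AtPrime _ _ P hP) ∧
        IsIntegrallyClosed (@Localization.AtPrime _ _ P hP)) ∧
    (∀ x : PrimeSpectrum (genericFiberRing p (RingOfIntegers p L) q m n),
      IsIrreducible (connectedComponent x)) := by
  obtain ⟨m, rfl⟩ := Nat.exists_eq_add_of_le' hm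
  obtain ⟨N, rfl⟩ := Nat.exists_eq_add_of_le' hn
  have hdvr : IsDiscreteValuationRing (RingOfIntegers p L) :=
    isDiscreteValuationRing_integralClosure p L
  obtain ⟨ζ, hζ⟩ := exists_isPrimitiveRoot_of_le_card (L := L) (s := s) (Fact.out : p.Prime)
    (by omega) (hq ▸ hL)
  rw [← hq] at hζ
  obtain ⟨ξ, hξ⟩ := exists_isPrimitiveRoot_integralClosure (A := ℤ_[p]) (by omega) hζ
  have key := fun (P : Ideal (genericFiberRing p (RingOfIntegers p L) q (m + 1) (N + 2)))
      (hP : P.IsPrime) => isDomain_and_isIntegrallyClosed_localization_genericFiberRing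
    hq hq3 (natCast_residueField_eq_zero p L) (Nat.le_add_left 1 N) hξ P
  exact ⟨key, isIrreducible_connectedComponent_of_isDomain fun P hP => (key P hP).1⟩
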